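/- Let I ⊂ ℝ be a finite interval and N ∈ ℤ_{≥0}. For each λ₀ > 0 there is a constant C (depending only on I, N and λ₀, and which can be taken depending only on I and N when λ ≥ 1) such that for every s = σ + it with σ ∈ I and t ≥ 2π, and all real α, β ≥ 1 with t = 2παβ and λ := √(α/β) ≥ λ₀, setting a := α − ⌊α⌋, b := β − ⌊β⌋ and ω_λ := e^{−πi/4}·√(π/2)·(aλ^{−1} − bλ), one has |ζ(s) − Σ_{n ≤ α} n^{−s} − χ(s)·Σ_{n ≤ β} n^{−(1−s)} − (−1)^{⌊α⌋⌊β⌋}·((2π)^s e^{πis/2}/(Γ(s)(e^{2πis} − 1)))·(2π/t)^{1/4}·λ^{1/2−s}·exp((πi/2)·[2aβ − 2bα + a²λ^{−2} − b²λ²])·exp((s/2 − 1/4)·log(t/(2π)) − it/2 − iπ/8)·Σ_{k=0}^{N−1} a_k(s)·Σ_{r=0}^k binom(k,r)·G^{(r)}(aλ^{−1} + bλ; λ²)·(e^{πi(k−3r)/4}/(2^{k−r}(2π)^{r/2}))·H_{k−r}(ω_λ)| ≤ C·λ^{1−σ}·t^{−σ/2 − N/6}, where the sums over n run over positive integers satisfying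 the stated inequality. -/

import Mathlib

open Complex Real MeasureTheory

noncomputable section

def chi (s : ℂ) : ℂ := (π : ℂ) ^ (s - 1/2) * Complex.Gamma ((1 - s)/2) / Complex.Gamma (s/2)

def RSOmega : Set ℂ := {s : ℂ | s.im ≠ 0 ∨ (0 < s.re ∧ s.re < 1)}

def IsRSTheta (ϑ : ℂ → ℂ) : Prop :=
  DifferentiableOn ℂ ϑ RSOmega ∧ (∀ s ∈ RSOmega, Complex.exp (-2 * I * ϑ s) = chi s) ∧
    ϑ (1/2) = 0

def zetaSum (x : ℝ) (s : ℂ) : ℂ := ∑ n ∈ Finset.Icc 1 ⌊x⌋₊, (n : ℂ) ^ (-s)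

def Upsilon (u τ : ℂ) : ℂ :=
  ∫ v : ℝ, Complex.exp (3 * (π:ℂ) * I / 4) *
    (Complex.exp (-(π:ℂ) * I * τ * (1/2 + Complex.exp (3 * (π:ℂ) * I / 4) * v) ^ 2
        + 2 * (π:ℂ) * I * u * (1/2 + Complex.exp (3 * (π:ℂ) * I / 4) * v)) /
      (Complex.exp (2 * (π:ℂ) * I * (1/2 + Complex.exp (3 * (π:ℂ) * I / 4) * v)) - 1))

def G (u τ : ℂ) : ℂ :=
  τ ^ ((1:ℂ)/4) * Complex.exp (-(π:ℂ) * I * u ^ 2 / 2 + (π:ℂ) * I / 8) *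
    Upsilon (τ ^ ((1:ℂ)/2) * u) τ

def Gderiv (k : ℕ) (u τ : ℂ) : ℂ := iteratedDeriv k (fun w => G w τ) u

def hermiteH (n : ℕ) (x : ℂ) : ℂ :=
  (Nat.factorial n : ℂ) * ∑ j ∈ Finset.range (n / 2 + 1),
    (-1:ℂ) ^ j / ((Nat.factorial j : ℂ) * (Nat.factorial (n - 2*j) : ℂ)) * (2 * x) ^ (n - 2*j)

def obell (p : ℕ → ℂ) (i j : ℕ) : ℂ :=
  ∑ f ∈ (Finset.Nat.antidiagonalTuple j i).filter (fun f => ∀ l, 1 ≤ f l), ∏ l, p (f l)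

def bernoulliPoly (n : ℕ) (x : ℂ) : ℂ := Polynomial.aeval x (Polynomial.bernoulli n)

def fseq (σ : ℝ) (n : ℕ) : ℂ :=
  (bernoulliPoly (n+1) ((σ:ℂ)/2) + (-1:ℂ)^(n+1) * bernoulliPoly (n+1) ((1-(σ:ℂ))/2)) /
    (2*(n:ℂ)*((n:ℂ)+1))

def um (m : ℕ) (σ : ℝ) : ℂ :=
  (-2:ℂ)^m * ∑ k ∈ Finset.range (m+1), obell (fseq σ) m k / (Nat.factorial k : ℂ)

def seqA (j : ℕ) : ℂ := (-1:ℂ)^(j+1) / ((j:ℂ) + 2)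

def seqB (j : ℕ) : ℂ := (-1:ℂ)^(j+1) / (j:ℂ)

def dd (m r : ℕ) (σ : ℝ) : ℂ :=
  ∑ n ∈ Finset.Icc r m, (obell seqA n r / (Nat.factorial r : ℂ)) *
    ∑ k ∈ Finset.range (m - n + 1),
      (obell seqB (m - n) k / (Nat.factorial k : ℂ)) * ((σ:ℂ) - 1)^k

def qq (n ℓ : ℕ) (σ : ℝ) : ℂ :=
  ∑ m ∈ Finset.Icc (ℓ - n) (ℓ / 3), um m σ * dd (n - 2*m) (n + m - ℓ) σ

def PP (n k : ℕ) (x : ℂ) (σ : ℝ) : ℂ :=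
  Complex.exp (3 * (π:ℂ) * I * (k:ℂ) / 4) * ∑ ℓ ∈ Finset.range (k/2 + 1),
    (Nat.choose (3*n - 2*ℓ) (3*n - k) : ℂ) * (-1:ℂ)^(n + ℓ) * 2^(2*ℓ) / 2^k *
      qq n ℓ σ * hermiteH (k - 2*ℓ) (Complex.exp (-(π:ℂ) * I / 4) * x)

def IsAk (s : ℂ) (a : ℕ → ℂ) : Prop :=
  a 0 = 1 ∧ ∀ k : ℕ, ((k:ℂ) + 1) * (Real.sqrt s.im : ℂ) * a (k+1) =
    -((k:ℂ) + 1 - (s.re:ℂ)) * a k + I * (if 2 ≤ k then a (k-2) else 0)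

def IsPsi (Ψ : ℂ → ℂ) : Prop :=
  Differentiable ℂ Ψ ∧ ∀ u : ℂ, Complex.cos ((π:ℂ)*u) ≠ 0 →
    Ψ u = Complex.cos ((π:ℂ)*(u^2/2 - u - 1/8)) / Complex.cos ((π:ℂ)*u)

def wfun (s z : ℂ) : ℂ :=
  Complex.exp ((s - 1) * Complex.log (1 + z / (Real.sqrt s.im : ℂ))
    - I * (Real.sqrt s.im : ℂ) * z + I * z^2 / 2)

def rn (n : ℕ) (s z : ℂ) : ℂ :=
  wfun s z - ∑ k ∈ Finset.range n, (iteratedDeriv k (wfun s) 0 / (Nat.factorial k : ℂ)) * z^k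

def GammaOmega : Set ℂ := {s : ℂ | s.im ≠ 0 ∨ 0 < s.re}

def IsLogGamma (L : ℂ → ℂ) : Prop :=
  DifferentiableOn ℂ L GammaOmega ∧ (∀ s ∈ GammaOmega, Complex.exp (L s) = Complex.Gamma s) ∧
    L 1 = 0

def gseq (σ : ℝ) (n : ℕ) : ℂ := -(bernoulliPoly (n+1) (σ:ℂ)) / ((n:ℂ)*((n:ℂ)+1))

def gammam (m : ℕ) (σ : ℝ) : ℂ :=
  I^m * ∑ k ∈ Finset.range (m+1), obell (gseq σ) m k / (Nat.factorial k : ℂ)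


theorem star_prim {f : ℂ → ℂ} {S : Set ℂ} (hS : IsOpen S) {c : ℂ} (hc : StarConvex ℝ c S)
    (hf : DifferentiableOn ℂ f S) : ∃ F : ℂ → ℂ, ∀ x ∈ S, HasDerivAt F (f x) x := by
  refine ⟨fun x => ∫ τ in (0:ℝ)..1, (x - c) * f (c + τ * (x - c)), fun x hx => ?_⟩
  have hseg : ∀ τ ∈ Set.Icc (0:ℝ) 1, c + (τ:ℂ) * (x - c) ∈ S := by
    intro τ hτ
    have := hc.add_smul_sub_mem hx hτ.1 hτ.2
    simpa using this
  let K : Set ℂ := (fun τ : ℝ => c + (τ:ℂ) * (x - c)) '' Set.Icc (0:ℝ) 1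
  have hKc : IsCompact K := isCompact_Icc.image (by fun_prop)
  have hKS : K ⊆ S := by rintro _ ⟨τ, hτ, rfl⟩; exact hseg τ hτ
  obtain ⟨δ, hδ, hδS⟩ := hKc.exists_cthickening_subset_open hS hKS
  have hTc : IsCompact (Metric.cthickening δ K) := hKc.cthickening
  have hdf : DifferentiableOn ℂ (deriv f) S := hf.deriv hS
  obtain ⟨M1, hM1⟩ := hTc.exists_bound_of_continuousOn (hf.continuousOn.mono hδS)
  obtain ⟨M2, hM2⟩ := hTc.exists_bound_of_continuousOn (hdf.continuousOn.mono hδS)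
  have hmem : ∀ x' ∈ Metric.ball x δ, ∀ τ ∈ Set.Icc (0:ℝ) 1,
      c + (τ:ℂ) * (x' - c) ∈ Metric.cthickening δ K := by
    intro x' hx' τ hτ
    refine Metric.mem_cthickening_of_dist_le _ (c + (τ:ℂ) * (x - c)) _ _ ⟨τ, hτ, rfl⟩ ?_
    rw [dist_eq_norm]
    have : c + (τ:ℂ) * (x' - c) - (c + τ * (x - c)) = τ * (x' - x) := by ring
    rw [this, norm_mul, Complex.norm_real, Real.norm_of_nonneg hτ.1]
    rw [Metric.mem_ball, dist_eq_norm] at hx'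
    have := norm_nonneg (x' - x)
    nlinarith [hτ.2]
  have hcont : ∀ x' ∈ Metric.ball x δ, ContinuousOn
      (fun τ : ℝ => f (c + τ * (x' - c))) (Set.Icc 0 1) := by
    intro x' hx'
    exact hf.continuousOn.comp (by fun_prop) (fun τ hτ => hδS (hmem x' hx' τ hτ))
  have hcont' : ∀ x' ∈ Metric.ball x δ, ContinuousOn
      (fun τ : ℝ => deriv f (c + τ * (x' - c))) (Set.Icc 0 1) := by
    intro x' hx'
    exact hdf.continuousOn.comp (by fun_prop) (fun τ hτ => hδS (hmem x' hx' τ hτ))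
  have huI : Set.uIcc (0:ℝ) 1 = Set.Icc 0 1 := Set.uIcc_of_le zero_le_one
  have huI' : Set.uIoc (0:ℝ) 1 = Set.Ioc 0 1 := Set.uIoc_of_le zero_le_one
  have hxb : x ∈ Metric.ball x δ := Metric.mem_ball_self hδ
  have key := intervalIntegral.hasDerivAt_integral_of_dominated_loc_of_deriv_le
    (F := fun (x' : ℂ) (τ : ℝ) => (x' - c) * f (c + τ * (x' - c)))
    (F' := fun (x' : ℂ) (τ : ℝ) => f (c + τ * (x' - c)) + (x' - c) * (deriv f (c + τ * (x' - c)) * τ))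
    (x₀ := x) (s := Metric.ball x δ) (a := 0) (b := 1) (μ := volume)
    (bound := fun _ => M1 + (‖x - c‖ + δ) * (M2 * 1)) (Metric.ball_mem_nhds x hδ) ?_ ?_ ?_ ?_ ?_ ?_
  · have h2 := key.2
    refine h2.congr_deriv ?_
    have h3 : ∀ τ ∈ Set.uIcc (0:ℝ) 1, HasDerivAt (fun τ : ℝ => (τ:ℂ) * f (c + τ * (x - c)))
        (f (c + τ * (x - c)) + (x - c) * (deriv f (c + τ * (x - c)) * τ)) τ := by
      intro τ hτ
      rw [huI] at hτ
      have h4 : HasDerivAt f (deriv f (c + τ * (x - c))) (c + τ * (x - c)) :=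
        (hf.differentiableAt (hS.mem_nhds (hseg τ hτ))).hasDerivAt
      have h5 : HasDerivAt (fun τ : ℝ => c + (τ:ℂ) * (x - c)) (x - c) τ := by
        have := ((hasDerivAt_id (τ:ℝ)).ofReal_comp.mul_const (x - c)).const_add c
        simpa using this
      have h6 := h4.scomp τ h5
      have h7 := (hasDerivAt_id (τ:ℝ)).ofReal_comp.mul h6
      refine h7.congr_deriv ?_
      simp; ring
    rw [intervalIntegral.integral_eq_sub_of_hasDerivAt h3]
    · simp
    · apply ContinuousOn.intervalIntegrable
      rw [huI]
      exact (hcont x hxb).add (continuousOn_const.mul ((hcont' x hxb).mul (by fun_prop)))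
  · filter_upwards [Metric.ball_mem_nhds x hδ] with x' hx'
    rw [huI']
    exact ((continuousOn_const.mul (hcont x' hx')).mono Set.Ioc_subset_Icc_self).aestronglyMeasurable measurableSet_Ioc
  · apply ContinuousOn.intervalIntegrable
    rw [huI]
    exact continuousOn_const.mul (hcont x hxb)
  · rw [huI']
    exact (((hcont x hxb).add (continuousOn_const.mul ((hcont' x hxb).mul (by fun_prop)))).mono Set.Ioc_subset_Icc_self).aestronglyMeasurable measurableSet_Ioc
  · refine Filter.Eventually.of_forall fun τ hτ x' hx' => ?_
    rw [huI'] at hτ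
    have hτ' : τ ∈ Set.Icc (0:ℝ) 1 := Set.Ioc_subset_Icc_self hτ
    have hm := hmem x' hx' τ hτ'
    have e1 := hM1 _ hm
    have e2 := hM2 _ hm
    have e3 : ‖x' - c‖ ≤ ‖x - c‖ + δ := by
      have : x' - c = (x - c) + (x' - x) := by ring
      rw [this]
      refine (norm_add_le _ _).trans ?_
      rw [Metric.mem_ball, dist_eq_norm] at hx'
      linarith
    have e4 : ‖(τ:ℂ)‖ ≤ 1 := by
      rw [Complex.norm_real, Real.norm_of_nonneg hτ'.1]; exact hτ'.2
    refine (norm_add_le _ _).trans (add_le_add e1 ?_)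
    rw [norm_mul, norm_mul]
    gcongr
    exact (norm_nonneg _).trans e2
  · exact intervalIntegrable_const
  · refine Filter.Eventually.of_forall fun τ hτ x' hx' => ?_
    rw [huI'] at hτ
    have hτ' : τ ∈ Set.Icc (0:ℝ) 1 := Set.Ioc_subset_Icc_self hτ
    have hm := hδS (hmem x' hx' τ hτ')
    have h4 : HasDerivAt f (deriv f (c + τ * (x' - c))) (c + τ * (x' - c)) :=
        (hf.differentiableAt (hS.mem_nhds hm)).hasDerivAt
    have h5 : HasDerivAt (fun x' : ℂ => c + (τ:ℂ) * (x' - c)) (τ:ℂ) x' := by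
      have := ((((hasDerivAt_id x').sub_const c).const_mul (τ:ℂ)).const_add c)
      simpa using this
    have h6 := h4.comp x' h5
    have h7 := ((hasDerivAt_id x').sub_const c).mul h6
    refine h7.congr_deriv ?_
    simp



def gfun (s : ℂ) (m : ℕ) (x : ℂ) : ℂ :=
  x ^ (s - 1) * Complex.exp (-(2 * (π:ℂ) * I * m * x)) / (Complex.exp (2 * (π:ℂ) * I * x) - 1)

def gapS (n : ℕ) : Set ℂ := {x : ℂ | x.im ≠ 0 ∨ ((n:ℝ) < x.re ∧ x.re < n + 1)}

theorem gapS_open (n : ℕ) : IsOpen (gapS n) := by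
  apply IsOpen.union
  · exact isOpen_ne_fun Complex.continuous_im continuous_const
  · exact (isOpen_lt continuous_const Complex.continuous_re).inter
      (isOpen_lt Complex.continuous_re continuous_const)

theorem gapS_star (n : ℕ) : StarConvex ℝ ((n:ℂ) + 1/2) (gapS n) := by
  rw [starConvex_iff_forall_pos (by right; simp; norm_num)]
  intro x hx a b ha hb hab
  rcases hx with h | ⟨h1, h2⟩
  · left; simp [hb.ne', h]
  · right
    simp only [real_smul, add_re, mul_re, ofReal_re, ofReal_im, natCast_re]
    norm_num
    constructor <;> nlinarith

theorem exp_two_pi_ne_one {x : ℂ} (h : ∀ k : ℤ, x ≠ k) : Complex.exp (2 * (π:ℂ) * I * x) - 1 ≠ 0 := by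
  intro h0
  rw [sub_eq_zero, Complex.exp_eq_one_iff] at h0
  obtain ⟨k, hk⟩ := h0
  apply h k
  have : (2 * (π:ℂ) * I) ≠ 0 := by simp [Real.pi_ne_zero]
  apply mul_left_cancel₀ this
  rw [hk]; ring

theorem gapS_ne_int {n : ℕ} {x : ℂ} (hx : x ∈ gapS n) (k : ℤ) : x ≠ k := by
  rintro rfl
  rcases hx with h | ⟨h1, h2⟩
  · simp at h
  · simp only [intCast_re] at h1 h2
    have : (n:ℤ) < k := by exact_mod_cast h1
    have : k < (n:ℤ) + 1 := by exact_mod_cast h2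
    omega

theorem gapS_slit {n : ℕ} {x : ℂ} (hx : x ∈ gapS n) : x ∈ Complex.slitPlane := by
  rcases hx with h | ⟨h1, h2⟩
  · right; exact h
  · left; exact lt_of_le_of_lt (Nat.cast_nonneg n) h1

theorem gfun_diff (s : ℂ) (m n : ℕ) : DifferentiableOn ℂ (gfun s m) (gapS n) := by
  intro x hx
  apply DifferentiableAt.differentiableWithinAt
  have h1 := gapS_slit hx
  have h2 := exp_two_pi_ne_one (gapS_ne_int hx)
  unfold gfun
  refine DifferentiableAt.div (DifferentiableAt.mul ?_ (by fun_prop)) (by fun_prop) h2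
  exact DifferentiableAt.cpow_const differentiableAt_id h1

theorem gfun_prim (s : ℂ) (m n : ℕ) : ∃ F : ℂ → ℂ, ∀ x ∈ gapS n, HasDerivAt F (gfun s m x) x :=
  star_prim (gapS_open n) (gapS_star n) (gfun_diff s m n)

theorem path_int {S : Set ℂ} {g P : ℂ → ℂ} (hP : ∀ x ∈ S, HasDerivAt P (g x) x)
    (hg : ContinuousOn g S) {γ γ' : ℝ → ℂ} {a b : ℝ}
    (hγ : ∀ θ, HasDerivAt γ (γ' θ) θ) (hγ' : Continuous γ')
    (hS : ∀ θ ∈ Set.uIcc a b, γ θ ∈ S) :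
    ∫ θ in a..b, γ' θ * g (γ θ) = P (γ b) - P (γ a) := by
  have hγc : Continuous γ := continuous_iff_continuousAt.2 fun θ => (hγ θ).continuousAt
  rw [intervalIntegral.integral_eq_sub_of_hasDerivAt (f := fun θ => P (γ θ))]
  · intro θ hθ
    have := (hP _ (hS θ hθ)).scomp θ (hγ θ)
    exact this
  · apply ContinuousOn.intervalIntegrable
    exact hγ'.continuousOn.mul (hg.comp hγc.continuousOn hS)

theorem prim_sub_const {U : Set ℂ} (hU : Convex ℝ U) {P Q g : ℂ → ℂ}
    (hP : ∀ x ∈ U, HasDerivAt P (g x) x) (hQ : ∀ x ∈ U, HasDerivAt Q (g x) x)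
    {x y : ℂ} (hx : x ∈ U) (hy : y ∈ U) : P x - Q x = P y - Q y := by
  have := hU.norm_image_sub_le_of_norm_hasDerivWithin_le (f := fun x => P x - Q x)
    (f' := fun _ => 0) (C := 0) (fun x hx => by
      have := ((hP x hx).sub (hQ x hx)).hasDerivWithinAt (s := U)
      rw [sub_self] at this; exact this) (by simp) hx hy
  simp only [zero_mul, norm_le_zero_iff] at this
  exact (sub_eq_zero.1 this).symm

theorem upper_sub (n : ℕ) : {x : ℂ | 0 < x.im} ⊆ gapS n := fun _ hx => Or.inl (ne_of_gt hx)
theorem lower_sub (n : ℕ) : {x : ℂ | x.im < 0} ⊆ gapS n := fun _ hx => Or.inl (ne_of_lt hx)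

theorem gfun_circle (s : ℂ) (m n : ℕ) (hn : 1 ≤ n) :
    (∮ z in C((n:ℂ), 1/2), gfun s m z) = (n:ℂ) ^ (s - 1) := by
  set f : ℂ → ℂ := fun x => Complex.exp (2 * (π:ℂ) * I * x) with hf
  have hfd : Differentiable ℂ f := by fun_prop
  have hfn : f n = 1 := by
    simp only [hf]
    rw [Complex.exp_eq_one_iff]; exact ⟨n, by push_cast; ring⟩
  have hderiv : deriv f n = 2 * (π:ℂ) * I := by
    have : HasDerivAt f (f n * (2 * (π:ℂ) * I)) n := by
      simpa using ((hasDerivAt_id (n:ℂ)).const_mul (2 * (π:ℂ) * I)).cexp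
    rw [this.deriv, hfn, one_mul]
  set q : ℂ → ℂ := fun x => x ^ (s - 1) * Complex.exp (-(2 * (π:ℂ) * I * m * x)) / dslope f n x with hq
  have hpi : (2 * (π:ℂ) * I) ≠ 0 := by simp [Real.pi_ne_zero]
  have hball : ∀ x ∈ Metric.closedBall (n:ℂ) (1/2), x ≠ n → ∀ k : ℤ, x ≠ k := by
    rintro x hx hxn k rfl
    rw [Metric.mem_closedBall, dist_eq_norm] at hx
    have : ((k:ℂ) - n) = ((k - n : ℤ) : ℂ) := by push_cast; ring
    rw [this, Complex.norm_intCast] at hx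
    have h2 : |k - (n:ℤ)| < 1 := by
      have : ((|k - (n:ℤ)| : ℤ):ℝ) < 1 := by rw [Int.cast_abs]; linarith
      exact_mod_cast this
    rw [Int.abs_lt_one_iff] at h2
    apply hxn
    have : k = (n:ℤ) := by omega
    rw [this]; simp
  have hds : ∀ x ∈ Metric.closedBall (n:ℂ) (1/2), dslope f n x ≠ 0 := by
    intro x hx
    by_cases hxn : x = n
    · rw [hxn, dslope_same, hderiv]; exact hpi
    · rw [dslope_of_ne _ hxn, slope_def_field]
      refine div_ne_zero ?_ (sub_ne_zero.2 hxn)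
      rw [hfn]
      exact exp_two_pi_ne_one (hball x hx hxn)
  have hqd : DifferentiableOn ℂ q (Metric.closedBall (n:ℂ) (1/2)) := by
    intro x hx
    have hds' : DifferentiableAt ℂ (dslope f n) x := by
      have : DifferentiableOn ℂ (dslope f n) Set.univ :=
        (Complex.differentiableOn_dslope Filter.univ_mem).2 hfd.differentiableOn
      exact this.differentiableAt Filter.univ_mem
    apply DifferentiableAt.differentiableWithinAt
    refine DifferentiableAt.div (DifferentiableAt.mul ?_ (by fun_prop)) hds' (hds x hx)
    refine DifferentiableAt.cpow_const differentiableAt_id ?_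
    left
    rw [Metric.mem_closedBall, dist_eq_norm] at hx
    have h1 := (Complex.abs_re_le_norm (x - n)).trans hx
    rw [abs_le] at h1
    simp only [sub_re, natCast_re] at h1
    have : (1:ℝ) ≤ n := by exact_mod_cast hn
    linarith [h1.1]
  have h1 := hqd.circleIntegral_sub_inv_smul (w := (n:ℂ)) (by simp)
  have h2 : (∮ z in C((n:ℂ), 1/2), gfun s m z) = ∮ z in C((n:ℂ), 1/2), (z - n)⁻¹ • q z := by
    apply circleIntegral.integral_congr (by norm_num)
    intro z hz
    have hzn : z ≠ n := by
      rintro rfl; simp at hz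
    simp only [hq, gfun, smul_eq_mul]
    rw [dslope_of_ne _ hzn, slope_def_field, hfn]
    have : z - n ≠ 0 := sub_ne_zero.2 hzn
    have h3 := exp_two_pi_ne_one (hball z (Metric.sphere_subset_closedBall hz) hzn)
    simp only [hf]
    field_simp
  rw [h2, h1, hq]
  simp only [dslope_same, hderiv, smul_eq_mul]
  have h4 : Complex.exp (-(2 * (π:ℂ) * I * m * n)) = 1 := by
    rw [Complex.exp_eq_one_iff]; exact ⟨-(m*n), by push_cast; ring⟩
  rw [h4]
  field_simp

theorem gap_step (s : ℂ) (m n : ℕ) {P Q : ℂ → ℂ}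
    (hP : ∀ x ∈ gapS n, HasDerivAt P (gfun s m x) x)
    (hQ : ∀ x ∈ gapS (n+1), HasDerivAt Q (gfun s m x) x)
    {x y : ℂ} (hx : x.im < 0) (hy : 0 < y.im) :
    P x - P y = (Q x - Q y) + ((n+1 : ℕ) : ℂ) ^ (s - 1) := by
  set c : ℂ := ((n+1:ℕ):ℂ) with hc
  have key := gfun_circle s m (n+1) (by omega)
  have hd : ∀ θ : ℝ, HasDerivAt (circleMap c (1/2)) (deriv (circleMap c (1/2)) θ) θ := fun θ => by
    have := hasDerivAt_circleMap c (1/2) θ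
    rw [this.deriv]; exact this
  have hdc : Continuous (deriv (circleMap c (1/2))) := by
    rw [show deriv (circleMap c (1/2)) = fun θ => circleMap 0 (1/2) θ * I from
      funext fun θ => deriv_circleMap c (1/2) θ]
    fun_prop
  have him : ∀ θ : ℝ, (circleMap c (1/2) θ).im = 1/2 * Real.sin θ := by
    intro θ; simp [circleMap, hc, Complex.exp_ofReal_mul_I_re, Complex.exp_ofReal_mul_I_im]
  have hre : ∀ θ : ℝ, (circleMap c (1/2) θ).re = (n+1) + 1/2 * Real.cos θ := by
    intro θ; simp [circleMap, hc, Complex.exp_ofReal_mul_I_re, Complex.exp_ofReal_mul_I_im]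
  have hpi := Real.pi_pos
  have hright : ∀ θ : ℝ, 0 < Real.cos θ → circleMap c (1/2) θ ∈ gapS (n+1) := by
    intro θ h
    right
    rw [hre]
    have := Real.cos_le_one θ
    push_cast
    constructor <;> linarith
  have hleft : ∀ θ : ℝ, Real.cos θ < 0 → circleMap c (1/2) θ ∈ gapS n := by
    intro θ h
    right
    rw [hre]
    have := Real.neg_one_le_cos θ
    constructor <;> linarith
  have hzero : ∀ k, ∀ θ : ℝ, Real.cos θ = 0 → circleMap c (1/2) θ ∈ gapS k := by
    intro k θ h
    left
    rw [him]
    have := Real.sin_sq_add_cos_sq θ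
    rw [h] at this
    intro h0
    have : Real.sin θ = 0 := by linarith
    simp_all
  have hright' : ∀ θ : ℝ, 0 ≤ Real.cos θ → circleMap c (1/2) θ ∈ gapS (n+1) := by
    intro θ h
    rcases h.lt_or_eq with h | h
    · exact hright θ h
    · exact hzero _ θ h.symm
  have hleft' : ∀ θ : ℝ, Real.cos θ ≤ 0 → circleMap c (1/2) θ ∈ gapS n := by
    intro θ h
    rcases h.lt_or_eq with h | h
    · exact hleft θ h
    · exact hzero _ θ h
  have m1 : ∀ θ ∈ Set.uIcc 0 (π/2), circleMap c (1/2) θ ∈ gapS (n+1) := by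
    intro θ hθ
    rw [Set.uIcc_of_le (by linarith)] at hθ
    exact hright' θ (Real.cos_nonneg_of_neg_pi_div_two_le_of_le (by linarith [hθ.1]) hθ.2)
  have m2 : ∀ θ ∈ Set.uIcc (π/2) (π + π/2), circleMap c (1/2) θ ∈ gapS n := by
    intro θ hθ
    rw [Set.uIcc_of_le (by linarith)] at hθ
    exact hleft' θ (Real.cos_nonpos_of_pi_div_two_le_of_le hθ.1 hθ.2)
  have m3 : ∀ θ ∈ Set.uIcc (π + π/2) (2*π), circleMap c (1/2) θ ∈ gapS (n+1) := by
    intro θ hθ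
    rw [Set.uIcc_of_le (by linarith)] at hθ
    apply hright'
    rw [← Real.cos_sub_two_pi]
    exact Real.cos_nonneg_of_neg_pi_div_two_le_of_le (by linarith [hθ.1]) (by linarith [hθ.2])
  have i1 := path_int hQ (gfun_diff s m (n+1)).continuousOn hd hdc m1
  have i2 := path_int hP (gfun_diff s m n).continuousOn hd hdc m2
  have i3 := path_int hQ (gfun_diff s m (n+1)).continuousOn hd hdc m3
  have hint : ∀ (k : ℕ) (a b : ℝ), (∀ θ ∈ Set.uIcc a b, circleMap c (1/2) θ ∈ gapS k) →
      IntervalIntegrable (fun θ => deriv (circleMap c (1/2)) θ * gfun s m (circleMap c (1/2) θ)) volume a b := by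
    intro k a b h
    apply ContinuousOn.intervalIntegrable
    exact hdc.continuousOn.mul ((gfun_diff s m k).continuousOn.comp (continuous_circleMap _ _).continuousOn h)
  have htot : (∮ z in C(c, 1/2), gfun s m z) = (Q (circleMap c (1/2) (π/2)) - Q (circleMap c (1/2) 0))
      + (P (circleMap c (1/2) (π + π/2)) - P (circleMap c (1/2) (π/2)))
      + (Q (circleMap c (1/2) (2*π)) - Q (circleMap c (1/2) (π + π/2))) := by
    rw [circleIntegral]
    simp only [smul_eq_mul]
    rw [← i1, ← i2, ← i3, intervalIntegral.integral_add_adjacent_intervals (hint _ _ _ m1) (hint _ _ _ m2),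
      intervalIntegral.integral_add_adjacent_intervals ((hint _ _ _ m1).trans (hint _ _ _ m2)) (hint _ _ _ m3)]
  have hend : circleMap c (1/2) (2*π) = circleMap c (1/2) 0 := by
    simpa using periodic_circleMap c (1/2) 0
  rw [hend] at htot
  have up : 0 < (circleMap c (1/2) (π/2)).im := by rw [him, Real.sin_pi_div_two]; norm_num
  have dn : (circleMap c (1/2) (π + π/2)).im < 0 := by
    rw [him, Real.sin_add]; simp
  have c1 := prim_sub_const (U := {x : ℂ | 0 < x.im}) (convex_halfSpace_im_gt 0)
    (fun x hx => hP x (upper_sub n hx)) (fun x hx => hQ x (upper_sub (n+1) hx)) hy up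
  have c2 := prim_sub_const (U := {x : ℂ | x.im < 0}) (convex_halfSpace_im_lt 0)
    (fun x hx => hP x (lower_sub n hx)) (fun x hx => hQ x (lower_sub (n+1) hx)) hx dn
  rw [htot] at key
  rw [← key]
  linear_combination c2 - c1

theorem gap_sum (s : ℂ) (m : ℕ) {P : ℂ → ℂ}
    (hP : ∀ x ∈ gapS 0, HasDerivAt P (gfun s m x) x) (n : ℕ) {Q : ℂ → ℂ}
    (hQ : ∀ x ∈ gapS n, HasDerivAt Q (gfun s m x) x)
    {x y : ℂ} (hx : x.im < 0) (hy : 0 < y.im) :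
    P x - P y = (Q x - Q y) + ∑ k ∈ Finset.Icc 1 n, (k : ℂ) ^ (s - 1) := by
  induction n generalizing Q with
  | zero =>
    have h1 : ∀ z ∈ gapS 0, P z - Q z = P (((0:ℕ):ℂ) + 1/2) - Q (((0:ℕ):ℂ) + 1/2) := by
      intro z hz
      refine prim_sub_const (U := segment ℝ (((0:ℕ):ℂ) + 1/2) z) (convex_segment _ _) (g := gfun s m) ?_ ?_
        (right_mem_segment _ _ _) (left_mem_segment _ _ _)
      · exact fun w hw => hP w ((gapS_star 0).segment_subset hz hw)
      · exact fun w hw => hQ w ((gapS_star 0).segment_subset hz hw)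
    have e1 := h1 x (lower_sub 0 hx)
    have e2 := h1 y (upper_sub 0 hy)
    simp only [Finset.Icc_eq_empty_of_lt (by norm_num : (0:ℕ) < 1), Finset.sum_empty]
    linear_combination e1 - e2
  | succ n ih =>
    obtain ⟨R, hR⟩ := gfun_prim s m n
    rw [ih hR, gap_step s m n hR hQ hx hy, Finset.sum_Icc_succ_top (by omega)]
    ring



def hz (m : ℕ) (z : ℂ) : ℂ := Complex.exp (-(m:ℂ) * z) / (Complex.exp z - 1)

def hLoop (m : ℕ) (s : ℂ) : ℂ :=
  ∫ θ in (0:ℝ)..(2*π), I * Complex.exp (I * s * θ) * hz m (Complex.exp (I * θ))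

def hTail (m : ℕ) (s : ℂ) : ℂ := ∫ y in Set.Ioi (1:ℝ), (y:ℂ) ^ (s - 1) * hz m y

theorem exp_sub_one_lower {z : ℂ} (hz : ‖z‖ ≤ 1/2) : ‖z‖ / 2 ≤ ‖Complex.exp z - 1‖ := by
  have h := Complex.norm_exp_sub_one_sub_id_le (x := z) (by linarith)
  have h2 : ‖z‖ ≤ ‖Complex.exp z - 1‖ + ‖Complex.exp z - 1 - z‖ := by
    have := norm_sub_le (Complex.exp z - 1) (Complex.exp z - 1 - z)
    simpa using this
  nlinarith [norm_nonneg z]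

theorem exp_sub_one_ne {z : ℂ} (hz : ‖z‖ < 2*π) (h0 : z ≠ 0) : Complex.exp z - 1 ≠ 0 := by
  intro h
  rw [sub_eq_zero, Complex.exp_eq_one_iff] at h
  obtain ⟨n, hn⟩ := h
  have hn0 : n ≠ 0 := by rintro rfl; simp at hn; exact h0 hn
  have : ‖z‖ = |(n:ℝ)| * (2*π) := by
    rw [hn]; simp [abs_of_pos Real.pi_pos]
  have h1 : (1:ℝ) ≤ |(n:ℝ)| := by exact_mod_cast Int.one_le_abs hn0
  nlinarith [Real.pi_pos]

theorem exp_sub_one_ne_real {y : ℝ} (hy : 0 < y) : Complex.exp (y:ℂ) - 1 ≠ 0 := by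
  rw [← Complex.ofReal_exp, ← Complex.ofReal_one, ← Complex.ofReal_sub]
  have := Real.add_one_lt_exp hy.ne'
  exact_mod_cast (show Real.exp y - 1 ≠ 0 from fun h => by linarith)

theorem hz_diffAt (m : ℕ) {z : ℂ} (h : Complex.exp z - 1 ≠ 0) : DifferentiableAt ℂ (hz m) z := by
  unfold hz
  exact DifferentiableAt.div (by fun_prop) (by fun_prop) h

theorem hz_norm_small (m : ℕ) {z : ℂ} (h : ‖z‖ ≤ 1/2) : ‖hz m z‖ ≤ 2 * Real.exp m * ‖z‖⁻¹ := by
  rcases eq_or_ne z 0 with rfl | h0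
  · simp [hz]
  unfold hz
  rw [norm_div, Complex.norm_exp]
  have h1 := exp_sub_one_lower h
  have h2 : 0 < ‖z‖ := norm_pos_iff.2 h0
  rw [div_le_iff₀ (by linarith)]
  have h3 : (-(m:ℂ) * z).re ≤ m := by
    have : (-(m:ℂ) * z).re = -(m * z.re) := by simp
    rw [this]
    have h4 := (abs_le.1 (Complex.abs_re_le_norm z)).1
    have h5 : -z.re ≤ 1 := by linarith
    nlinarith [(Nat.cast_nonneg m : (0:ℝ) ≤ m)]
  have h6 := Real.exp_le_exp.2 h3
  calc _ ≤ Real.exp m := h6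
    _ = 2 * Real.exp m * ‖z‖⁻¹ * (‖z‖/2) := by field_simp
    _ ≤ _ := by gcongr

theorem hz_norm_large (m : ℕ) {y : ℝ} (h : 1 ≤ y) : ‖hz m y‖ ≤ 2 * Real.exp (-(1:ℝ) * y) := by
  unfold hz
  rw [norm_div, Complex.norm_exp]
  have e1 : ‖Complex.exp (y:ℂ) - 1‖ = Real.exp y - 1 := by
    rw [← Complex.ofReal_exp, ← Complex.ofReal_one, ← Complex.ofReal_sub, Complex.norm_real, Real.norm_eq_abs,
      abs_of_nonneg]
    linarith [Real.add_one_le_exp y]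
  have h2 : 2 ≤ Real.exp y := by linarith [Real.add_one_le_exp y]
  rw [e1, div_le_iff₀ (by linarith)]
  have h3 : (-(m:ℂ) * (y:ℂ)).re ≤ 0 := by
    have : (-(m:ℂ) * (y:ℂ)).re = -(m * y) := by simp
    rw [this]; have : (0:ℝ) ≤ m * y := by positivity
    linarith
  have h4 := Real.exp_le_one_iff.2 h3
  have h5 : Real.exp (-1*y) * Real.exp y = 1 := by rw [← Real.exp_add]; simp
  nlinarith [Real.exp_pos (-1*y)]

theorem hz_cont (m : ℕ) : ContinuousOn (fun y : ℝ => hz m y) (Set.Ioi 0) := by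
  intro y hy
  apply ContinuousAt.continuousWithinAt
  exact ContinuousAt.comp (f := fun y : ℝ => (y:ℂ)) (hz_diffAt m (exp_sub_one_ne_real hy)).continuousAt (by fun_prop)

open Filter Topology Asymptotics in
theorem hz_bigO_top (m : ℕ) : (fun y : ℝ => hz m y) =O[atTop] fun t => Real.exp (-(1:ℝ) * t) := by
  refine IsBigO.of_bound 2 ?_
  filter_upwards [eventually_ge_atTop 1] with y hy
  rw [Real.norm_eq_abs, abs_of_pos (Real.exp_pos _)]
  exact hz_norm_large m hy

open Filter Topology Asymptotics in
theorem hz_bigO_zero (m : ℕ) : (fun y : ℝ => hz m y) =O[𝓝[>] 0] fun y : ℝ => y ^ (-(1:ℝ)) := by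
  refine IsBigO.of_bound (2 * Real.exp m) ?_
  filter_upwards [Ioo_mem_nhdsGT (show (0:ℝ) < 1/2 by norm_num)] with y hy
  have := hz_norm_small m (z := (y:ℂ)) (by rw [Complex.norm_real, Real.norm_eq_abs, abs_of_pos hy.1]; exact hy.2.le)
  rw [Complex.norm_real] at this
  rwa [Real.rpow_neg_one, norm_inv]

theorem hz_mellinConv (m : ℕ) {s : ℂ} (hs : 1 < s.re) : MellinConvergent (fun y : ℝ => hz m y) s :=
  mellinConvergent_of_isBigO_rpow_exp one_pos ((hz_cont m).locallyIntegrableOn measurableSet_Ioi)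
    (hz_bigO_top m) (hz_bigO_zero m) hs

theorem hz_hasSum (m : ℕ) {y : ℝ} (hy : 0 < y) :
    HasSum (fun i : ℕ => (1:ℂ) * Real.exp (-((m:ℝ)+1+i) * y)) (hz m y) := by
  have h1 : ‖Complex.exp (-(y:ℂ))‖ < 1 := by
    rw [Complex.norm_exp]; simpa using hy
  have h2 := (hasSum_geometric_of_norm_lt_one h1).mul_left (Complex.exp (-((m:ℂ)+1) * y))
  have h0 := exp_sub_one_ne_real hy
  have e1 : (fun i : ℕ => (1:ℂ) * Real.exp (-((m:ℝ)+1+i) * y)) =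
      fun i => Complex.exp (-((m:ℂ)+1) * y) * Complex.exp (-(y:ℂ)) ^ i := by
    funext i
    rw [one_mul, ← Complex.exp_nat_mul, Complex.ofReal_exp, ← Complex.exp_add]
    congr 1; push_cast; ring
  have e2 : hz m y = Complex.exp (-((m:ℂ)+1) * y) * (1 - Complex.exp (-(y:ℂ)))⁻¹ := by
    unfold hz
    have h3 : Complex.exp (y:ℂ) * Complex.exp (-(y:ℂ)) = 1 := by rw [← Complex.exp_add]; simp
    have h4 : 1 - Complex.exp (-(y:ℂ)) ≠ 0 := by
      intro h; apply h0
      have : Complex.exp (-(y:ℂ)) = 1 := by linear_combination -h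
      rw [this] at h3; linear_combination h3
    have h5 : Complex.exp (-((m:ℂ)+1) * y) = Complex.exp (-(m:ℂ)*y) * Complex.exp (-(y:ℂ)) := by
      rw [← Complex.exp_add]; congr 1; ring
    rw [h5, ← div_eq_mul_inv, div_eq_div_iff h0 h4]
    linear_combination -Complex.exp (-(m:ℂ)*y) * h3
  rw [e1, e2]; exact h2

theorem mellin_hz (m : ℕ) {s : ℂ} (hs : 1 < s.re) :
    mellin (fun y : ℝ => hz m y) s
      = Complex.Gamma s * (riemannZeta s - ∑ k ∈ Finset.Icc 1 m, (k:ℂ)^(-s)) := by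
  have hsum : Summable (fun k : ℕ => 1 / ((k:ℝ)) ^ s.re) := Real.summable_one_div_nat_rpow.2 hs
  have h := hasSum_mellin (a := fun _ : ℕ => (1:ℂ)) (p := fun i => (m:ℝ)+1+i) (F := fun y : ℝ => hz m y) (s := s)
    (fun i => Or.inr (by positivity)) (by linarith) (fun t ht => by simpa using hz_hasSum m ht)
    (by
      have := (summable_nat_add_iff (m+1)).2 hsum
      refine this.congr fun i => ?_
      simp only [norm_one]; push_cast; congr 2; ring)
  have h2 : HasSum (fun i : ℕ => 1 / ((i:ℂ)+1)^s) (riemannZeta s) := by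
    rw [zeta_eq_tsum_one_div_nat_add_one_cpow hs]
    apply Summable.hasSum
    have := (summable_nat_add_iff 1).2 (Complex.summable_one_div_nat_cpow.2 hs)
    simpa using this
  have h3 := (hasSum_nat_add_iff' m).2 h2
  have h4 := h3.mul_left (Complex.Gamma s)
  have e1 : (fun i : ℕ => Complex.Gamma s * (1 / (((i + m : ℕ):ℂ) + 1) ^ s)) =
      fun i : ℕ => Complex.Gamma s * 1 / (((m:ℝ)+1+i : ℝ):ℂ) ^ s := by
    funext i
    push_cast
    rw [mul_one, mul_one_div]; congr 2; ring
  rw [e1] at h4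
  rw [h.unique h4]
  congr 2
  have e2 : Finset.Icc 1 m = Finset.Ico (0+1) (m+1) := by ext k; simp
  rw [e2, ← Finset.sum_Ico_add' (fun k : ℕ => (k:ℂ)^(-s)) 0 m 1, Finset.range_eq_Ico]
  apply Finset.sum_congr rfl
  intro k _
  push_cast
  rw [Complex.cpow_neg, one_div]


open Filter Topology in
theorem hz_loop_eq (m : ℕ) {s : ℂ} (hs : 1 < s.re) :
    (Complex.exp (2*π*I*s) - 1) * ∫ y in (0:ℝ)..1, (y:ℂ)^(s-1) * hz m y = hLoop m s := by
  set H : ℂ → ℂ := fun ζ => Complex.exp (s*ζ) * hz m (Complex.exp ζ) with hH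
  have hHd : ∀ ζ : ℂ, ζ.re ≤ 0 → DifferentiableAt ℂ H ζ := by
    intro ζ hζ
    have h1 : Complex.exp (Complex.exp ζ) - 1 ≠ 0 := by
      apply exp_sub_one_ne _ (Complex.exp_ne_zero _)
      rw [Complex.norm_exp]
      have : Real.exp ζ.re ≤ 1 := Real.exp_le_one_iff.2 hζ
      linarith [Real.pi_gt_three]
    exact DifferentiableAt.mul (by fun_prop) (DifferentiableAt.comp ζ (hz_diffAt m h1) (by fun_prop))
  have hfi : IntervalIntegrable (fun y : ℝ => (y:ℂ)^(s-1) * hz m y) volume 0 1 := by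
    have := hz_mellinConv m hs
    unfold MellinConvergent at this
    rw [intervalIntegrable_iff_integrableOn_Ioc_of_le zero_le_one]
    exact (this.mono_set Set.Ioc_subset_Ioi_self)
  -- finite identity
  have key : ∀ X : ℝ, 0 ≤ X → (Complex.exp (2*π*I*s) - 1) * ∫ y in (Real.exp (-X))..1, (y:ℂ)^(s-1) * hz m y
      = hLoop m s - I * ∫ θ in (0:ℝ)..(2*π), H (-X + θ * I) := by
    intro X hX
    have hcv : ∫ y in (Real.exp (-X))..1, (y:ℂ)^(s-1) * hz m y = ∫ x in (-X)..0, H x := by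
      have h1 := intervalIntegral.integral_deriv_smul_comp' (a := -X) (b := 0) (f := Real.exp) (f' := Real.exp)
        (g := fun y : ℝ => (y:ℂ)^(s-1) * hz m y) (fun x _ => Real.hasDerivAt_exp x) (Real.continuous_exp.continuousOn)
        (by
          intro y hy
          obtain ⟨x, hx, rfl⟩ := hy
          have hp := Real.exp_pos x
          apply ContinuousAt.continuousWithinAt
          apply ContinuousAt.mul
          · exact Complex.continuousAt_ofReal_cpow_const _ _ (Or.inr hp.ne')
          · exact (hz_cont m).continuousAt (Ioi_mem_nhds hp))
      rw [Real.exp_zero] at h1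
      rw [← h1]
      apply intervalIntegral.integral_congr
      intro x _
      simp only [Function.comp, hH, Complex.real_smul]
      rw [Complex.ofReal_exp, ← mul_assoc]
      congr 1
      rw [Complex.cpow_def_of_ne_zero (Complex.exp_ne_zero _), ← Complex.ofReal_exp, ← Complex.ofReal_log (Real.exp_pos x).le,
        Real.log_exp, Complex.ofReal_exp, ← Complex.exp_add]
      congr 1; ring
    have hrect := Complex.integral_boundary_rect_eq_zero_of_differentiableOn H (-X:ℂ) (2*π*I) (by
      intro ζ hζ
      apply DifferentiableAt.differentiableWithinAt
      apply hHd
      have := (Complex.mem_reProdIm.1 hζ).1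
      simp [Set.uIcc_of_le, hX] at this
      exact this.2)
    simp only [Complex.neg_re, Complex.ofReal_re, Complex.neg_im, Complex.ofReal_im, neg_zero, Complex.ofReal_zero, zero_mul, add_zero,
      Complex.mul_re, Complex.mul_im, Complex.I_re, Complex.I_im, Complex.re_ofNat, Complex.im_ofNat, mul_zero, mul_one, sub_zero, zero_sub, zero_add,
      smul_eq_mul, Complex.ofReal_neg] at hrect
    have hper : ∫ x in (-X)..0, H (x + ((2*π : ℝ):ℂ) * I) = Complex.exp (2*π*I*s) * ∫ x in (-X)..0, H x := by
      rw [← intervalIntegral.integral_const_mul]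
      apply intervalIntegral.integral_congr
      intro x _
      simp only [hH]
      have e1 : Complex.exp (x + ((2*π : ℝ):ℂ) * I) = Complex.exp x := by
        rw [Complex.exp_add]; push_cast; rw [Complex.exp_two_pi_mul_I, mul_one]
      rw [e1, ← mul_assoc, ← Complex.exp_add]
      congr 2; push_cast; ring
    have hl : hLoop m s = I * ∫ y in (0:ℝ)..(2*π), H (y * I) := by
      unfold hLoop
      rw [← intervalIntegral.integral_const_mul]
      apply intervalIntegral.integral_congr
      intro x _
      simp only [hH]
      rw [mul_assoc]
      congr 3
      · ring
      · rw [mul_comm]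
    rw [hper] at hrect
    rw [hcv, hl]
    linear_combination -hrect
  have l1 : Tendsto (fun X : ℝ => (Complex.exp (2*π*I*s) - 1) * ∫ y in (Real.exp (-X))..1, (y:ℂ)^(s-1) * hz m y) atTop
      (𝓝 ((Complex.exp (2*π*I*s) - 1) * ∫ y in (0:ℝ)..1, (y:ℂ)^(s-1) * hz m y)) := by
    apply Tendsto.const_mul
    have hc := intervalIntegral.continuousOn_primitive_interval_left (a := 0) (b := 1) (μ := volume) (f := fun y : ℝ => (y:ℂ)^(s-1) * hz m y)
      (by rw [Set.uIcc_of_le zero_le_one, integrableOn_Icc_iff_integrableOn_Ioc, ← intervalIntegrable_iff_integrableOn_Ioc_of_le zero_le_one]; exact hfi)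
    have h0 := hc 0 (by simp)
    apply h0.tendsto.comp
    rw [tendsto_nhdsWithin_iff]
    refine ⟨Real.tendsto_exp_atBot.comp tendsto_neg_atTop_atBot, ?_⟩
    filter_upwards [eventually_ge_atTop 0] with X hX
    rw [Set.uIcc_of_le zero_le_one]
    exact ⟨(Real.exp_pos _).le, Real.exp_le_one_iff.2 (by linarith)⟩
  have l2 : Tendsto (fun X : ℝ => hLoop m s - I * ∫ θ in (0:ℝ)..(2*π), H (-X + θ * I)) atTop (𝓝 (hLoop m s - I * 0)) := by
    apply Tendsto.const_sub
    apply Tendsto.const_mul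
    have hb : Tendsto (fun X : ℝ => Real.exp (|s.im| * (2*π)) * (2 * Real.exp m) * (2*π) * Real.exp (-((s.re - 1)*X))) atTop (𝓝 (Real.exp (|s.im| * (2*π)) * (2 * Real.exp m) * (2*π) * 0)) := by
      apply Tendsto.const_mul
      apply Real.tendsto_exp_neg_atTop_nhds_zero.comp
      exact tendsto_id.const_mul_atTop (by linarith)
    rw [mul_zero] at hb
    apply squeeze_zero_norm' _ hb
    filter_upwards [eventually_ge_atTop 1] with X hX
    have := intervalIntegral.norm_integral_le_of_norm_le_const (a := 0) (b := 2*π) (f := fun θ : ℝ => H (-X + θ * I))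
      (C := Real.exp (|s.im| * (2*π)) * (2 * Real.exp m) * Real.exp (-((s.re - 1)*X))) (by
      intro θ hθ
      rw [Set.uIoc_of_le (by positivity)] at hθ
      simp only [hH]
      have hn : ‖Complex.exp (-X + θ * I)‖ = Real.exp (-X) := by
        rw [Complex.norm_exp]; simp
      have hsm : Real.exp (-X) ≤ 1/2 := by
        have := Real.exp_le_exp.2 (neg_le_neg hX)
        have h3 := Real.exp_neg_one_lt_half
        linarith
      have h2 := hz_norm_small m (z := Complex.exp (-X + θ * I)) (by rw [hn]; exact hsm)
      rw [hn, ← Real.exp_neg, neg_neg] at h2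
      rw [norm_mul, Complex.norm_exp]
      have e : (s * (-X + θ*I)).re = -(s.re * X) - s.im * θ := by simp
      rw [e]
      have h4 : -(s.re * X) - s.im * θ ≤ |s.im| * (2*π) + -(s.re*X) := by
        have : -s.im * θ ≤ |s.im| * (2*π) := by
          apply mul_le_mul (neg_le_abs _) hθ.2 hθ.1.le (abs_nonneg _)
        linarith
      calc _ ≤ Real.exp (|s.im| * (2*π) + -(s.re*X)) * (2 * Real.exp m * Real.exp X) := by gcongr
        _ = Real.exp (|s.im| * (2*π)) * (2 * Real.exp m) * (Real.exp (-(s.re*X)) * Real.exp X) := by rw [Real.exp_add]; ring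
        _ = _ := by rw [← Real.exp_add]; congr 2; ring)
    refine this.trans (le_of_eq ?_)
    rw [sub_zero, abs_of_pos (show (0:ℝ) < 2*π by positivity)]; ring
  rw [mul_zero, sub_zero] at l2
  refine tendsto_nhds_unique (l1.congr' ?_) l2
  filter_upwards [eventually_ge_atTop 0] with X hX
  exact key X hX

theorem hankel_re_gt (m : ℕ) {s : ℂ} (hs : 1 < s.re) :
    (Complex.exp (2*π*I*s) - 1) * (Complex.Gamma s * (riemannZeta s - ∑ k ∈ Finset.Icc 1 m, (k:ℂ)^(-s)))
      = hLoop m s + (Complex.exp (2*π*I*s) - 1) * hTail m s := by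
  rw [← mellin_hz m hs, ← hz_loop_eq m hs, ← mul_add]
  congr 1
  have h := hz_mellinConv m hs
  unfold MellinConvergent at h
  unfold mellin hTail
  simp only [smul_eq_mul] at h ⊢
  rw [intervalIntegral.integral_of_le zero_le_one, ← setIntegral_union (Set.Ioc_disjoint_Ioi le_rfl) measurableSet_Ioi
    (h.mono_set Set.Ioc_subset_Ioi_self) (h.mono_set (Set.Ioi_subset_Ioi zero_le_one)), Set.Ioc_union_Ioi_eq_Ioi zero_le_one]

open Filter Topology Asymptotics in
theorem hTail_diff (m : ℕ) : Differentiable ℂ (hTail m) := by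
  intro s
  set f : ℝ → ℂ := (Set.Ioi (1:ℝ)).indicator (fun y : ℝ => hz m y) with hf
  have e : hTail m = mellin f := by
    funext s
    unfold hTail mellin
    have : ∀ y : ℝ, (y:ℂ)^(s-1) • f y = (Set.Ioi (1:ℝ)).indicator (fun y : ℝ => (y:ℂ)^(s-1) * hz m y) y := by
      intro y; simp only [hf, smul_eq_mul, Set.indicator]; split_ifs <;> simp
    simp_rw [this]
    rw [setIntegral_indicator measurableSet_Ioi, Set.Ioi_inter_Ioi]; simp
  rw [e]
  have hli := ((hz_cont m).locallyIntegrableOn (μ := volume) measurableSet_Ioi)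
  apply mellin_differentiableAt_of_isBigO_rpow_exp one_pos (b := s.re - 1) (a := 1)
  · rw [locallyIntegrableOn_iff isOpen_Ioi.isLocallyClosed] at hli ⊢
    intro k hk hkc
    exact (hli k hk hkc).indicator measurableSet_Ioi
  · refine IsBigO.of_bound 2 ?_
    filter_upwards [eventually_ge_atTop 1] with y hy
    rw [Real.norm_eq_abs, abs_of_pos (Real.exp_pos _)]
    refine (norm_indicator_le_norm_self _ _).trans (hz_norm_large m hy)
  · refine IsBigO.of_bound 0 ?_
    filter_upwards [Ioo_mem_nhdsGT (show (0:ℝ) < 1 by norm_num)] with y hy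
    simp [hf, Set.indicator, not_lt.2 hy.2.le]
  · linarith

theorem hLoop_integrand_cont (m : ℕ) : Continuous (fun θ : ℝ => hz m (Complex.exp (I*θ))) := by
  rw [continuous_iff_continuousAt]
  intro θ
  apply ContinuousAt.comp (f := fun θ : ℝ => Complex.exp (I*θ)) (hz_diffAt m _).continuousAt (by fun_prop)
  apply exp_sub_one_ne _ (Complex.exp_ne_zero _)
  rw [Complex.norm_exp]; simp; linarith [Real.pi_gt_three]

theorem hLoop_diff (m : ℕ) : Differentiable ℂ (hLoop m) := by
  intro s
  have hc := hLoop_integrand_cont m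
  set g : ℝ → ℂ := fun θ : ℝ => hz m (Complex.exp (I*θ)) with hg
  set F' : ℂ → ℝ → ℂ := fun z θ => I * (Complex.exp (I*z*θ) * (I*θ)) * g θ with hF'
  have hcont2 : Continuous (fun p : ℂ × ℝ => F' p.1 p.2) := by
    simp only [hF']; fun_prop
  obtain ⟨C, hC⟩ := ((isCompact_closedBall s 1).prod (isCompact_Icc (a := (0:ℝ)) (b := 2*π))).exists_bound_of_continuousOn hcont2.continuousOn
  have := intervalIntegral.hasDerivAt_integral_of_dominated_loc_of_deriv_le (μ := volume) (a := 0) (b := 2*π) (F := fun z (θ:ℝ) => I * Complex.exp (I * z * θ) * g θ)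
    (F' := F') (x₀ := s) (s := Metric.ball s 1) (bound := fun _ => C) (Metric.ball_mem_nhds s one_pos) 
    (Filter.Eventually.of_forall fun z => by
      apply Continuous.aestronglyMeasurable; fun_prop)
    (by apply Continuous.intervalIntegrable; fun_prop)
    (by apply Continuous.aestronglyMeasurable; simp only [hF']; fun_prop)
    (by
      refine Filter.Eventually.of_forall fun θ hθ z hz => ?_
      rw [Set.uIoc_of_le (by positivity)] at hθ
      exact hC (z, θ) ⟨Metric.ball_subset_closedBall hz, hθ.1.le, hθ.2⟩)
    (by simp)
    (by
      refine Filter.Eventually.of_forall fun θ hθ z hz => ?_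
      simp only [hF']
      have h1 : HasDerivAt (fun z : ℂ => I*z*θ) (I*θ) z := by
        have := ((hasDerivAt_id z).const_mul I).mul_const (θ:ℂ)
        simpa using this
      exact ((h1.cexp).const_mul I).mul_const (g θ))
  exact this.2.differentiableAt

open Filter Topology in
theorem hankel (m : ℕ) {s : ℂ} (hs : 0 < s.im) :
    (Complex.exp (2*π*I*s) - 1) * (Complex.Gamma s * (riemannZeta s - ∑ k ∈ Finset.Icc 1 m, (k:ℂ)^(-s)))
      = hLoop m s + (Complex.exp (2*π*I*s) - 1) * hTail m s := by
  have hU : IsOpen {z : ℂ | 0 < z.im} := isOpen_lt continuous_const Complex.continuous_im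
  have hne : ∀ z : ℂ, 0 < z.im → ∀ n : ℕ, z ≠ -n := by
    rintro z hz n rfl; simp at hz
  have h1 : DifferentiableOn ℂ (fun s => (Complex.exp (2*π*I*s) - 1) * (Complex.Gamma s * (riemannZeta s - ∑ k ∈ Finset.Icc 1 m, (k:ℂ)^(-s)))) {z : ℂ | 0 < z.im} := by
    intro z hz
    apply DifferentiableAt.differentiableWithinAt
    apply DifferentiableAt.mul (by fun_prop)
    apply DifferentiableAt.mul (Complex.differentiableAt_Gamma _ (hne z hz))
    apply DifferentiableAt.sub
    · apply differentiableAt_riemannZeta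
      rintro rfl; simp at hz
    · apply DifferentiableAt.fun_sum
      intro k hk
      have : (k:ℂ) ≠ 0 := by
        have := (Finset.mem_Icc.1 hk).1
        exact_mod_cast (by omega : k ≠ 0)
      apply DifferentiableAt.const_cpow (by fun_prop) (Or.inl this)
  have h2 : DifferentiableOn ℂ (fun s => hLoop m s + (Complex.exp (2*π*I*s) - 1) * hTail m s) {z : ℂ | 0 < z.im} := by
    have := hLoop_diff m
    have := hTail_diff m
    apply Differentiable.differentiableOn
    fun_prop
  have h3 := (h1.analyticOnNhd hU).eqOn_of_preconnected_of_eventuallyEq (h2.analyticOnNhd hU)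
    (convex_halfSpace_im_gt 0).isPreconnected (z₀ := 2 + I) (by simp) (by
      have : {z : ℂ | 1 < z.re} ∈ 𝓝 (2 + I) := by
        apply (isOpen_lt continuous_const Complex.continuous_re).mem_nhds; simp
      filter_upwards [this] with z hz
      exact hankel_re_gt m hz)
  exact h3 hs


def Efac (s : ℂ) : ℂ := ((2*π : ℝ):ℂ)^s * Complex.exp ((π:ℂ)*I*s/2)

def hLoop2 (m : ℕ) (s : ℂ) : ℂ :=
  ∫ θ in (π:ℝ)..(3*π), I * Complex.exp (I * s * θ) * hz m (Complex.exp (I * θ))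

def dirE : ℂ := Complex.exp (3 * (π:ℂ) * I / 4)

theorem dirE_eq : dirE = (-(√2/2 : ℝ) : ℂ) + (√2/2 : ℝ) * I := by
  unfold dirE
  have h : (3 * (π:ℂ) * I / 4) = ((π - π/4 : ℝ):ℂ) * I := by push_cast; ring
  rw [h, Complex.exp_mul_I, ← Complex.ofReal_cos, ← Complex.ofReal_sin, Real.cos_pi_sub, Real.sin_pi_sub, Real.cos_pi_div_four, Real.sin_pi_div_four]
  push_cast; ring

theorem dirE_re : dirE.re = -(√2/2) := by rw [dirE_eq]; simp
theorem dirE_im : dirE.im = √2/2 := by rw [dirE_eq]; simp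
theorem dirE_norm : ‖dirE‖ = 1 := by unfold dirE; rw [Complex.norm_exp]; simp

theorem Efac_ne (s : ℂ) : Efac s ≠ 0 := by
  unfold Efac
  apply mul_ne_zero _ (Complex.exp_ne_zero _)
  rw [Complex.cpow_def_of_ne_zero (by exact_mod_cast (by positivity : (2*π:ℝ) ≠ 0))]
  exact Complex.exp_ne_zero _

theorem cpow_polar (r φ : ℝ) (hr : 0 < r) (h1 : -π < φ) (h2 : φ ≤ π) (z : ℂ) :
    ((r:ℂ) * Complex.exp (φ * I)) ^ z = Complex.exp (z * (Real.log r + φ * I)) := by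
  rw [Complex.cpow_def_of_ne_zero (mul_ne_zero (by exact_mod_cast hr.ne') (Complex.exp_ne_zero _)),
    Complex.log_ofReal_mul hr (Complex.exp_ne_zero _), Complex.log_exp (by simpa using h1) (by simpa using h2), mul_comm]

theorem Efac_eq (s : ℂ) : Efac s = Complex.exp (s * (Real.log (2*π) + (π/2:ℝ) * I)) := by
  unfold Efac
  rw [Complex.cpow_def_of_ne_zero (by exact_mod_cast (by positivity : (2*π:ℝ) ≠ 0)), ← Complex.ofReal_log (by positivity), ← Complex.exp_add]
  congr 1; push_cast; ring

theorem gfun_cont (s : ℂ) (m n : ℕ) : ContinuousOn (gfun s m) (gapS n) := (gfun_diff s m n).continuousOn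

theorem gfun_hz (s : ℂ) (m : ℕ) (x : ℂ) : gfun s m x = x^(s-1) * hz m (2*π*I*x) := by
  unfold gfun hz
  rw [mul_div_assoc]; congr 3; ring

theorem arc_int (s : ℂ) (m : ℕ) {P : ℂ → ℂ} (hP : ∀ x ∈ gapS 0, HasDerivAt P (gfun s m x) x) :
    ∫ θ in (0:ℝ)..π, I * Complex.exp (I * s * θ) * hz m (Complex.exp (I * θ))
      = Efac s * (P (I/(2*π)) - P (-I/(2*π))) := by
  have h := path_int hP (gfun_cont s m 0) (γ := fun θ : ℝ => ((1/(2*π):ℝ):ℂ) * Complex.exp (((θ - π/2 : ℝ):ℂ) * I))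
    (γ' := fun θ : ℝ => ((1/(2*π):ℝ):ℂ) * (Complex.exp (((θ - π/2 : ℝ):ℂ) * I) * I)) (a := 0) (b := π)
    (by
      intro θ
      apply HasDerivAt.const_mul
      have h1 : HasDerivAt (fun θ : ℝ => ((θ - π/2 : ℝ):ℂ) * I) I θ := by
        have := (((hasDerivAt_id θ).sub_const (π/2)).ofReal_comp).mul_const I
        simpa using this
      exact h1.cexp)
    (by fun_prop)
    (by
      intro θ hθ
      rw [Set.uIcc_of_le Real.pi_pos.le] at hθ
      have e : ((1/(2*π):ℝ):ℂ) * Complex.exp (((θ - π/2 : ℝ):ℂ) * I) = ((1/(2*π)*Real.cos (θ-π/2) : ℝ):ℂ) + ((1/(2*π)*Real.sin (θ-π/2) : ℝ):ℂ) * I := by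
        rw [Complex.exp_mul_I, ← Complex.ofReal_cos, ← Complex.ofReal_sin]; push_cast; ring
      rw [e]
      by_cases hc : θ = π/2
      · right
        subst hc
        simp
        constructor
        · positivity
        · rw [← mul_inv, inv_lt_one_iff₀]; right; linarith [Real.pi_gt_three]
      · left
        simp only [Complex.add_im, Complex.ofReal_im, Complex.mul_im, Complex.ofReal_re, Complex.I_im, Complex.I_re]
        simp
        rcases lt_or_gt_of_ne hc with hh | hh
        · exact (Real.sin_neg_of_neg_of_neg_pi_lt (by linarith) (by linarith [hθ.1, Real.pi_pos])).ne
        · exact (Real.sin_pos_of_pos_of_lt_pi (by linarith) (by linarith [hθ.2, Real.pi_pos])).ne')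
  have e1 : ((1/(2*π):ℝ):ℂ) * Complex.exp (((π - π/2 : ℝ):ℂ) * I) = I/(2*π) := by
    rw [show ((π - π/2 : ℝ):ℂ) * I = π/2*I by push_cast; ring, Complex.exp_pi_div_two_mul_I]; push_cast; ring
  have e2 : ((1/(2*π):ℝ):ℂ) * Complex.exp (((0 - π/2 : ℝ):ℂ) * I) = -I/(2*π) := by
    rw [show ((0 - π/2 : ℝ):ℂ) * I = -(π/2*I) by push_cast; ring, Complex.exp_neg, Complex.exp_pi_div_two_mul_I]; push_cast; simp; ring
  rw [e1, e2] at h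
  rw [← h, ← intervalIntegral.integral_const_mul]
  apply intervalIntegral.integral_congr
  intro θ hθ
  rw [Set.uIcc_of_le Real.pi_pos.le] at hθ
  simp only
  rw [gfun_hz, cpow_polar _ _ (by positivity) (by linarith [hθ.1, Real.pi_pos]) (by linarith [hθ.2, Real.pi_pos]), Efac_eq]
  have e3 : 2*(π:ℂ)*I*(((1/(2*π):ℝ):ℂ) * Complex.exp (((θ - π/2 : ℝ):ℂ) * I)) = Complex.exp (I*θ) := by
    have : I * Complex.exp (((θ - π/2 : ℝ):ℂ) * I) = Complex.exp (I*θ) := by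
      rw [show ((θ - π/2 : ℝ):ℂ) * I = I*θ - π/2*I by push_cast; ring, Complex.exp_sub, Complex.exp_pi_div_two_mul_I]
      field_simp
    rw [← this]; push_cast; field_simp
  rw [e3]
  have e4 : (((1/(2*π):ℝ)):ℂ) = Complex.exp ((Real.log (1/(2*π)) : ℝ)) := by
    rw [← Complex.ofReal_exp, Real.exp_log (by positivity)]
  rw [e4]
  have e5 : Real.log (1/(2*π)) = -Real.log (2*π) := by rw [one_div, Real.log_inv]
  rw [e5]
  have e6 : Complex.exp (I*s*θ) = Complex.exp (s * (Real.log (2*π) + (π/2:ℝ) * I)) * (Complex.exp ((-Real.log (2*π) : ℝ)) * (Complex.exp (((θ - π/2 : ℝ):ℂ) * I)) * Complex.exp ((s-1) * ((-Real.log (2*π) : ℝ) + ((θ - π/2:ℝ):ℂ) * I))) := by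
    rw [← Complex.exp_add, ← Complex.exp_add, ← Complex.exp_add]; congr 1; push_cast; ring
  rw [e6]; ring

theorem tail_int (s : ℂ) (m : ℕ) {P : ℂ → ℂ} (hP : ∀ x ∈ gapS 0, HasDerivAt P (gfun s m x) x) {Y : ℝ} (hY : 1 ≤ Y) :
    ∫ y in (1:ℝ)..Y, (y:ℂ)^(s-1) * hz m y = Efac s * (P (-I/(2*π) * Y) - P (-I/(2*π))) := by
  have h := path_int hP (gfun_cont s m 0) (γ := fun y : ℝ => -I/(2*π) * (y:ℂ)) (γ' := fun _ => -I/(2*π)) (a := 1) (b := Y)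
    (by
      intro θ
      have := (hasDerivAt_id θ).ofReal_comp.const_mul (-I/(2*π):ℂ)
      simpa using this)
    (by fun_prop)
    (by
      intro y hy
      rw [Set.uIcc_of_le hY] at hy
      left
      have : (-I/(2*π) * (y:ℂ)) = ((-(y/(2*π)) : ℝ):ℂ) * I := by push_cast; ring
      rw [this, Complex.mul_I_im, Complex.ofReal_re]
      have : 0 < y/(2*π) := by have := hy.1; positivity
      linarith)
  rw [Complex.ofReal_one, mul_one] at h
  rw [← h, ← intervalIntegral.integral_const_mul]
  apply intervalIntegral.integral_congr
  intro y hy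
  rw [Set.uIcc_of_le hY] at hy
  have hy0 : 0 < y := by linarith [hy.1]
  simp only
  have e0 : (-I/(2*π) * (y:ℂ)) = ((y/(2*π):ℝ):ℂ) * Complex.exp (((-(π/2):ℝ):ℂ) * I) := by
    rw [show ((-(π/2):ℝ):ℂ) * I = -(π/2*I) by push_cast; ring, Complex.exp_neg, Complex.exp_pi_div_two_mul_I]; push_cast; simp; ring
  have e3 : 2*(π:ℂ)*I*(-I/(2*π) * (y:ℂ)) = y := by
    have : (π:ℂ) ≠ 0 := by exact_mod_cast Real.pi_pos.ne'
    field_simp; rw [Complex.I_sq]; ring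
  rw [gfun_hz, e3, e0, cpow_polar _ _ (by positivity) (by linarith [Real.pi_pos]) (by linarith [Real.pi_pos]), Efac_eq]
  have e1 : (-I/(2*π) : ℂ) = Complex.exp (((-Real.log (2*π):ℝ):ℂ) + ((-(π/2):ℝ):ℂ) * I) := by
    rw [Complex.exp_add, show ((-(π/2):ℝ):ℂ) * I = -(π/2*I) by push_cast; ring, Complex.exp_neg (π/2*I), Complex.exp_pi_div_two_mul_I, ← Complex.ofReal_exp, Real.exp_neg, Real.exp_log (by positivity)]; push_cast; simp; ring
  rw [e1, Real.log_div hy0.ne' (by positivity), Complex.cpow_def_of_ne_zero (by exact_mod_cast hy0.ne'), ← Complex.ofReal_log hy0.le]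
  rw [← mul_assoc, ← mul_assoc, ← Complex.exp_add, ← Complex.exp_add]
  congr 2
  push_cast; ring

theorem loop_split (s : ℂ) (m : ℕ) : hLoop m s = hLoop2 m s + (1 - Complex.exp (2*π*I*s)) *
    ∫ θ in (0:ℝ)..π, I * Complex.exp (I * s * θ) * hz m (Complex.exp (I * θ)) := by
  set f : ℝ → ℂ := fun θ => I * Complex.exp (I * s * θ) * hz m (Complex.exp (I * θ)) with hf
  have hc : Continuous f := by
    have := hLoop_integrand_cont m
    simp only [hf]; fun_prop
  have hi : ∀ a b, IntervalIntegrable f volume a b := fun a b => hc.intervalIntegrable a b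
  have h1 : ∫ θ in (2*π)..(3*π), f θ = Complex.exp (2*π*I*s) * ∫ θ in (0:ℝ)..π, f θ := by
    have := intervalIntegral.integral_comp_add_right (a := 0) (b := π) f (2*π)
    rw [show 0 + 2*π = 2*π by ring, show π + 2*π = 3*π by ring] at this
    rw [← this, ← intervalIntegral.integral_const_mul]
    apply intervalIntegral.integral_congr
    intro θ _
    simp only [hf]
    have e1 : Complex.exp (I * ((θ + 2*π : ℝ):ℂ)) = Complex.exp (I*θ) := by
      rw [show I * ((θ + 2*π : ℝ):ℂ) = I*θ + 2*π*I by push_cast; ring, Complex.exp_add, Complex.exp_two_pi_mul_I, mul_one]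
    have e2 : Complex.exp (I * s * ((θ + 2*π : ℝ):ℂ)) = Complex.exp (2*π*I*s) * Complex.exp (I*s*θ) := by
      rw [← Complex.exp_add]; congr 1; push_cast; ring
    rw [e1, e2]; ring
  have h2 : hLoop m s = (∫ θ in (0:ℝ)..π, f θ) + ∫ θ in π..(2*π), f θ :=
    (intervalIntegral.integral_add_adjacent_intervals (hi _ _) (hi _ _)).symm
  have h3 : hLoop2 m s = (∫ θ in π..(2*π), f θ) + ∫ θ in (2*π)..(3*π), f θ :=
    (intervalIntegral.integral_add_adjacent_intervals (hi _ _) (hi _ _)).symm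
  rw [h2, h3, h1]; ring

theorem hTail_integrable (m : ℕ) (s : ℂ) : IntegrableOn (fun y : ℝ => (y:ℂ)^(s-1) * hz m y) (Set.Ioi 1) := by
  have h := hz_mellinConv m (s := (max 2 s.re : ℝ)) (by simp)
  have h2 : IntegrableOn (fun y : ℝ => (y:ℂ)^(((max 2 s.re : ℝ):ℂ)-1) * hz m y) (Set.Ioi 1) :=
    IntegrableOn.mono_set h (Set.Ioi_subset_Ioi zero_le_one)
  refine Integrable.mono h2 ?_ ?_
  · apply ContinuousOn.aestronglyMeasurable _ measurableSet_Ioi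
    intro y hy
    have hp : (0:ℝ) < y := lt_trans one_pos hy
    apply ContinuousAt.continuousWithinAt
    apply ContinuousAt.mul
    · exact Complex.continuousAt_ofReal_cpow_const _ _ (Or.inr hp.ne')
    · exact (hz_cont m).continuousAt (Ioi_mem_nhds hp)
  · rw [ae_restrict_iff' measurableSet_Ioi]
    refine Filter.Eventually.of_forall fun y hy => ?_
    have hp : (0:ℝ) < y := lt_trans one_pos hy
    rw [norm_mul, norm_mul, Complex.norm_cpow_eq_rpow_re_of_pos hp, Complex.norm_cpow_eq_rpow_re_of_pos hp]
    apply mul_le_mul_of_nonneg_right _ (norm_nonneg _)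
    apply Real.rpow_le_rpow_of_exponent_le (le_of_lt hy)
    rw [Complex.sub_re, Complex.sub_re, Complex.ofReal_re]; have := le_max_right 2 s.re; linarith



theorem gfun_norm (s : ℂ) (m : ℕ) {x : ℂ} (hx : x ≠ 0) :
    ‖gfun s m x‖ = ‖x‖^(s.re - 1) * Real.exp (-(s.im * x.arg)) * Real.exp (2*π*m*x.im)
      / ‖Complex.exp (2*π*I*x) - 1‖ := by
  unfold gfun
  rw [norm_div, norm_mul, Complex.norm_cpow_of_ne_zero hx, Complex.norm_exp, Real.exp_neg, ← div_eq_mul_inv]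
  congr 2
  · simp; rw [mul_comm x.arg]
  · congr 1; simp

theorem exp2pi_ne {s : ℂ} (hs : 0 < s.im) : Complex.exp (2*π*I*s) - 1 ≠ 0 := by
  apply exp_two_pi_ne_one
  rintro k rfl; simp at hs

theorem rpow_abs_bound {r R κ : ℝ} (h1 : 1 ≤ r) (h2 : r ≤ R) : r^κ ≤ R^|κ| :=
  (Real.rpow_le_rpow_of_exponent_le h1 (le_abs_self κ)).trans
    (Real.rpow_le_rpow (by linarith) h2 (abs_nonneg _))

open Filter Topology in
theorem contour (s : ℂ) (hs : 0 < s.im) (m n : ℕ) {x0 : ℝ} (h0 : 0 ≤ x0)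
    {Q : ℂ → ℂ} (hQ : ∀ x ∈ gapS n, HasDerivAt Q (gfun s m x) x) :
    Tendsto (fun R : ℝ => Q (x0 + dirE * ((-R:ℝ):ℂ))) atTop
      (𝓝 (Q (I/(2*π)) + (Complex.Gamma s * (riemannZeta s - ∑ k ∈ Finset.Icc 1 m, (k:ℂ)^(-s))
        - hLoop2 m s / (Complex.exp (2*π*I*s) - 1)) / Efac s - ∑ k ∈ Finset.Icc 1 n, (k:ℂ)^(s-1))) := by
  obtain ⟨P, hP⟩ := gfun_prim s m 0
  have he := exp2pi_ne hs
  have hE := Efac_ne s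
  have hk := hankel m hs
  rw [loop_split, arc_int s m hP] at hk
  have hk2 : Complex.Gamma s * (riemannZeta s - ∑ k ∈ Finset.Icc 1 m, (k:ℂ)^(-s))
        - hLoop2 m s / (Complex.exp (2*π*I*s) - 1) = hTail m s - Efac s * (P (I/(2*π)) - P (-I/(2*π))) := by
    apply mul_left_cancel₀ he
    rw [mul_sub, mul_div_cancel₀ _ he]
    linear_combination hk
  rw [hk2]
  have t1 : Tendsto (fun Y : ℝ => ∫ y in (1:ℝ)..Y, (y:ℂ)^(s-1) * hz m y) atTop (𝓝 (hTail m s)) :=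
    intervalIntegral_tendsto_integral_Ioi 1 (hTail_integrable m s) tendsto_id
  have t2 : Tendsto (fun Y : ℝ => Q (-I/(2*π) * Y)) atTop (𝓝 (Q (I/(2*π)) + (hTail m s - Efac s * (P (I/(2*π)) - P (-I/(2*π)))) / Efac s - ∑ k ∈ Finset.Icc 1 n, (k:ℂ)^(s-1))) := by
    have t3 := ((t1.div_const (Efac s)).add_const (P (-I/(2*π)) - P (I/(2*π)) + Q (I/(2*π)) - ∑ k ∈ Finset.Icc 1 n, (k:ℂ)^(s-1)))
    have e : hTail m s / Efac s + (P (-I/(2*π)) - P (I/(2*π)) + Q (I/(2*π)) - ∑ k ∈ Finset.Icc 1 n, (k:ℂ)^(s-1)) = Q (I/(2*π)) + (hTail m s - Efac s * (P (I/(2*π)) - P (-I/(2*π)))) / Efac s - ∑ k ∈ Finset.Icc 1 n, (k:ℂ)^(s-1) := by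
      field_simp; ring
    rw [e] at t3
    refine t3.congr' ?_
    filter_upwards [eventually_ge_atTop 1] with Y hY
    rw [tail_int s m hP hY, mul_div_cancel_left₀ _ hE]
    have hg := gap_sum s m hP n hQ (x := -I/(2*π) * Y) (y := I/(2*π))
      (by
        have : (-I/(2*π) * (Y:ℂ)) = ((-(Y/(2*π)) : ℝ):ℂ) * I := by push_cast; ring
        rw [this, Complex.mul_I_im, Complex.ofReal_re]
        have : 0 < Y/(2*π) := by positivity
        linarith)
      (by
        have : (I/(2*π)) = ((1/(2*π) : ℝ):ℂ) * I := by push_cast; ring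
        rw [this, Complex.mul_I_im, Complex.ofReal_re]
        positivity)
    linear_combination hg
  have t4 : Tendsto (fun R : ℝ => 2*π*(R*(√2/2))) atTop atTop :=
    (tendsto_id.atTop_mul_const (by positivity)).const_mul_atTop (by positivity)
  have t5 := t2.comp t4
  have tb : Tendsto (fun R : ℝ => Real.exp (π * s.im) * Real.exp (x0/2) * ((x0 + 2*(R*(√2/2)))^(|s.re-1|+1) * Real.exp (-(1/2) * (x0 + 2*(R*(√2/2)))))) atTop (𝓝 (Real.exp (π * s.im) * Real.exp (x0/2) * 0)) := by
    apply Tendsto.const_mul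
    apply (tendsto_rpow_mul_exp_neg_mul_atTop_nhds_zero (|s.re-1|+1) (1/2) (by norm_num)).comp
    apply tendsto_atTop_add_const_left
    exact (tendsto_id.atTop_mul_const (by positivity)).const_mul_atTop (by positivity)
  rw [mul_zero] at tb
  have t6 : Tendsto (fun R : ℝ => Q (x0 + dirE * ((-R:ℝ):ℂ)) - Q (-I/(2*π) * ((2*π*(R*(√2/2)):ℝ):ℂ))) atTop (𝓝 0) := by
    apply squeeze_zero_norm' _ tb
    have hev : ∀ᶠ R : ℝ in atTop, 1 ≤ R * (√2/2) := by
      have : Tendsto (fun R : ℝ => R*(√2/2)) atTop atTop := tendsto_id.atTop_mul_const (by positivity)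
      exact this.eventually_ge_atTop 1
    filter_upwards [hev] with R hR
    set h := R*(√2/2) with hh
    have ex : (x0 + dirE * ((-R:ℝ):ℂ)) = ((x0 + h : ℝ):ℂ) + ((-h:ℝ):ℂ) * I := by
      rw [dirE_eq, hh]; push_cast; ring
    have ey : -I/(2*π) * ((2*π*h:ℝ):ℂ) = ((0 : ℝ):ℂ) + ((-h:ℝ):ℂ) * I := by
      have : (π:ℂ) ≠ 0 := by exact_mod_cast Real.pi_pos.ne'
      push_cast; field_simp; ring
    rw [ex, ey]
    set S : Set ℂ := {x : ℂ | x.im ∈ Set.Icc (-h) (-h)} ∩ {x : ℂ | x.re ∈ Set.Icc 0 (x0+h)} with hS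
    have hconv : Convex ℝ S := by
      apply Convex.inter
      · exact (convex_Icc (-h) (-h)).linear_preimage Complex.imLm
      · exact (convex_Icc 0 (x0+h)).linear_preimage Complex.reLm
    have hbd := hconv.norm_image_sub_le_of_norm_hasDerivWithin_le (f := Q) (f' := gfun s m)
      (C := Real.exp (π * s.im) * (x0+2*h)^|s.re-1| * Real.exp (-h))
      (fun x hx => (hQ x (lower_sub n (show x.im < 0 by have := hx.1.2; linarith))).hasDerivWithinAt)
      (by
        intro x hx
        have him : x.im = -h := le_antisymm hx.1.2 hx.1.1
        have hx0 : x ≠ 0 := by rintro rfl; simp at him; linarith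
        rw [gfun_norm s m hx0]
        have b1 : 1 ≤ ‖x‖ := by
          have := Complex.abs_im_le_norm x
          rw [him, abs_neg, abs_of_pos (by linarith)] at this; linarith
        have b2 : ‖x‖ ≤ x0 + 2*h := by
          have := Complex.norm_le_abs_re_add_abs_im x
          rw [him, abs_neg, abs_of_pos (show 0 < h by linarith), abs_of_nonneg hx.2.1] at this
          have := hx.2.2; linarith
        have b3 : ‖x‖^(s.re-1) ≤ (x0+2*h)^|s.re-1| := rpow_abs_bound b1 b2
        have b4 : Real.exp (-(s.im * x.arg)) ≤ Real.exp (π * s.im) := by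
          apply Real.exp_le_exp.2
          have := Complex.neg_pi_lt_arg x
          nlinarith
        have b5 : Real.exp (2*π*m*x.im) ≤ 1 := by
          apply Real.exp_le_one_iff.2
          rw [him]
          have : 0 ≤ 2*π*m*h := by positivity
          linarith
        have b6 : Real.exp h ≤ ‖Complex.exp (2*π*I*x) - 1‖ := by
          have h1 := norm_sub_norm_le (Complex.exp (2*π*I*x)) 1
          rw [Complex.norm_exp, norm_one] at h1
          have e : (2*π*I*x).re = 2*π*h := by simp [him]
          rw [e] at h1
          have h2 : Real.exp (h + 1) ≤ Real.exp (2*π*h) := by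
            apply Real.exp_le_exp.2
            nlinarith [Real.pi_gt_three]
          rw [Real.exp_add] at h2
          have h3 := Real.add_one_le_exp (1:ℝ)
          have h4 := Real.one_le_exp (show 0 ≤ h by linarith)
          nlinarith
        have b7 : 0 < Real.exp h := Real.exp_pos h
        calc _ ≤ (x0+2*h)^|s.re-1| * Real.exp (π * s.im) * 1 / Real.exp h := by gcongr
          _ = _ := by rw [Real.exp_neg]; field_simp)
      (x := ((0 : ℝ):ℂ) + ((-h:ℝ):ℂ) * I) (y := ((x0 + h : ℝ):ℂ) + ((-h:ℝ):ℂ) * I)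
      (by constructor <;> simp <;> linarith) (by constructor <;> simp <;> linarith)
    refine hbd.trans ?_
    have e1 : ‖((x0 + h : ℝ):ℂ) + ((-h:ℝ):ℂ) * I - (((0 : ℝ):ℂ) + ((-h:ℝ):ℂ) * I)‖ = x0 + h := by
      rw [add_sub_add_right_eq_sub, ← Complex.ofReal_sub, Complex.norm_real, Real.norm_eq_abs, sub_zero, abs_of_nonneg (by linarith)]
    rw [e1, Real.rpow_add_one (by linarith)]
    have e2 : Real.exp (-h) = Real.exp (x0/2) * Real.exp (-(1/2)*(x0+2*h)) := by
      rw [← Real.exp_add]; congr 1; ring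
    rw [e2]
    have e3 : x0 + h ≤ x0 + 2*h := by linarith
    have e4 : 0 ≤ (x0+2*h)^|s.re-1| := Real.rpow_nonneg (by linarith) _
    calc _ ≤ Real.exp (π * s.im) * (x0+2*h)^|s.re-1| * (Real.exp (x0/2) * Real.exp (-(1/2)*(x0+2*h))) * (x0+2*h) := by gcongr
      _ = _ := by ring
  have t7 := t6.add t5
  rw [zero_add] at t7
  refine t7.congr fun R => ?_
  simp only [Function.comp]
  ring


theorem div_sinh_le {u : ℝ} (hu : 0 < u) : u / Real.sinh u ≤ (1 + 2*u) * Real.exp (-u) := by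
  have h0 : 0 < Real.sinh u := Real.sinh_pos_iff.2 hu
  rw [div_le_iff₀ h0, Real.sinh_eq]
  have h1 := Real.add_one_le_exp (2*u)
  have h2 : Real.exp (-u) * Real.exp u = 1 := by rw [← Real.exp_add]; simp
  have h3 : Real.exp (2*u) * Real.exp (-u) * Real.exp (-u) = 1 := by rw [← Real.exp_add, ← Real.exp_add]; ring_nf; simp
  have h4 : (2*u+1) * (Real.exp (-u) * Real.exp (-u)) ≤ 1 := by
    have : 0 < Real.exp (-u) * Real.exp (-u) := by positivity
    nlinarith
  nlinarith

theorem Gamma_one_add_I (T : ℝ) : ‖Complex.Gamma (1 + T * I)‖ ^ 2 ≤ (1 + 2*(π*|T|)) * Real.exp (-(π*|T|)) := by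
  rcases eq_or_ne T 0 with rfl | hT
  · simp
  have h1 : Complex.Gamma (1 + T * I) * Complex.Gamma (1 - T*I) = ((π*T/Real.sinh (π*T) : ℝ):ℂ) := by
    rw [add_comm, Complex.Gamma_add_one _ (by simp [hT]), mul_assoc, Complex.Gamma_mul_Gamma_one_sub, ← mul_assoc (π:ℂ), Complex.sin_mul_I,
      ← Complex.ofReal_mul, ← Complex.ofReal_sinh]
    push_cast
    have : (Real.sinh (π*T):ℂ) ≠ 0 := by
      exact_mod_cast (by rw [ne_eq, Real.sinh_eq_zero]; exact mul_ne_zero Real.pi_pos.ne' hT : Real.sinh (π*T) ≠ 0)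
    push_cast at this
    field_simp
  have h2 : Complex.Gamma (1 - T*I) = (starRingEnd ℂ) (Complex.Gamma (1 + T*I)) := by
    rw [← Complex.Gamma_conj]; congr 1; simp; ring
  rw [h2, Complex.mul_conj, Complex.normSq_eq_norm_sq] at h1
  have h3 : ‖Complex.Gamma (1 + T * I)‖ ^ 2 = π*T/Real.sinh (π*T) := by exact_mod_cast h1
  rw [h3]
  have h4 : π*T/Real.sinh (π*T) = (π*|T|)/Real.sinh (π*|T|) := by
    rcases abs_cases T with ⟨h, _⟩ | ⟨h, _⟩ <;> rw [h]
    rw [mul_neg, Real.sinh_neg, neg_div_neg_eq]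
  rw [h4]
  exact div_sinh_le (by positivity)

theorem Gamma_one_shift {t y : ℝ} (ht : 1 ≤ t) : ‖Complex.Gamma (1 + ((t+y:ℝ):ℂ) * I)‖ ≤ 3 * t^(1/2:ℝ) * Real.exp |y| * Real.exp (-(π*t/2)) * Real.exp (-(π*y/2)) := by
  apply le_of_sq_le_sq _ (by positivity)
  refine (Gamma_one_add_I (t+y)).trans ?_
  have e : (3 * t^(1/2:ℝ) * Real.exp |y| * Real.exp (-(π*t/2)) * Real.exp (-(π*y/2)))^2 = (9 * t * (Real.exp |y|)^2) * Real.exp (-(π*(t+y))) := by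
    rw [mul_pow, mul_pow, mul_pow, mul_pow, ← Real.sqrt_eq_rpow, Real.sq_sqrt (by linarith)]
    have : Real.exp (-(π*(t+y))) = Real.exp (-(π*t/2))^2 * Real.exp (-(π*y/2))^2 := by
      rw [← Real.exp_nat_mul, ← Real.exp_nat_mul, ← Real.exp_add]; congr 1; push_cast; ring
    rw [this]; ring
  rw [e]
  have h1 : Real.exp (-(π*|t+y|)) ≤ Real.exp (-(π*(t+y))) := by
    apply Real.exp_le_exp.2; have := le_abs_self (t+y); nlinarith [Real.pi_pos]
  have h2 : 1 + 2*(π*|t+y|) ≤ 9 * t * (Real.exp |y|)^2 := by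
    have a1 : |t+y| ≤ t + |y| := by have := abs_add_le t y; rwa [abs_of_pos (by linarith : 0 < t)] at this
    have a2 := Real.add_one_le_exp |y|
    have a3 := abs_nonneg y
    have a4 := Real.pi_lt_d2
    have a5 : π*|t+y| ≤ 3.15 * (t+|y|) := mul_le_mul a4.le a1 (abs_nonneg _) (by norm_num)
    have a6 : (1+|y|)^2 ≤ (Real.exp |y|)^2 := by gcongr; linarith
    nlinarith [mul_nonneg a3 a3, mul_nonneg (by linarith : 0 ≤ t - 1) a3, mul_nonneg (by linarith : (0:ℝ) ≤ t) (mul_nonneg a3 a3)]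
  gcongr

theorem Gamma_norm_le_re {z : ℂ} (hz : 0 < z.re) : ‖Complex.Gamma z‖ ≤ Real.Gamma z.re := by
  rw [Complex.Gamma_eq_integral hz, Real.Gamma_eq_integral hz, Complex.GammaIntegral]
  refine (norm_integral_le_integral_norm _).trans (le_of_eq ?_)
  apply setIntegral_congr_fun measurableSet_Ioi
  intro x hx
  simp only
  rw [norm_mul, Complex.norm_cpow_eq_rpow_re_of_pos hx, Complex.norm_real, Real.norm_eq_abs, abs_of_pos (Real.exp_pos _)]
  simp

open Complex.HadamardThreeLines in
theorem Gamma_strip {x t : ℝ} (hx0 : 0 ≤ x) (hx1 : x ≤ 1) (ht : 1 ≤ t) :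
    ‖Complex.Gamma (((1+x:ℝ):ℂ) + t * I)‖ ≤ 6 * Real.exp 2 * t^(1/2+x) * Real.exp (-(π*t/2)) := by
  have ht0 : 0 < t := by linarith
  set F : ℂ → ℂ := fun z => Complex.Gamma (1 + z + t*I) * Complex.exp (-(I*(π:ℂ)*z/2)) * Complex.exp (z^2) with hF
  have hnorm : ∀ z, ‖F z‖ = ‖Complex.Gamma (1 + z + t*I)‖ * Real.exp (π*z.im/2) * Real.exp (z.re^2 - z.im^2) := by
    intro z
    simp only [hF]
    rw [norm_mul, norm_mul, Complex.norm_exp, Complex.norm_exp]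
    congr 3
    · simp; ring
    · congr 1; simp [sq]
  have hexp : ∀ y : ℝ, Real.exp |y| * Real.exp |y| * Real.exp (-y^2) ≤ Real.exp 1 := by
    intro y
    rw [← Real.exp_add, ← Real.exp_add]
    apply Real.exp_le_exp.2
    nlinarith [sq_nonneg (|y| - 1), sq_abs y]
  have ha : ∀ z ∈ re ⁻¹' {(0:ℝ)}, ‖F z‖ ≤ 6 * Real.exp 2 * Real.exp (-(π*t/2)) * t^(1/2:ℝ) := by
    intro z hz
    have hz : z.re = 0 := hz
    rw [hnorm, hz]
    have e : 1 + z + t*I = 1 + ((t+z.im:ℝ):ℂ)*I := by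
      apply Complex.ext <;> simp [hz]; ring
    rw [e]
    have h1 := Gamma_one_shift (y := z.im) ht
    have h2 := hexp z.im
    have h3 : Real.exp (-(π*z.im/2)) * Real.exp (π*z.im/2) = 1 := by rw [← Real.exp_add]; simp
    have h4 : (0:ℝ)^2 - z.im^2 = -z.im^2 := by ring
    rw [h4]
    have h5 : 1 ≤ Real.exp |z.im| := Real.one_le_exp (abs_nonneg _)
    have h6 : Real.exp 1 ≤ Real.exp 2 := Real.exp_le_exp.2 (by norm_num)
    calc _ ≤ (3 * t^(1/2:ℝ) * Real.exp |z.im| * Real.exp (-(π*t/2)) * Real.exp (-(π*z.im/2))) * Real.exp (π*z.im/2) * Real.exp (-z.im^2) := by gcongr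
      _ = 3 * t^(1/2:ℝ) * Real.exp (-(π*t/2)) * (Real.exp |z.im| * 1 * Real.exp (-z.im^2)) * (Real.exp (-(π*z.im/2)) * Real.exp (π*z.im/2)) := by ring
      _ ≤ 3 * t^(1/2:ℝ) * Real.exp (-(π*t/2)) * (Real.exp |z.im| * Real.exp |z.im| * Real.exp (-z.im^2)) * (Real.exp (-(π*z.im/2)) * Real.exp (π*z.im/2)) := by gcongr
      _ ≤ 6 * t^(1/2:ℝ) * Real.exp (-(π*t/2)) * (Real.exp 2) * 1 := by
        rw [h3]; gcongr
        · norm_num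
        · exact h2.trans h6
      _ = _ := by ring
  have hb : ∀ z ∈ re ⁻¹' {(1:ℝ)}, ‖F z‖ ≤ 6 * Real.exp 2 * Real.exp (-(π*t/2)) * t^(3/2:ℝ) := by
    intro z hz
    have hz : z.re = 1 := hz
    rw [hnorm, hz]
    have e : 1 + z + t*I = (1 + ((t+z.im:ℝ):ℂ)*I) + 1 := by
      apply Complex.ext <;> simp [hz]; ring
    rw [e, Complex.Gamma_add_one _ (by intro h; have := congrArg Complex.re h; simp at this), norm_mul]
    have h1 := Gamma_one_shift (y := z.im) ht
    have h2 := hexp z.im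
    have h3 : Real.exp (-(π*z.im/2)) * Real.exp (π*z.im/2) = 1 := by rw [← Real.exp_add]; simp
    have h4 : Real.exp ((1:ℝ)^2 - z.im^2) = Real.exp 1 * Real.exp (-z.im^2) := by rw [← Real.exp_add]; ring_nf
    rw [h4]
    have h5 : ‖1 + ((t+z.im:ℝ):ℂ)*I‖ ≤ 2 * t * Real.exp |z.im| := by
      refine (norm_add_le _ _).trans ?_
      rw [norm_one, norm_mul, Complex.norm_I, mul_one, Complex.norm_real, Real.norm_eq_abs]
      have a1 : |t+z.im| ≤ t + |z.im| := by have := abs_add_le t z.im; rwa [abs_of_pos (by linarith : 0 < t)] at this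
      have a2 := Real.add_one_le_exp |z.im|
      nlinarith [abs_nonneg z.im]
    have h6 : Real.exp 1 * Real.exp 1 = Real.exp 2 := by rw [← Real.exp_add]; norm_num
    have h7 : t^(3/2:ℝ) = t * t^(1/2:ℝ) := by rw [show (3/2:ℝ) = 1/2+1 by norm_num, Real.rpow_add_one ht0.ne']; ring
    calc _ ≤ (2 * t * Real.exp |z.im|) * (3 * t^(1/2:ℝ) * Real.exp |z.im| * Real.exp (-(π*t/2)) * Real.exp (-(π*z.im/2))) * Real.exp (π*z.im/2) * (Real.exp 1 * Real.exp (-z.im^2)) := by gcongr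
      _ = 6 * (t * t^(1/2:ℝ)) * Real.exp (-(π*t/2)) * (Real.exp 1 * (Real.exp |z.im| * Real.exp |z.im| * Real.exp (-z.im^2))) * (Real.exp (-(π*z.im/2)) * Real.exp (π*z.im/2)) := by ring
      _ ≤ 6 * (t * t^(1/2:ℝ)) * Real.exp (-(π*t/2)) * (Real.exp 1 * Real.exp 1) * 1 := by
        rw [h3]; gcongr
      _ = _ := by rw [h6, h7]; ring
  have hdiff : ∀ z : ℂ, 0 ≤ z.re → DifferentiableAt ℂ F z := by
    intro z hz
    simp only [hF]
    apply DifferentiableAt.mul (DifferentiableAt.mul _ (by fun_prop)) (by fun_prop)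
    apply DifferentiableAt.fun_comp' (g := Complex.Gamma) (f := fun z => 1 + z + t*I) z _ (by fun_prop)
    apply Complex.differentiableAt_Gamma
    intro k h
    have := congrArg Complex.re h
    simp at this
    have : (0:ℝ) ≤ k := Nat.cast_nonneg k
    linarith
  have hd : DiffContOnCl ℂ F (verticalStrip 0 1) := by
    apply DifferentiableOn.diffContOnCl
    intro z hz
    apply (hdiff z _).differentiableWithinAt
    have h1 : closure (verticalStrip 0 1) ⊆ re ⁻¹' (Set.Icc 0 1) :=
      closure_minimal (Set.preimage_mono Set.Ioo_subset_Icc_self) (isClosed_Icc.preimage Complex.continuous_re)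
    exact (h1 hz).1
  obtain ⟨M, hM⟩ := (isCompact_Icc (a := (1:ℝ)) (b := 2)).exists_bound_of_continuousOn (f := Real.Gamma) (by
    intro x hx
    apply ContinuousAt.continuousWithinAt
    apply (Real.differentiableAt_Gamma _).continuousAt
    intro k h; have := hx.1; have : (0:ℝ) ≤ k := Nat.cast_nonneg k; linarith)
  have hB : BddAbove ((norm ∘ F) '' verticalClosedStrip 0 1) := by
    refine ⟨M * Real.exp (1 + π^2), ?_⟩
    rintro _ ⟨z, hz, rfl⟩
    have hz : z.re ∈ Set.Icc 0 1 := hz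
    simp only [Function.comp]
    rw [hnorm, mul_assoc, ← Real.exp_add]
    have e : (1 + z + t*I).re = 1 + z.re := by simp
    have h1 := Gamma_norm_le_re (z := 1 + z + t*I) (by rw [e]; linarith [hz.1])
    rw [e] at h1
    have h2 := (le_abs_self _).trans (hM (1+z.re) ⟨by linarith [hz.1], by linarith [hz.2]⟩)
    have h3 : π*z.im/2 + (z.re^2 - z.im^2) ≤ 1 + π^2 := by
      nlinarith [sq_nonneg (π/2 - z.im), hz.1, hz.2, Real.pi_pos]
    have h4 : 0 ≤ M := (norm_nonneg _).trans (h1.trans h2)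
    gcongr
    exact h1.trans h2
  have hfin := norm_le_interp_of_mem_verticalClosedStrip' (f := F) (z := (x:ℂ)) zero_lt_one ⟨by simpa using hx0, by simpa using hx1⟩ hd hB ha hb
  rw [hnorm] at hfin
  simp only [Complex.ofReal_re, Complex.ofReal_im, sub_zero, div_one] at hfin
  have e1 : (1 + (x:ℂ) + t*I) = ((1+x:ℝ):ℂ) + t*I := by push_cast; ring
  rw [e1] at hfin
  set K := 6 * Real.exp 2 * Real.exp (-(π*t/2)) with hK
  have hKp : 0 < K := by positivity
  have e2 : (K * t^(1/2:ℝ))^(1-x) * (K * t^(3/2:ℝ))^x = K * t^(1/2+x) := by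
    rw [Real.mul_rpow hKp.le (by positivity), Real.mul_rpow hKp.le (by positivity), ← Real.rpow_mul ht0.le, ← Real.rpow_mul ht0.le]
    have : K^(1-x) * t^(1/2*(1-x)) * (K^x * t^(3/2*x)) = (K^(1-x) * K^x) * (t^(1/2*(1-x)) * t^(3/2*x)) := by ring
    rw [this, ← Real.rpow_add hKp, ← Real.rpow_add ht0]
    have : 1/2*(1-x)+3/2*x = 1/2+x := by ring
    rw [this]; simp
  rw [e2] at hfin
  have e3 : 1 ≤ Real.exp (π*0/2) * Real.exp (x^2 - 0^2) := by
    rw [← Real.exp_add]; apply Real.one_le_exp; nlinarith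
  calc ‖Complex.Gamma (((1+x:ℝ):ℂ) + t * I)‖ ≤ ‖Complex.Gamma (((1+x:ℝ):ℂ) + t * I)‖ * (Real.exp (π*0/2) * Real.exp (x^2 - 0^2)) := le_mul_of_one_le_right (norm_nonneg _) e3
    _ ≤ K * t^(1/2+x) := by rw [← mul_assoc]; exact hfin
    _ = _ := by rw [hK]; ring


theorem Gamma_upper (n : ℕ) : ∃ C : ℝ, 0 ≤ C ∧ ∀ s : ℂ, 1 - (n:ℝ) ≤ s.re → s.re ≤ 2 + n → 1 ≤ s.im →
    ‖Complex.Gamma s‖ ≤ C * s.im^(s.re - 1/2) * Real.exp (-(π*s.im/2)) := by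
  induction n with
  | zero =>
    refine ⟨6 * Real.exp 2, by positivity, fun s h1 h2 ht => ?_⟩
    simp at h1 h2
    have := Gamma_strip (x := s.re - 1) (t := s.im) (by linarith) (by linarith) ht
    have e : (((1 + (s.re - 1) : ℝ):ℂ) + s.im * I) = s := by
      rw [add_sub_cancel, Complex.re_add_im]
    rw [e] at this
    convert this using 4
    ring
  | succ n ih =>
    obtain ⟨C, hC0, hC⟩ := ih
    refine ⟨C * (n + 3), by positivity, fun s h1 h2 ht => ?_⟩
    push_cast at h1 h2
    have ht0 : 0 < s.im := by linarith
    have hE : 0 < Real.exp (-(π*s.im/2)) := Real.exp_pos _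
    have hn : (0:ℝ) ≤ n := Nat.cast_nonneg n
    have hmono : ∀ p : ℝ, C * p * Real.exp (-(π*s.im/2)) = C * p * Real.exp (-(π*s.im/2)) := fun _ => rfl
    by_cases c1 : s.re < 1 - n
    · -- use s+1
      have hs0 : s ≠ 0 := by rintro rfl; simp at ht0
      have hg := hC (s+1) (by simp; linarith) (by simp; linarith) (by simpa using ht)
      rw [Complex.Gamma_add_one s hs0, norm_mul] at hg
      simp only [Complex.add_re, Complex.one_re, Complex.add_im, Complex.one_im, add_zero] at hg
      have h3 : s.im ≤ ‖s‖ := (le_abs_self _).trans (Complex.abs_im_le_norm s)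
      have h4 : s.im^(s.re + 1 - 1/2) = s.im * s.im^(s.re - 1/2) := by
        rw [show s.re + 1 - 1/2 = (s.re - 1/2) + 1 by ring, Real.rpow_add_one ht0.ne']; ring
      rw [h4] at hg
      have h5 : s.im * ‖Complex.Gamma s‖ ≤ s.im * (C * s.im^(s.re-1/2) * Real.exp (-(π*s.im/2))) := by
        calc _ ≤ ‖s‖ * ‖Complex.Gamma s‖ := by gcongr
          _ ≤ _ := hg
          _ = _ := by ring
      have h6 := le_of_mul_le_mul_left h5 ht0
      refine h6.trans ?_
      have : C ≤ C * (n+3) := by nlinarith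
      gcongr
    by_cases c2 : s.re ≤ 2 + n
    · refine (hC s (by linarith) c2 ht).trans ?_
      have : C ≤ C * (n+3) := by nlinarith
      gcongr
    · push Not at c1 c2
      have hs0 : s - 1 ≠ 0 := by intro h; have := congrArg Complex.im h; simp at this; linarith
      have hg := hC (s-1) (by simp; linarith) (by simp; linarith) (by simpa using ht)
      have e : Complex.Gamma s = (s-1) * Complex.Gamma (s-1) := by
        rw [← Complex.Gamma_add_one _ hs0]; simp
      rw [e, norm_mul]
      simp only [Complex.sub_re, Complex.one_re, Complex.sub_im, Complex.one_im, sub_zero] at hg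
      have h4 : s.im^(s.re - 1/2) = s.im * s.im^(s.re - 1 - 1/2) := by
        rw [show s.re - 1/2 = (s.re - 1 - 1/2) + 1 by ring, Real.rpow_add_one ht0.ne']; ring
      rw [h4]
      have h5 : ‖s - 1‖ ≤ (n+3) * s.im := by
        have := Complex.norm_le_abs_re_add_abs_im (s-1)
        simp only [Complex.sub_re, Complex.one_re, Complex.sub_im, Complex.one_im, sub_zero] at this
        rw [abs_of_pos (show 0 < s.re - 1 by linarith), abs_of_pos ht0] at this
        nlinarith
      calc _ ≤ ((n+3) * s.im) * (C * s.im^(s.re - 1 - 1/2) * Real.exp (-(π*s.im/2))) := by gcongr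
        _ = _ := by ring

theorem sin_norm_le (z : ℂ) : ‖Complex.sin z‖ ≤ Real.exp |z.im| := by
  rw [Complex.sin, norm_div, norm_mul, Complex.norm_I, mul_one]
  have h1 : ‖Complex.exp (-z * I)‖ ≤ Real.exp |z.im| := by
    rw [Complex.norm_exp]; apply Real.exp_le_exp.2; simp [le_abs_self]
  have h2 : ‖Complex.exp (z * I)‖ ≤ Real.exp |z.im| := by
    rw [Complex.norm_exp]; apply Real.exp_le_exp.2; simp [neg_le_abs]
  have h3 := norm_sub_le (Complex.exp (-z * I)) (Complex.exp (z * I))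
  have : ‖(2:ℂ)‖ = 2 := by simp
  rw [this]; linarith

theorem Efac_norm (s : ℂ) : ‖Efac s‖ = (2*π)^s.re * Real.exp (-(π*s.im/2)) := by
  unfold Efac
  rw [norm_mul, Complex.norm_cpow_eq_rpow_re_of_pos (by positivity), Complex.norm_exp]
  congr 2
  simp
  ring

theorem D_bound (A B : ℝ) : ∃ C : ℝ, 0 ≤ C ∧ ∀ s : ℂ, A ≤ s.re → s.re ≤ B → 1 ≤ s.im →
    ‖Efac s / Complex.Gamma s‖ ≤ C * s.im^(1/2 - s.re) := by
  obtain ⟨n, hn⟩ := exists_nat_ge (max (|A|+1) (|B|+1))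
  obtain ⟨C, hC0, hC⟩ := Gamma_upper n
  refine ⟨(2*π)^B * C / π, by positivity, fun s h1 h2 ht => ?_⟩
  have ht0 : 0 < s.im := by linarith
  have hA := (le_max_left _ _).trans hn
  have hB := (le_max_right _ _).trans hn
  have a1 := neg_abs_le A
  have a2 := le_abs_self B
  have hg := hC ((starRingEnd ℂ) (1 - s)) (by simp; linarith) (by simp; linarith) (by simpa using ht)
  rw [Complex.Gamma_conj, Complex.norm_conj] at hg
  simp only [Complex.conj_re, Complex.sub_re, Complex.one_re, Complex.conj_im, Complex.sub_im, Complex.one_im, zero_sub, neg_neg] at hg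
  have hsin : Complex.sin (π * s) ≠ 0 := by
    intro h
    rw [Complex.sin_eq_zero_iff] at h
    obtain ⟨k, hk⟩ := h
    have := congrArg Complex.im hk
    simp at this
    linarith
  have hr := Complex.Gamma_mul_Gamma_one_sub s
  have hG0 : Complex.Gamma s ≠ 0 := by
    intro h; rw [h, zero_mul] at hr
    exact div_ne_zero (by exact_mod_cast Real.pi_pos.ne') hsin hr.symm
  have hinv : (Complex.Gamma s)⁻¹ = Complex.Gamma (1-s) * Complex.sin (π*s) / π := by
    have : (π:ℂ) ≠ 0 := by exact_mod_cast Real.pi_pos.ne'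
    rw [inv_eq_iff_eq_inv, eq_comm, inv_eq_iff_eq_inv, eq_comm, ← mul_right_inj' hG0, mul_inv_cancel₀ hG0, mul_div_assoc', ← mul_assoc, hr]
    field_simp
  rw [div_eq_mul_inv, hinv, norm_mul, norm_div, norm_mul, Efac_norm, Complex.norm_real, Real.norm_eq_abs, abs_of_pos Real.pi_pos]
  have hs2 := sin_norm_le (π*s)
  have e : (π*s:ℂ).im = π*s.im := by simp
  rw [e, abs_of_pos (by positivity)] at hs2
  have h3 : (2*π)^s.re ≤ (2*π)^B := Real.rpow_le_rpow_of_exponent_le (by linarith [Real.pi_gt_three]) h2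
  have e5 : 1 - s.re - 1/2 = 1/2 - s.re := by ring
  rw [e5] at hg
  have e6 : Real.exp (-(π*s.im/2)) * Real.exp (-(π*s.im/2)) * Real.exp (π*s.im) = 1 := by
    rw [← Real.exp_add, ← Real.exp_add]; ring_nf; simp
  calc _ ≤ (2*π)^B * Real.exp (-(π*s.im/2)) * ((C * s.im^(1/2-s.re) * Real.exp (-(π*s.im/2))) * Real.exp (π*s.im) / π) := by gcongr
    _ = (2*π)^B * C / π * s.im^(1/2-s.re) * (Real.exp (-(π*s.im/2)) * Real.exp (-(π*s.im/2)) * Real.exp (π*s.im)) := by ring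
    _ = _ := by rw [e6, mul_one]


def akm (ak : ℕ → ℂ) (j k : ℕ) : ℂ := if j ≤ k then ak (k - j) else 0

theorem ak_bound {s : ℂ} {τ M : ℝ} (hτ : 1 ≤ τ) (hs : Real.sqrt s.im = τ^3) (hM : |s.re| ≤ M) {ak : ℕ → ℂ} (h : IsAk s ak) (k : ℕ) :
    ‖ak k‖ * τ^k ≤ (M+2)^k := by
  have hM0 : 0 ≤ M := (abs_nonneg _).trans hM
  induction k using Nat.strong_induction_on with
  | _ k ih =>
    rcases k with _ | k
    · simp [h.1]
    · have h1 := h.2 k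
      have hk := ih k (by omega)
      have h2 : ((k:ℝ)+1) * τ^3 * ‖ak (k+1)‖ ≤ (k+1+M) * ‖ak k‖ + ‖(if 2 ≤ k then ak (k-2) else 0)‖ := by
        have e : ‖((k:ℂ) + 1) * (Real.sqrt s.im : ℂ) * ak (k+1)‖ = ((k:ℝ)+1) * τ^3 * ‖ak (k+1)‖ := by
          rw [norm_mul, norm_mul, hs, Complex.norm_real, Real.norm_eq_abs, abs_of_pos (by positivity)]
          congr 2
          have : ((k:ℂ)+1) = ((k+1:ℕ):ℂ) := by push_cast; ring
          rw [this, Complex.norm_natCast]; push_cast; ring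
        rw [← e, h1]
        refine (norm_add_le _ _).trans ?_
        rw [norm_mul, norm_mul, Complex.norm_I, one_mul, norm_neg]
        gcongr
        have : ((k:ℂ) + 1 - (s.re:ℂ)) = ((k+1-s.re : ℝ):ℂ) := by push_cast; ring
        rw [this, Complex.norm_real, Real.norm_eq_abs, abs_le]
        have := abs_le.1 hM
        have hk0 : (0:ℝ) ≤ k := Nat.cast_nonneg k
        constructor <;> linarith
      have h3 : ‖(if 2 ≤ k then ak (k-2) else 0)‖ * τ^k ≤ τ^2 * (M+2)^k := by
        split_ifs with hc
        · have := ih (k-2) (by omega)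
          obtain ⟨j, rfl⟩ := Nat.exists_eq_add_of_le' hc
          simp only [Nat.add_sub_cancel] at this ⊢
          have h4 : (M+2)^j ≤ (M+2)^(j+2) := pow_le_pow_right₀ (by linarith) (by omega)
          calc _ = τ^2 * (‖ak j‖ * τ^j) := by ring
            _ ≤ τ^2 * (M+2)^(j+2) := by gcongr; linarith
        · simp; positivity
      have hk0 : (0:ℝ) ≤ k := Nat.cast_nonneg k
      have h5 : ((k:ℝ)+1) * (τ^2 * (‖ak (k+1)‖ * τ^(k+1))) ≤ ((k:ℝ)+1) * (τ^2 * (M+2)^(k+1)) := by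
        have hp : 0 ≤ (M+2)^k := by positivity
        have hτ2 : 1 ≤ τ^2 := one_le_pow₀ hτ
        calc _ = ((k:ℝ)+1) * τ^3 * ‖ak (k+1)‖ * τ^k := by ring
          _ ≤ ((k+1+M) * ‖ak k‖ + ‖(if 2 ≤ k then ak (k-2) else 0)‖) * τ^k := by gcongr
          _ = (k+1+M) * (‖ak k‖ * τ^k) + ‖(if 2 ≤ k then ak (k-2) else 0)‖ * τ^k := by ring
          _ ≤ (k+1+M) * (τ^2 * (M+2)^k) + τ^2 * (M+2)^k := by
            have hk' : ‖ak k‖ * τ^k ≤ τ^2 * (M+2)^k := by nlinarith [ih k (by omega)]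
            have := mul_le_mul_of_nonneg_left hk' (by positivity : (0:ℝ) ≤ k+1+M)
            linarith
          _ = (k+1+M+1) * (τ^2 * (M+2)^k) := by ring
          _ ≤ ((k+1) * (M+2)) * (τ^2 * (M+2)^k) := by
            gcongr
            nlinarith
          _ = _ := by ring
      have h6 := le_of_mul_le_mul_left h5 (by positivity)
      exact le_of_mul_le_mul_left h6 (by positivity)

def Tpoly (ak : ℕ → ℂ) (N : ℕ) (w : ℂ) : ℂ := ∑ k ∈ Finset.range N, ak k * w^k
def Tpoly' (ak : ℕ → ℂ) (N : ℕ) (w : ℂ) : ℂ := ∑ k ∈ Finset.range N, ak k * (k * w^(k-1))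

theorem Tpoly_deriv (ak : ℕ → ℂ) (N : ℕ) (w : ℂ) : HasDerivAt (Tpoly ak N) (Tpoly' ak N w) w := by
  unfold Tpoly Tpoly'
  apply HasDerivAt.fun_sum
  intro k _
  exact (hasDerivAt_pow k w).const_mul (ak k)

/-- residual -/
def Qres (τ : ℝ) (ak : ℕ → ℂ) (N : ℕ) (w : ℂ) : ℂ :=
  (τ:ℂ)^3 * N * ak N * w^(N-1) + I * akm ak 2 N * w^N + I * akm ak 1 N * w^(N+1)

theorem Tpoly_ode {s : ℂ} {τ : ℝ} (hs : Real.sqrt s.im = τ^3) {ak : ℕ → ℂ} (h : IsAk s ak) (N : ℕ) (w : ℂ) :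
    ((s.re:ℂ) - 1 + I * w^2) * Tpoly ak N w - ((τ:ℂ)^3 + w) * Tpoly' ak N w = Qres τ ak N w := by
  induction N with
  | zero => simp [Tpoly, Tpoly', Qres, akm]
  | succ N ih =>
    have e1 : Tpoly ak (N+1) w = Tpoly ak N w + ak N * w^N := by simp [Tpoly, Finset.sum_range_succ]
    have e2 : Tpoly' ak (N+1) w = Tpoly' ak N w + ak N * (N * w^(N-1)) := by simp [Tpoly', Finset.sum_range_succ]
    have h1 := h.2 N
    rw [hs] at h1
    have e4 : akm ak 1 (N+1) = ak N := by simp [akm]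
    have e5 : akm ak 2 (N+1) = akm ak 1 N := by unfold akm; congr 1; simp
    have e6 : (if 2 ≤ N then ak (N-2) else 0) = akm ak 2 N := rfl
    rw [e6] at h1
    have e7 : (N:ℂ) * w^(N-1) * w = N * w^N := by
      rcases N with _ | N
      · simp
      · simp; ring
    have : ((s.re:ℂ) - 1 + I * w^2) * Tpoly ak (N+1) w - ((τ:ℂ)^3 + w) * Tpoly' ak (N+1) w
        = Qres τ ak N w + ((s.re:ℂ) - 1 + I * w^2) * (ak N * w^N) - ((τ:ℂ)^3 + w) * (ak N * (N * w^(N-1))) := by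
      rw [e1, e2, ← ih]; ring
    rw [this]
    unfold Qres
    rw [e4, e5, Nat.add_sub_cancel]
    push_cast at h1 ⊢
    linear_combination -w^N * h1 - ak N * e7

theorem wfun_eq {s : ℂ} {τ : ℝ} (hτ : 1 ≤ τ) (ht : s.im = τ^6) (hs : Real.sqrt s.im = τ^3) (w : ℂ) :
    wfun s w = Complex.exp (((s.re:ℂ)-1) * Complex.log (1 + w/(τ:ℂ)^3) + I * (τ:ℂ)^6 * (Complex.log (1 + w/(τ:ℂ)^3) - (w/(τ:ℂ)^3 - (w/(τ:ℂ)^3)^2/2))) := by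
  unfold wfun
  rw [hs]
  congr 1
  have h0 : (τ:ℂ) ≠ 0 := by exact_mod_cast (by linarith : τ ≠ 0)
  have e : s = (s.re:ℂ) + (τ:ℂ)^6 * I := by
    conv_lhs => rw [← Complex.re_add_im s, ht]
    push_cast; ring
  rw [e]
  push_cast
  simp only [Complex.add_re, Complex.ofReal_re]
  have : ((τ:ℂ)^6 * I).re = 0 := by rw [← Complex.ofReal_pow, Complex.re_ofReal_mul, Complex.I_re, mul_zero]
  rw [this]
  field_simp
  push_cast; ring

theorem small_y {τ : ℝ} {w : ℂ} (hτ : 1 ≤ τ) (hw : ‖w‖ ≤ τ/2) : ‖w/(τ:ℂ)^3‖ ≤ 1/2 ∧ τ^6 * ‖w/(τ:ℂ)^3‖^3 ≤ 1 := by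
  have h0 : 0 < τ := by linarith
  have e : ‖w/(τ:ℂ)^3‖ = ‖w‖/τ^3 := by
    rw [norm_div, norm_pow, Complex.norm_real, Real.norm_eq_abs, abs_of_pos h0]
  rw [e]
  have h1 : ‖w‖/τ^3 ≤ 1/(2*τ^2) := by
    rw [div_le_div_iff₀ (by positivity) (by positivity)]
    nlinarith [mul_le_mul_of_nonneg_right hw (by positivity : 0 ≤ 2*τ^2)]
  have h2 : 1 ≤ τ^2 := one_le_pow₀ hτ
  constructor
  · refine h1.trans ?_
    rw [div_le_div_iff₀ (by positivity) (by norm_num)]; linarith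
  · have h3 : (‖w‖/τ^3)^3 ≤ (1/(2*τ^2))^3 := by gcongr
    calc _ ≤ τ^6 * (1/(2*τ^2))^3 := by gcongr
      _ = 1/8 := by field_simp; norm_num
      _ ≤ 1 := by norm_num

theorem wfun_small {s : ℂ} {τ M : ℝ} (hτ : 1 ≤ τ) (ht : s.im = τ^6) (hs : Real.sqrt s.im = τ^3) (hM : |s.re| ≤ M) {w : ℂ} (hw : ‖w‖ ≤ τ/2) :
    ‖wfun s w‖ ≤ Real.exp (M+2) ∧ ‖(wfun s w)⁻¹‖ ≤ Real.exp (M+2) := by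
  obtain ⟨h1, h2⟩ := small_y hτ hw
  set y := w/(τ:ℂ)^3 with hy
  have hlog := Complex.norm_log_one_add_half_le_self (z := y) h1
  have htay := Complex.norm_log_sub_logTaylor_le 2 (z := y) (by linarith)
  have e1 : Complex.logTaylor (2+1) y = y - y^2/2 := by
    simp [Complex.logTaylor, Finset.sum_range_succ]; ring
  rw [e1] at htay
  rw [wfun_eq hτ ht hs w, ← hy]
  set Ex := ((s.re:ℂ)-1) * Complex.log (1 + y) + I * (τ:ℂ)^6 * (Complex.log (1 + y) - (y - y^2/2)) with hEx
  have hM0 : 0 ≤ M := (abs_nonneg _).trans hM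
  have hExb : ‖Ex‖ ≤ M + 2 := by
    have b1 : ‖(s.re:ℂ) - 1‖ ≤ M + 1 := by
      rw [← Complex.ofReal_one, ← Complex.ofReal_sub, Complex.norm_real, Real.norm_eq_abs]
      have := abs_sub s.re 1
      rw [abs_one] at this; linarith
    have b2 : ‖Complex.log (1+y)‖ ≤ 3/4 := by linarith
    have b3 : ‖Complex.log (1 + y) - (y - y^2/2)‖ ≤ ‖y‖^3 := by
      refine htay.trans ?_
      have : (1-‖y‖)⁻¹ ≤ 2 := by
        rw [inv_le_comm₀ (by linarith) (by norm_num)]; linarith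
      have h0 : 0 ≤ ‖y‖^3 := by positivity
      norm_num
      nlinarith [mul_le_mul_of_nonneg_left this h0]
    have b4 : ‖I * (τ:ℂ)^6‖ = τ^6 := by
      rw [norm_mul, Complex.norm_I, norm_pow, Complex.norm_real, Real.norm_eq_abs, abs_of_pos (by linarith), one_mul]
    calc ‖Ex‖ ≤ ‖((s.re:ℂ)-1)‖ * ‖Complex.log (1 + y)‖ + ‖I * (τ:ℂ)^6‖ * ‖Complex.log (1 + y) - (y - y^2/2)‖ := by
          rw [hEx, ← norm_mul, ← norm_mul]; exact norm_add_le _ _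
      _ ≤ (M+1) * (3/4) + τ^6 * ‖y‖^3 := by rw [b4]; gcongr
      _ ≤ M + 2 := by linarith
  constructor
  · exact (Complex.norm_exp_le_exp_norm _).trans (Real.exp_le_exp.2 hExb)
  · rw [← Complex.exp_neg]
    exact (Complex.norm_exp_le_exp_norm _).trans (Real.exp_le_exp.2 (by rw [norm_neg]; exact hExb))

theorem wfun_deriv {s : ℂ} {τ : ℝ} (hτ : 1 ≤ τ) (ht : s.im = τ^6) (hs : Real.sqrt s.im = τ^3) {w : ℂ} (hw : ‖w‖ ≤ τ/2) :
    HasDerivAt (wfun s) (((s.re:ℂ) - 1 + I * w^2) / ((τ:ℂ)^3 + w) * wfun s w) w ∧ (τ:ℂ)^3 + w ≠ 0 ∧ τ^3/2 ≤ ‖(τ:ℂ)^3 + w‖ := by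
  obtain ⟨h1, h2⟩ := small_y hτ hw
  have hn : ‖(τ:ℂ)^3‖ = τ^3 := by rw [norm_pow, Complex.norm_real, Real.norm_eq_abs, abs_of_pos (by linarith)]
  have hp : 0 < τ := by linarith
  have h0 : (τ:ℂ) ≠ 0 := by exact_mod_cast (by linarith : τ ≠ 0)
  have hlow : τ^3/2 ≤ ‖(τ:ℂ)^3 + w‖ := by
    have := norm_sub_norm_le ((τ:ℂ)^3) (-w)
    rw [sub_neg_eq_add, norm_neg, hn] at this
    have h4 : τ ≤ τ^3 := by nlinarith [one_le_pow₀ hτ (n := 2)]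
    linarith
  have hne : (τ:ℂ)^3 + w ≠ 0 := by
    rw [← norm_pos_iff]; have : 0 < τ^3/2 := by positivity
    linarith
  refine ⟨?_, hne, hlow⟩
  have hslit : 1 + w/(Real.sqrt s.im : ℂ) ∈ Complex.slitPlane := by
    left
    rw [hs]; push_cast
    have := (abs_le.1 (Complex.abs_re_le_norm (w/(τ:ℂ)^3))).1
    simp only [Complex.add_re, Complex.one_re]; linarith
  have hd : HasDerivAt (fun z : ℂ => (s - 1) * Complex.log (1 + z / (Real.sqrt s.im : ℂ)) - I * (Real.sqrt s.im : ℂ) * z + I * z^2 / 2)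
      ((s-1) * ((1/(Real.sqrt s.im : ℂ)) / (1 + w/(Real.sqrt s.im : ℂ))) - I * (Real.sqrt s.im : ℂ) + I * (2*w)/2) w := by
    have d1 : HasDerivAt (fun z : ℂ => 1 + z / (Real.sqrt s.im : ℂ)) (1/(Real.sqrt s.im : ℂ)) w :=
      ((hasDerivAt_id w).div_const _).const_add 1
    have d2 := (d1.clog hslit).const_mul (s-1)
    have d3 := (hasDerivAt_id w).const_mul (I * (Real.sqrt s.im : ℂ))
    have d4 := ((hasDerivAt_pow 2 w).const_mul I).div_const 2
    have := (d2.sub d3).add d4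
    refine this.congr_deriv ?_
    push_cast; ring
  have := hd.cexp
  unfold wfun
  refine this.congr_deriv ?_
  rw [mul_comm]
  congr 1
  rw [hs]; push_cast
  have e : s = (s.re:ℂ) + (τ:ℂ)^6 * I := by
    conv_lhs => rw [← Complex.re_add_im s, ht]
    push_cast; ring
  have hq : 1 + w/(τ:ℂ)^3 ≠ 0 := by
    intro h; apply hne
    have : (τ:ℂ)^3 + w = (τ:ℂ)^3 * (1 + w/(τ:ℂ)^3) := by field_simp
    rw [this, h, mul_zero]
  rw [show s - 1 = (s.re:ℂ) - 1 + (τ:ℂ)^6 * I by linear_combination e]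
  have e8 : (1/(τ:ℂ)^3) / (1 + w/(τ:ℂ)^3) = 1/((τ:ℂ)^3+w) := by field_simp
  rw [e8]
  field_simp
  ring


theorem akm_bound {s : ℂ} {τ M : ℝ} (hτ : 1 ≤ τ) (hs : Real.sqrt s.im = τ^3) (hM : |s.re| ≤ M) {ak : ℕ → ℂ} (h : IsAk s ak) (j k : ℕ) :
    ‖akm ak j k‖ ≤ τ^j * (M+2)^k / τ^k := by
  have hM0 : 0 ≤ M := (abs_nonneg _).trans hM
  have hp : 0 < τ := by linarith
  unfold akm
  split_ifs with hc
  · obtain ⟨i, rfl⟩ := Nat.exists_eq_add_of_le' hc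
    rw [le_div_iff₀ (by positivity), Nat.add_sub_cancel]
    have h1 := ak_bound hτ hs hM h i
    have h4 : (M+2)^i ≤ (M+2)^(i+j) := pow_le_pow_right₀ (by linarith) (by omega)
    calc _ = τ^j * (‖ak i‖ * τ^i) := by ring
      _ ≤ τ^j * (M+2)^(i+j) := by gcongr; linarith
  · simp; positivity

def CR (M : ℝ) (N : ℕ) : ℝ := 2 * (N+2) * (M+2)^N * Real.exp (2*(M+2))

theorem wfun_zero (s : ℂ) : wfun s 0 = 1 := by simp [wfun]

theorem R_bound {s : ℂ} {τ M : ℝ} (hτ : 1 ≤ τ) (ht : s.im = τ^6) (hs : Real.sqrt s.im = τ^3) (hM : |s.re| ≤ M)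
    {ak : ℕ → ℂ} (h : IsAk s ak) (N : ℕ) {w : ℂ} (hw : ‖w‖ ≤ τ/2) :
    ‖wfun s w - Tpoly ak N w‖ ≤ CR M N * (‖w‖/τ)^N := by
  have hM0 : 0 ≤ M := (abs_nonneg _).trans hM
  have hp : 0 < τ := by linarith
  have hW := wfun_small hτ ht hs hM hw
  have hE : 1 ≤ Real.exp (M+2) := Real.one_le_exp (by linarith)
  have hEE : Real.exp (2*(M+2)) = Real.exp (M+2) * Real.exp (M+2) := by rw [← Real.exp_add]; ring_nf
  rcases Nat.eq_zero_or_pos N with rfl | hN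
  · simp [Tpoly, CR]
    rw [hEE]
    nlinarith [hW.1]
  have hWne : ∀ z : ℂ, wfun s z ≠ 0 := fun z => Complex.exp_ne_zero _
  set r := ‖w‖ with hr
  have hr0 : 0 ≤ r := norm_nonneg w
  set K : ℝ := 2 * (N+2) * (M+2)^N * Real.exp (M+2) / τ^N * r^(N-1) with hK
  have hder : ∀ z ∈ Metric.closedBall (0:ℂ) r, HasDerivWithinAt (fun z => Tpoly ak N z / wfun s z)
      (-(Qres τ ak N z) / (((τ:ℂ)^3 + z) * wfun s z)) (Metric.closedBall (0:ℂ) r) z := by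
    intro z hz
    have hz' : ‖z‖ ≤ τ/2 := (mem_closedBall_zero_iff.1 hz).trans hw
    obtain ⟨d, hne, -⟩ := wfun_deriv hτ ht hs hz'
    refine (((Tpoly_deriv ak N z).div d (hWne z)).congr_deriv ?_).hasDerivWithinAt
    rw [← Tpoly_ode hs h N z]
    have := hWne z
    field_simp
    ring
  have hbd : ∀ z ∈ Metric.closedBall (0:ℂ) r, ‖-(Qres τ ak N z) / (((τ:ℂ)^3 + z) * wfun s z)‖ ≤ K := by
    intro z hz
    have hzr : ‖z‖ ≤ r := mem_closedBall_zero_iff.1 hz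
    have hz' : ‖z‖ ≤ τ/2 := hzr.trans hw
    obtain ⟨-, hne, hlow⟩ := wfun_deriv hτ ht hs hz'
    have hWz := (wfun_small hτ ht hs hM hz').2
    have hz0 := norm_nonneg z
    have hQ : ‖Qres τ ak N z‖ ≤ (N+2) * (M+2)^N * τ^3 / τ^N * r^(N-1) := by
      unfold Qres
      have b0 := akm_bound hτ hs hM h 0 N
      have b2 := akm_bound hτ hs hM h 2 N
      have b1 := akm_bound hτ hs hM h 1 N
      have e0 : akm ak 0 N = ak N := by simp [akm]
      rw [e0] at b0
      have hτn : ‖(τ:ℂ)^3‖ = τ^3 := by rw [norm_pow, Complex.norm_real, Real.norm_eq_abs, abs_of_pos hp]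
      have ezN : ‖z‖^N = ‖z‖^(N-1) * ‖z‖ := by rw [← pow_succ]; congr 1; omega
      have ezN1 : ‖z‖^(N+1) = ‖z‖^(N-1) * ‖z‖ * ‖z‖ := by rw [← ezN, pow_succ]
      have hzz : ‖z‖^(N-1) ≤ r^(N-1) := by gcongr
      have hzτ : ‖z‖ ≤ τ := by linarith
      calc _ ≤ ‖(τ:ℂ)^3 * N * ak N * z^(N-1)‖ + ‖I * akm ak 2 N * z^N‖ + ‖I * akm ak 1 N * z^(N+1)‖ := norm_add₃_le
        _ = τ^3 * N * ‖ak N‖ * ‖z‖^(N-1) + ‖akm ak 2 N‖ * (‖z‖^(N-1) * ‖z‖) + ‖akm ak 1 N‖ * (‖z‖^(N-1) * ‖z‖ * ‖z‖) := by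
            simp only [norm_mul, hτn, Complex.norm_I, one_mul, Complex.norm_natCast]
            rw [norm_pow, norm_pow, norm_pow, ezN, ezN1]
        _ ≤ τ^3 * N * (τ^0 * (M+2)^N / τ^N) * r^(N-1) + (τ^2 * (M+2)^N / τ^N) * (r^(N-1) * τ) + (τ^1 * (M+2)^N / τ^N) * (r^(N-1) * τ * τ) := by
            gcongr
        _ = _ := by ring
    rw [norm_div, norm_neg, norm_mul, div_mul_eq_div_div, div_eq_mul_inv _ ‖wfun s z‖, ← norm_inv]
    calc _ ≤ ((N+2) * (M+2)^N * τ^3 / τ^N * r^(N-1)) / (τ^3/2) * Real.exp (M+2) := by gcongr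
      _ = K := by rw [hK]; field_simp
  have hmv := (convex_closedBall (0:ℂ) r).norm_image_sub_le_of_norm_hasDerivWithin_le hder hbd
    (Metric.mem_closedBall_self hr0) (mem_closedBall_zero_iff.2 le_rfl : w ∈ _)
  simp only [sub_zero, wfun_zero, div_one] at hmv
  have hT0 : Tpoly ak N 0 = 1 := by
    unfold Tpoly
    rw [Finset.sum_eq_single 0]
    · simp [h.1]
    · intro b _ hb; simp [hb]
    · intro h'; simp at h'; omega
  rw [hT0] at hmv
  have e : wfun s w - Tpoly ak N w = -(wfun s w * (Tpoly ak N w / wfun s w - 1)) := by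
    have := hWne w
    field_simp; ring
  rw [e, norm_neg, norm_mul]
  have eN : r^N = r^(N-1) * r := by rw [← pow_succ]; congr 1; omega
  calc _ ≤ Real.exp (M+2) * (K * r) := by
        refine mul_le_mul hW.1 hmv (norm_nonneg _) (by positivity)
    _ = _ := by rw [hK, CR, hEE, div_pow, eN]; ring

theorem T_bound {s : ℂ} {τ M : ℝ} (hτ : 1 ≤ τ) (hs : Real.sqrt s.im = τ^3) (hM : |s.re| ≤ M)
    {ak : ℕ → ℂ} (h : IsAk s ak) (N : ℕ) (w : ℂ) :
    ‖Tpoly ak N w‖ ≤ N * (M+2)^N * (1+‖w‖)^N := by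
  have hM0 : 0 ≤ M := (abs_nonneg _).trans hM
  unfold Tpoly
  refine (norm_sum_le _ _).trans ?_
  have : ∀ k ∈ Finset.range N, ‖ak k * w^k‖ ≤ (M+2)^N * (1+‖w‖)^N := by
    intro k hk
    have hk' := (Finset.mem_range.1 hk).le
    rw [norm_mul, norm_pow]
    have h1 := ak_bound hτ hs hM h k
    have h2 : 1 ≤ τ^k := one_le_pow₀ hτ
    have h3 : ‖ak k‖ ≤ (M+2)^k := by nlinarith [norm_nonneg (ak k)]
    have h4 : (M+2)^k ≤ (M+2)^N := pow_le_pow_right₀ (by linarith) hk'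
    have h5 : ‖w‖^k ≤ (1+‖w‖)^k := by gcongr; linarith
    have h6 : (1+‖w‖)^k ≤ (1+‖w‖)^N := pow_le_pow_right₀ (by linarith [norm_nonneg w]) hk'
    exact mul_le_mul (h3.trans h4) (h5.trans h6) (by positivity) (by positivity)
  refine (Finset.sum_le_sum this).trans ?_
  simp [mul_assoc]

theorem T_bound_large {s : ℂ} {τ M : ℝ} (hτ : 1 ≤ τ) (hs : Real.sqrt s.im = τ^3) (hM : |s.re| ≤ M)
    {ak : ℕ → ℂ} (h : IsAk s ak) (N : ℕ) {w : ℂ} (hw : τ/2 ≤ ‖w‖) :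
    ‖Tpoly ak N w‖ ≤ N * (M+2)^N * (2*‖w‖/τ)^N := by
  have hM0 : 0 ≤ M := (abs_nonneg _).trans hM
  have hp : 0 < τ := by linarith
  unfold Tpoly
  refine (norm_sum_le _ _).trans ?_
  have : ∀ k ∈ Finset.range N, ‖ak k * w^k‖ ≤ (M+2)^N * (2*‖w‖/τ)^N := by
    intro k hk
    have hk' := (Finset.mem_range.1 hk).le
    rw [norm_mul, norm_pow]
    have h1 := ak_bound hτ hs hM h k
    have hq : 1 ≤ 2*‖w‖/τ := by rw [le_div_iff₀ hp]; linarith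
    have h4 : (M+2)^k ≤ (M+2)^N := pow_le_pow_right₀ (by linarith) hk'
    have h6 : (2*‖w‖/τ)^k ≤ (2*‖w‖/τ)^N := pow_le_pow_right₀ hq hk'
    have h7 : (‖w‖/τ)^k ≤ (2*‖w‖/τ)^k := by gcongr; linarith [norm_nonneg w]
    calc _ = (‖ak k‖ * τ^k) * (‖w‖/τ)^k := by rw [div_pow]; field_simp
      _ ≤ (M+2)^N * (2*‖w‖/τ)^N := mul_le_mul (h1.trans h4) (h7.trans h6) (by positivity) (by positivity)
  refine (Finset.sum_le_sum this).trans ?_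
  simp [mul_assoc]


/-- point on the steepest line -/
def wl (w0 v : ℝ) : ℂ := (w0:ℂ) + (-1 + I) * (v:ℂ)

theorem wl_re (w0 v : ℝ) : (wl w0 v).re = w0 - v := by simp [wl]; ring
theorem wl_im (w0 v : ℝ) : (wl w0 v).im = v := by simp [wl]

theorem wl_norm (w0 v : ℝ) (h : |w0| ≤ 1/2) : ‖wl w0 v‖ ≤ 2*(1+|v|) := by
  refine (Complex.norm_le_abs_re_add_abs_im _).trans ?_
  rw [wl_re, wl_im]
  have := abs_sub w0 v
  linarith [abs_nonneg v]

theorem gauss_norm (w0 v : ℝ) : ‖cexp (-(I * (wl w0 v)^2/2))‖ = rexp (w0*v - v^2) := by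
  rw [Complex.norm_exp]
  congr 1
  have e : -(I * (wl w0 v)^2/2) = (((w0*v - v^2) : ℝ):ℂ) + ((-(w0^2)/2 + w0*v : ℝ):ℂ) * I := by
    unfold wl; push_cast
    linear_combination (-(w0:ℂ)*v + v^2 -(v:ℂ)^2*I/2)*Complex.I_sq
  rw [e, Complex.add_re, Complex.ofReal_re, Complex.re_ofReal_mul, Complex.I_re, mul_zero, add_zero]

theorem gauss_bound (w0 v : ℝ) (h : |w0| ≤ 1/2) : ‖cexp (-(I * (wl w0 v)^2/2))‖ ≤ rexp (6 - |v|) := by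
  rw [gauss_norm]
  apply Real.exp_le_exp.2
  have h1 : w0*v ≤ 1/2*|v| := by
    calc w0*v ≤ |w0*v| := le_abs_self _
      _ = |w0| * |v| := abs_mul _ _
      _ ≤ _ := by gcongr
  rw [← sq_abs v]
  nlinarith [sq_nonneg (|v| - 3/4)]

theorem rpow_two_sided {r R κ P : ℝ} (hR : 1 ≤ R) (h1 : 1/R ≤ r) (h2 : r ≤ R) (hκ : |κ| ≤ P) : r^κ ≤ R^P := by
  have hr : 0 < r := lt_of_lt_of_le (by positivity) h1
  rcases le_total 0 κ with hk | hk
  · calc r^κ ≤ R^κ := Real.rpow_le_rpow hr.le h2 hk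
      _ ≤ R^P := Real.rpow_le_rpow_of_exponent_le hR ((le_abs_self _).trans hκ)
  · have : r⁻¹ ≤ R := by rw [inv_le_comm₀ hr (by linarith)]; simpa using h1
    calc r^κ = (r⁻¹)^(-κ) := by rw [Real.rpow_neg (by positivity), Real.inv_rpow hr.le, inv_inv]
      _ ≤ R^(-κ) := Real.rpow_le_rpow (by positivity) this (by linarith)
      _ ≤ R^P := Real.rpow_le_rpow_of_exponent_le hR ((neg_le_abs _).trans hκ)

theorem arg_ge_sin {z : ℂ} (h : 0 ≤ z.im) : z.im / ‖z‖ ≤ z.arg := by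
  rw [← Complex.sin_arg]
  exact Real.sin_le (Complex.arg_nonneg_iff.2 h)

theorem arg_ge_tan {z : ℂ} (h : 0 < z.re) (hi : z.im ≤ 0) : z.im / z.re ≤ z.arg := by
  have h1 : |z.arg| < π/2 := Complex.abs_arg_lt_pi_div_two_iff.2 (Or.inl h)
  have h2 := abs_lt.1 h1
  have h3 : z.arg ≤ 0 := by
    rcases hi.lt_or_eq with hi | hi
    · exact (Complex.arg_neg_iff.2 hi).le
    · rw [Complex.arg_eq_zero_iff.2 ⟨h.le, hi⟩]
  rw [← Complex.tan_arg]
  have := Real.le_tan (x := -z.arg) (by linarith) (by linarith)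
  rw [Real.tan_neg] at this; linarith

/-- key exponent inequality, y-plane -/
theorem expo_upper {T d q : ℝ} (hT : 0 ≤ T) (hd : |d| ≤ 1/5) (hq : 0 ≤ q) (hq2 : q ≤ 1/2) {z : ℂ} (hre : z.re = 1 + d - q) (him : z.im = q) :
    -(T * z.arg) + T * q ≤ T * (-(q^2)/2 + 1.1 * q * |d|) := by
  have hz : z ≠ 0 := by
    intro h; rw [h] at hre him; simp at hre him
    have := (abs_le.1 hd).1; linarith
  have hn : ‖z‖^2 = (1+d-q)^2 + q^2 := by rw [Complex.sq_norm, Complex.normSq_apply, hre, him]; ring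
  have hnp : 0 < ‖z‖ := norm_pos_iff.2 hz
  have h1 := arg_ge_sin (by rw [him]; exact hq)
  rw [him] at h1
  set X : ℝ := 1 - ‖z‖^2 with hX
  have h2 : 1 + X/2 ≤ 1/‖z‖ := by
    rw [le_div_iff₀ hnp]
    -- (1 + (1-n²)/2) n ≤ 1
    have : 0 ≤ (‖z‖-1)^2 * (‖z‖+2) := by positivity
    rw [hX]; nlinarith
  have h3 : q * (1 + X/2) ≤ z.arg := by
    refine le_trans ?_ h1
    rw [div_eq_mul_one_div q]; exact mul_le_mul_of_nonneg_left h2 hq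
  have h4 : q/2 - 1.1*|d| ≤ X/2 := by
    rw [hX, hn]
    have ha := le_abs_self d
    have hb := neg_abs_le d
    have hc := abs_nonneg d
    have hd2 : d^2 ≤ 1/5*|d| := by rw [← sq_abs d]; nlinarith
    nlinarith [mul_nonneg hq (by linarith : 0 ≤ 1/2 - q), mul_nonneg (by linarith : 0 ≤ 1 - q) (by linarith : 0 ≤ |d| - d)]
  have h5 : -z.arg + q ≤ -(q^2)/2 + 1.1*q*|d| := by nlinarith
  nlinarith

theorem expo_lower {T d p : ℝ} (hT : 0 ≤ T) (hd : |d| ≤ 1/5) (hp : 0 ≤ p) {z : ℂ} (hre : z.re = 1 + d + p) (him : z.im = -p) :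
    -(T * z.arg) - T * p ≤ T * (-(p^2)/((6/5) + p) + (5/4) * p * |d|) := by
  have hdd := abs_le.1 hd
  have hz : 0 < z.re := by rw [hre]; linarith
  have h1 := arg_ge_tan hz (by rw [him]; linarith)
  rw [hre, him] at h1
  have hpos : 0 < 1 + d + p := by linarith
  have h2 : p/(1+d+p) - p = -(p^2)/(1+d+p) - p*d/(1+d+p) := by field_simp; ring
  have h3 : -(p^2)/(1+d+p) ≤ -(p^2)/((6/5)+p) := by
    rw [neg_div, neg_div]
    apply neg_le_neg
    apply div_le_div_of_nonneg_left (by positivity) hpos (by linarith)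
  have h4 : -(p*d/(1+d+p)) ≤ (5/4)*p*|d| := by
    rw [← neg_div, div_le_iff₀ hpos]
    have hb := neg_abs_le d
    have := mul_nonneg hp (abs_nonneg d)
    nlinarith [mul_nonneg hp (by linarith : 0 ≤ |d| + d), mul_nonneg this (by linarith : 0 ≤ d+p+1/5)]
  have h5 : -z.arg - p ≤ -(p^2)/((6/5) + p) + (5/4) * p * |d| := by
    rw [neg_div] at h1; linarith
  nlinarith

set_option maxHeartbeats 800000 in
theorem line_W {s : ℂ} {M : ℝ} (ht : 2*π ≤ s.im) (hM : |s.re| ≤ M) {w0 v : ℝ} (h0 : |w0| ≤ 1/2) (hv : v ≤ √s.im/2) :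
    ‖wfun s (wl w0 v) * cexp (-(I * (wl w0 v)^2/2))‖ ≤ (2*(1+|v|))^(M+1) * rexp (6 - |v|) := by
  have ht' : 6.25 ≤ s.im := by linarith [Real.pi_gt_d2]
  set R := √s.im with hR
  have hR2 : R^2 = s.im := Real.sq_sqrt (by linarith)
  have hR25 : 2.5 ≤ R := Real.le_sqrt_of_sq_le (by norm_num; linarith)
  have hRp : 0 < R := by linarith
  have hRc : (R:ℂ) ≠ 0 := by exact_mod_cast hRp.ne'
  set z : ℂ := 1 + wl w0 v / (R:ℂ) with hz
  have hre : z.re = 1 + w0/R - v/R := by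
    rw [hz, Complex.add_re, Complex.div_ofReal_re, wl_re, Complex.one_re]; ring
  have him : z.im = v/R := by
    rw [hz, Complex.add_im, Complex.div_ofReal_im, wl_im, Complex.one_im]; ring
  set d := w0/R with hd
  set q := v/R with hq
  have hdb : |d| = |w0|/R := by rw [hd, abs_div, abs_of_pos hRp]
  have hd5 : |d| ≤ 1/5 := by rw [hdb, div_le_iff₀ hRp]; linarith
  have hdd := abs_le.1 hd5
  have hq2 : q ≤ 1/2 := by rw [hq, div_le_iff₀ hRp]; linarith
  have hn : ‖z‖^2 = (1+d-q)^2 + q^2 := by rw [Complex.sq_norm, Complex.normSq_apply, hre, him]; ring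
  have hnl : 1/2 ≤ ‖z‖ := by
    apply le_of_sq_le_sq _ (norm_nonneg _)
    rw [hn]; nlinarith [sq_nonneg (1+d-2*q)]
  have hz0 : z ≠ 0 := by rw [← norm_pos_iff]; linarith
  have hnu : ‖z‖ ≤ 2*(1+|v|) := by
    calc ‖z‖ ≤ ‖(1:ℂ)‖ + ‖wl w0 v/(R:ℂ)‖ := norm_add_le _ _
      _ = 1 + ‖wl w0 v‖/R := by rw [norm_div, norm_one, Complex.norm_real, Real.norm_eq_abs, abs_of_pos hRp]
      _ ≤ 1 + 2*(1+|v|)/2.5 := by gcongr; exact wl_norm w0 v h0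
      _ ≤ _ := by norm_num; linarith [abs_nonneg v]
  have hmain : ‖wfun s (wl w0 v) * cexp (-(I * (wl w0 v)^2/2))‖ = ‖z‖^(s.re-1) * rexp (-(s.im*z.arg) + s.im*q) := by
    unfold wfun
    rw [← Complex.exp_add, Complex.norm_exp, Real.rpow_def_of_pos (by linarith), ← Real.exp_add]
    congr 1
    have : (s - 1) * Complex.log (1 + wl w0 v / (√s.im:ℂ)) - I * (√s.im:ℂ) * wl w0 v + I * (wl w0 v)^2/2 + -(I * (wl w0 v)^2/2)
      = (s-1) * Complex.log z - I * ((R:ℂ) * wl w0 v) := by rw [← hR, hz]; ring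
    rw [this, Complex.sub_re, Complex.mul_re, Complex.log_re, Complex.log_im, Complex.I_mul_re]
    simp only [Complex.sub_re, Complex.sub_im, Complex.one_re, Complex.one_im, sub_zero, Complex.im_ofReal_mul, wl_im]
    rw [hq, ← hR2]; field_simp; ring
  rw [hmain]
  have hb1 : ‖z‖^(s.re-1) ≤ (2*(1+|v|))^(M+1) := by
    apply rpow_two_sided (by linarith [abs_nonneg v]) _ hnu
    · have := abs_sub s.re 1
      rw [abs_one] at this; linarith
    · refine le_trans ?_ hnl
      rw [div_le_div_iff₀ (by positivity) (by norm_num)]; linarith [abs_nonneg v]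
  have hb2 : -(s.im*z.arg) + s.im*q ≤ 6 - |v| := by
    have hRq : R*q = v := by rw [hq]; field_simp
    have hRd : R*|d| = |w0| := by rw [hdb]; field_simp
    rcases le_total 0 v with hv0 | hv0
    · have hq0 : 0 ≤ q := by positivity
      refine (expo_upper (by linarith) hd5 hq0 hq2 hre him).trans ?_
      have : s.im * (-(q^2)/2 + 1.1 * q * |d|) = -v^2/2 + 1.1 * v * |w0| := by
        rw [← hR2, ← hRq, ← hRd]; ring
      rw [this, abs_of_nonneg hv0]
      nlinarith [sq_nonneg (v-2)]
    · have hp0 : 0 ≤ -q := by rw [hq, ← neg_div]; apply div_nonneg (by linarith) hRp.le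
      have := expo_lower (T := s.im) (by linarith) hd5 hp0 (z := z) (by rw [hre]; ring) (by rw [him]; ring)
      have e2 : s.im * (-((-q)^2)/((6/5) + -q) + (5/4) * -q * |d|) = -(v^2)/((6/5) + -q) + (5/4) * (-v) * |w0| := by
        rw [← hR2, ← hRq, ← hRd]; ring
      rw [e2] at this
      rw [abs_of_nonpos hv0]
      have h3 : -(v^2)/((6/5) + -q) ≤ -(v^2)/((6/5) + (-v)*(2/5)) := by
        rw [neg_div, neg_div]
        apply neg_le_neg
        apply div_le_div_of_nonneg_left (by positivity) (by norm_num; linarith)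
        have : -q ≤ (-v)*(2/5) := by
          rw [hq, ← neg_div, div_le_iff₀ hRp]; nlinarith
        linarith
      have h4 : -(v^2)/((6/5) + (-v)*(2/5)) ≤ 6 - 13/8*(-v) := by
        rw [div_le_iff₀ (by linarith)]
        nlinarith [sq_nonneg v]
      have h5 : (5/4) * (-v) * |w0| ≤ 5/8 * (-v) := by
        have := mul_le_mul_of_nonneg_left h0 (by linarith : 0 ≤ -v)
        linarith
      linarith
  exact mul_le_mul hb1 (Real.exp_le_exp.2 hb2) (Real.exp_pos _).le (by positivity)


theorem poly_exp (M : ℝ) (N : ℕ) : ∃ C : ℝ, 0 ≤ C ∧ ∀ v : ℝ, (2*(1+|v|))^(M+1) * (2*(1+|v|))^N * rexp (6 - |v|) ≤ C * rexp (-(|v|/2)) := by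
  set P := ⌈M+1⌉₊ + N with hP
  refine ⟨4^P * P.factorial * rexp (13/2), by positivity, fun v => ?_⟩
  set u := 2*(1+|v|) with hu
  have hu1 : 1 ≤ u := by rw [hu]; linarith [abs_nonneg v]
  have h1 : u^(M+1) ≤ u^(⌈M+1⌉₊) := by
    rw [← Real.rpow_natCast]
    exact Real.rpow_le_rpow_of_exponent_le hu1 (Nat.le_ceil _)
  have h2 := Real.pow_div_factorial_le_exp (u/4) (by linarith) P
  rw [div_le_iff₀ (by positivity), div_pow, div_le_iff₀ (by positivity)] at h2
  calc u^(M+1) * u^N * rexp (6-|v|) ≤ u^(⌈M+1⌉₊) * u^N * rexp (6-|v|) := by gcongr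
    _ = u^P * rexp (6-|v|) := by rw [hP, pow_add]
    _ ≤ (rexp (u/4) * P.factorial * 4^P) * rexp (6-|v|) := by gcongr
    _ = 4^P * P.factorial * (rexp (u/4) * rexp (6-|v|)) := by ring
    _ = 4^P * P.factorial * (rexp (13/2) * rexp (-(|v|/2))) := by
        rw [← Real.exp_add, ← Real.exp_add]; congr 2; rw [hu]; ring
    _ = _ := by ring

theorem FT_bound (M : ℝ) (N : ℕ) : ∃ C : ℝ, 0 ≤ C ∧ ∀ (s : ℂ) (τ : ℝ) (ak : ℕ → ℂ) (w0 v : ℝ), 1 ≤ τ → s.im = τ^6 → √s.im = τ^3 →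
    2*π ≤ s.im → |s.re| ≤ M → IsAk s ak → |w0| ≤ 1/2 →
    ‖((if v ≤ √s.im/2 then wfun s (wl w0 v) else 0) - Tpoly ak N (wl w0 v)) * cexp (-(I * (wl w0 v)^2/2))‖ ≤ C/τ^N * rexp (-(|v|/2)) := by
  obtain ⟨C0, hC0, hpe⟩ := poly_exp M N
  by_cases hM0 : 0 ≤ M
  swap
  · refine ⟨0, le_rfl, ?_⟩
    intro s τ ak w0 v _ _ _ _ hM
    exact absurd ((abs_nonneg _).trans hM) hM0
  have hCR : 0 ≤ CR M N := by unfold CR; positivity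
  refine ⟨(CR M N + 2^N + N*(M+2)^N*2^N) * C0, by positivity, ?_⟩
  intro s τ ak w0 v hτ ht hs h2p hM hak hw0
  set w := wl w0 v with hw
  set u := 2*(1+|v|) with hu
  have hp : 0 < τ := by linarith
  have hu1 : 1 ≤ u := by rw [hu]; linarith [abs_nonneg v]
  have hwu : ‖w‖ ≤ u := wl_norm w0 v hw0
  have hg := gauss_bound w0 v hw0
  rw [← hw] at hg
  have huM : 1 ≤ u^(M+1) := Real.one_le_rpow hu1 (by linarith)
  suffices hX : ‖((if v ≤ √s.im/2 then wfun s w else 0) - Tpoly ak N w) * cexp (-(I * w^2/2))‖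
      ≤ (CR M N + 2^N + N*(M+2)^N*2^N)/τ^N * (u^(M+1) * u^N * rexp (6-|v|)) by
    refine hX.trans ?_
    calc _ ≤ (CR M N + 2^N + N*(M+2)^N*2^N)/τ^N * (C0 * rexp (-(|v|/2))) := mul_le_mul_of_nonneg_left (hpe v) (by positivity)
      _ = _ := by ring
  have hE := (Real.exp_pos (6-|v|)).le
  rcases le_total ‖w‖ (τ/2) with hc | hc
  · have hv : v ≤ √s.im/2 := by
      have h1 : v ≤ ‖w‖ := by
        have := Complex.im_le_norm w
        rwa [hw, wl_im] at this
      have : τ ≤ τ^3 := by nlinarith [one_le_pow₀ hτ (n := 2)]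
      rw [hs]; linarith
    rw [if_pos hv, norm_mul]
    calc _ ≤ (CR M N * (‖w‖/τ)^N) * rexp (6-|v|) := by
          exact mul_le_mul (R_bound hτ ht hs hM hak N hc) hg (norm_nonneg _) (by positivity)
      _ ≤ (CR M N * (u/τ)^N) * rexp (6-|v|) := by gcongr
      _ = CR M N/τ^N * (1 * u^N * rexp (6-|v|)) := by rw [div_pow]; ring
      _ ≤ _ := by
        gcongr
        have : (0:ℝ) ≤ N*(M+2)^N*2^N := by positivity
        have : (0:ℝ) ≤ 2^N := by positivity
        linarith
  · have hq : 1 ≤ 2*‖w‖/τ := by rw [le_div_iff₀ hp]; linarith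
    have hqu : (2*‖w‖/τ)^N ≤ 2^N/τ^N * u^N := by
      calc (2*‖w‖/τ)^N ≤ (2*u/τ)^N := by gcongr
        _ = _ := by rw [div_pow, mul_pow]; ring
    have hT : ‖Tpoly ak N w * cexp (-(I * w^2/2))‖ ≤ N*(M+2)^N*2^N/τ^N * (u^(M+1) * u^N * rexp (6-|v|)) := by
      rw [norm_mul]
      calc _ ≤ (N * (M+2)^N * (2*‖w‖/τ)^N) * rexp (6-|v|) := 
            mul_le_mul (T_bound_large hτ hs hM hak N hc) hg (norm_nonneg _) (by positivity)
        _ ≤ (N * (M+2)^N * (2^N/τ^N * u^N)) * rexp (6-|v|) := by gcongr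
        _ = N*(M+2)^N*2^N/τ^N * (1 * u^N * rexp (6-|v|)) := by ring
        _ ≤ _ := by gcongr
    have hF : ‖(if v ≤ √s.im/2 then wfun s w else 0) * cexp (-(I * w^2/2))‖ ≤ 2^N/τ^N * (u^(M+1) * u^N * rexp (6-|v|)) := by
      split_ifs with hv
      · calc _ ≤ u^(M+1) * rexp (6-|v|) * 1 := by rw [mul_one]; exact line_W h2p hM hw0 hv
          _ ≤ u^(M+1) * rexp (6-|v|) * (2*‖w‖/τ)^N := by gcongr; exact one_le_pow₀ hq
          _ ≤ u^(M+1) * rexp (6-|v|) * (2^N/τ^N * u^N) := by gcongr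
          _ = _ := by ring
      · simp; positivity
    rw [sub_mul]
    refine (norm_sub_le _ _).trans ((add_le_add hF hT).trans ?_)
    rw [← add_mul, ← add_div]
    gcongr
    linarith

def Kf (a : ℝ) (x : ℂ) : ℂ := cexp (2*π*I*a*x) / (cexp (2*π*I*x) - 1)

theorem sin_re_le (z : ℂ) : |Real.sin z.re| ≤ ‖Complex.sin z‖ := by
  refine le_trans ?_ (Complex.abs_re_le_norm _)
  have : (Complex.sin z).re = Real.sin z.re * Real.cosh z.im := by
    rw [Complex.sin_eq z]
    rw [← Complex.ofReal_sin, ← Complex.ofReal_cos, ← Complex.ofReal_cosh, ← Complex.ofReal_sinh]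
    simp [-Complex.ofReal_sin, -Complex.ofReal_cos, -Complex.ofReal_cosh, -Complex.ofReal_sinh]
  rw [this, abs_mul, abs_of_pos (Real.cosh_pos _)]
  nlinarith [Real.one_le_cosh z.im, abs_nonneg (Real.sin z.re)]

theorem sin_pi_low {θ δ : ℝ} (h0 : 0 ≤ δ) (h1 : δ ≤ θ) (h2 : θ ≤ 1 - δ) : 2*δ ≤ Real.sin (π*θ) := by
  have hpi := Real.pi_pos
  rcases le_total θ (1/2) with h | h
  · have := Real.mul_le_sin (x := π*θ) (by nlinarith) (by nlinarith)
    have e : 2/π*(π*θ) = 2*θ := by field_simp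
    linarith
  · have := Real.mul_le_sin (x := π*(1-θ)) (by nlinarith) (by nlinarith)
    have e : 2/π*(π*(1-θ)) = 2*(1-θ) := by field_simp
    rw [e, show π*(1-θ) = π - π*θ by ring, Real.sin_pi_sub] at this
    linarith

theorem K_bound {a ε x0 : ℝ} {n : ℤ} {x : ℂ} (ha0 : 0 ≤ a) (ha1 : a ≤ 1) (hε : 0 < ε) (hε2 : ε ≤ 1/2) (h1 : n + ε ≤ x0) (h2 : x0 ≤ n + 1 - ε)
    (hx : x.re = x0 - x.im) : ‖Kf a x‖ ≤ 2/ε := by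
  have hpi := Real.pi_gt_three
  have hpi4 := Real.pi_lt_four
  set q := x.im with hq
  have hE : ‖cexp (2*π*I*x)‖ = rexp (-(2*π*q)) := by
    rw [Complex.norm_exp]; congr 1
    have : 2*π*I*x = ((2*π:ℝ):ℂ) * (I*x) := by push_cast; ring
    rw [this, Complex.re_ofReal_mul, Complex.I_mul_re]; ring
  have hA : ‖cexp (2*π*I*a*x)‖ = rexp (-(2*π*a*q)) := by
    rw [Complex.norm_exp]; congr 1
    have : 2*π*I*a*x = ((2*π*a:ℝ):ℂ) * (I*x) := by push_cast; ring
    rw [this, Complex.re_ofReal_mul, Complex.I_mul_re]; ring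
  unfold Kf
  rw [norm_div, hA]
  have hge : ∀ y : ℝ, π*ε ≤ y → ε ≤ 1 - rexp (-y) := by
    intro y hy
    have h3 : rexp (-y) ≤ rexp (-(π*ε)) := Real.exp_le_exp.2 (by linarith)
    have h4 : rexp (-(π*ε)) ≤ 1 - ε := by
      rw [Real.exp_neg, inv_le_comm₀ (Real.exp_pos _) (by linarith)]
      refine le_trans ?_ (Real.add_one_le_exp _)
      rw [inv_le_comm₀ (by linarith) (by positivity), inv_le_iff_one_le_mul₀ (by positivity)]
      have : 0 ≤ π - 1 - π*ε := by nlinarith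
      nlinarith [mul_nonneg hε.le this]
    linarith
  rcases le_total (ε/2) |q| with hc | hc
  · rcases le_total 0 q with hq0 | hq0
    · rw [abs_of_nonneg hq0] at hc
      have h3 := hge (2*π*q) (by nlinarith)
      have h4 : ε ≤ ‖cexp (2*π*I*x) - 1‖ := by
        have := norm_sub_norm_le 1 (cexp (2*π*I*x))
        rw [norm_one, hE, norm_sub_rev] at this; linarith
      calc _ ≤ 1/ε := by
            gcongr
            rw [Real.exp_le_one_iff]
            have := mul_nonneg (mul_nonneg Real.pi_pos.le ha0) hq0
            nlinarith
        _ ≤ 2/ε := by gcongr; norm_num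
    · rw [abs_of_nonpos hq0] at hc
      have h3 := hge (2*π*(-q)) (by nlinarith)
      have h4 : ε * rexp (-(2*π*q)) ≤ ‖cexp (2*π*I*x) - 1‖ := by
        have := norm_sub_norm_le (cexp (2*π*I*x)) 1
        rw [norm_one, hE] at this
        have e : rexp (-(2*π*(-q))) * rexp (-(2*π*q)) = 1 := by rw [← Real.exp_add]; simp
        have := mul_le_mul_of_nonneg_right h3 (Real.exp_pos (-(2*π*q))).le
        linarith
      calc _ ≤ rexp (-(2*π*q)) / (ε * rexp (-(2*π*q))) := by
            refine div_le_div₀ (Real.exp_pos _).le (Real.exp_le_exp.2 ?_) (by positivity) h4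
            have : 0 ≤ π * (1-a) * (-q) := by
              apply mul_nonneg (mul_nonneg (by linarith) (by linarith)) (by linarith)
            nlinarith
        _ = 1/ε := by field_simp
        _ ≤ 2/ε := by gcongr; norm_num
  · have hqq := abs_le.1 hc
    have hs : ε ≤ ‖Complex.sin (π*x)‖ := by
      refine le_trans ?_ (sin_re_le _)
      have e : ((π:ℂ)*x).re = π*x.re := Complex.re_ofReal_mul _ _
      rw [e]
      have h5 := sin_pi_low (θ := x.re - n) (δ := ε/2) (by linarith) (by rw [hx]; linarith) (by rw [hx]; linarith)
      have h6 : |Real.sin (π*x.re)| = |Real.sin (π*(x.re - n))| := by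
        rw [mul_sub, mul_comm π (n:ℝ), Real.sin_sub_int_mul_pi, abs_mul, abs_zpow]; simp
      rw [h6]
      exact le_trans (by linarith) (le_abs_self _)
    have e : cexp (2*π*I*x) - 1 = cexp (π*I*x) * (2*I*Complex.sin (π*x)) := by
      rw [Complex.sin]
      have e1 : cexp (2*π*I*x) = cexp (π*I*x) * cexp (π*I*x) := by rw [← Complex.exp_add]; ring_nf
      have e2 : cexp (-(π*x)*I) = (cexp (π*I*x))⁻¹ := by rw [← Complex.exp_neg]; ring_nf
      have e3 : cexp (π*x*I) = cexp (π*I*x) := by ring_nf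
      rw [e1, e2, e3]
      field_simp
      linear_combination (cexp (π*I*x)^2 - 1) * Complex.I_sq
    have hh : ‖cexp (π*I*x)‖ = rexp (-(π*q)) := by
      rw [Complex.norm_exp]; congr 1
      have : π*I*x = ((π:ℝ):ℂ) * (I*x) := by ring
      rw [this, Complex.re_ofReal_mul, Complex.I_mul_re]; ring
    have h2I : ‖(2:ℂ)*I‖ = 2 := by simp
    rw [e, norm_mul, hh, norm_mul, h2I]
    have h7 : rexp (-(2*π*a*q)) ≤ 4 * rexp (-(π*q)) := by
      have h8 : (4:ℝ) ≥ rexp 1 := by linarith [Real.exp_one_lt_d9]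
      calc rexp (-(2*π*a*q)) ≤ rexp (1 + -(π*q)) := by
            apply Real.exp_le_exp.2
            have h9 : |(1-2*a)*q| ≤ 1/4 := by
              rw [abs_mul]
              have : |1-2*a| ≤ 1 := by rw [abs_le]; constructor <;> linarith
              nlinarith [abs_nonneg q, abs_nonneg (1-2*a)]
            have := (abs_le.1 h9)
            nlinarith
        _ = rexp 1 * rexp (-(π*q)) := Real.exp_add _ _
        _ ≤ _ := by gcongr
    calc _ ≤ (4 * rexp (-(π*q))) / (rexp (-(π*q)) * (2*ε)) := by gcongr
      _ = 2/ε := by field_simp; norm_num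


theorem edec_int : Integrable (fun v : ℝ => rexp (-(|v|/2))) := by
  refine (integrable_inv_one_add_sq.const_mul 8).mono' (by fun_prop) (Filter.Eventually.of_forall fun v => ?_)
  rw [Real.norm_eq_abs, abs_of_pos (Real.exp_pos _), Real.exp_neg]
  have := Real.quadratic_le_exp_of_nonneg (x := |v|/2) (by positivity)
  rw [← div_eq_mul_inv, inv_eq_one_div, div_le_div_iff₀ (Real.exp_pos _) (by positivity)]
  have h2 : |v|^2 = v^2 := sq_abs v
  nlinarith [abs_nonneg v]

theorem g_factor {s : ℂ} {α β μ R a : ℝ} {m : ℕ} (hβ : 0 < β) (hμ : 0 < μ) (hR : R = √s.im) (hRp : 0 < R) (hβμ : β*μ = R) (hα : 2*π*α = R*μ)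
    (hm : (m:ℝ) = α - a) {w : ℂ} (hz : 1 + w/(R:ℂ) ≠ 0) :
    gfun s m (β + w/μ) = ((β:ℂ)^(s-1) * cexp (-(I*s.im))) * (wfun s w * cexp (-(I*w^2/2)) * Kf a (β + w/μ)) := by
  have hβc : (β:ℂ) ≠ 0 := by exact_mod_cast hβ.ne'
  have hμc : (μ:ℂ) ≠ 0 := by exact_mod_cast hμ.ne'
  have hRc : (R:ℂ) ≠ 0 := by exact_mod_cast hRp.ne'
  have him : 0 < s.im := by rw [hR] at hRp; exact Real.sqrt_pos.1 hRp
  have hR2 : R^2 = s.im := by rw [hR]; exact Real.sq_sqrt him.le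
  have c1 : (β:ℂ)*μ = R := by exact_mod_cast hβμ
  have c2 : 2*(π:ℂ)*α = R*μ := by exact_mod_cast hα
  have c3 : (m:ℂ) = α - a := by exact_mod_cast hm
  have c4 : (R:ℂ)^2 = s.im := by exact_mod_cast hR2
  have ex : (β:ℂ) + w/μ = (β:ℂ) * (1 + w/R) := by
    rw [← c1]; field_simp
  unfold gfun Kf wfun
  rw [← hR]
  have hx0 : (β:ℂ) + w/μ ≠ 0 := by rw [ex]; exact mul_ne_zero hβc hz
  rw [Complex.cpow_def_of_ne_zero hx0, Complex.cpow_def_of_ne_zero hβc, mul_div_assoc', ← Complex.exp_add, ← Complex.exp_add, ← Complex.exp_add, ← Complex.exp_add, mul_div_assoc', ← Complex.exp_add]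
  congr 2
  conv_lhs => rw [ex, Complex.log_ofReal_mul hβ hz]
  rw [← Complex.ofReal_log hβ.le, ex, c3, ← c4]
  have e1 : 2*(π:ℂ)*α*β = R^2 := by rw [c2]; rw [pow_two]; nth_rewrite 2 [← c1]; ring
  have e2 : 2*(π:ℂ)*α*β*(w/R) = R*w := by rw [e1]; field_simp
  linear_combination (-I)*e1 - I*e2

theorem wfun_meas (s : ℂ) : Measurable (wfun s) := by
  unfold wfun
  fun_prop

theorem Tpoly_cont (ak : ℕ → ℂ) (N : ℕ) : Continuous (Tpoly ak N) := by
  unfold Tpoly; fun_prop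

theorem wl_cont (w0 : ℝ) : Continuous (wl w0) := by unfold wl; fun_prop

theorem Kf_meas (a : ℝ) : Measurable (Kf a) := by
  unfold Kf
  fun_prop

/-- main integrand -/
def mainI (a β μ : ℝ) (ak : ℕ → ℂ) (N : ℕ) (w0 v : ℝ) : ℂ :=
  (-1+I)/μ * (Tpoly ak N (wl w0 v) * cexp (-(I * (wl w0 v)^2/2)) * Kf a (β + wl w0 v/μ))

theorem norm_dir {μ : ℝ} (hμ : 0 < μ) : ‖(-1+I)/(μ:ℂ)‖ ≤ 2/μ := by
  rw [norm_div, Complex.norm_real, Real.norm_eq_abs, abs_of_pos hμ]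
  gcongr
  refine (norm_add_le _ _).trans ?_
  simp; norm_num

theorem line_est (M : ℝ) (N : ℕ) : ∃ C : ℝ, 0 ≤ C ∧ ∀ (s : ℂ) (τ : ℝ) (ak : ℕ → ℂ) (α β μ a ε x0 : ℝ) (m : ℕ) (n : ℤ), 1 ≤ τ → s.im = τ^6 → √s.im = τ^3 →
    2*π ≤ s.im → |s.re| ≤ M → IsAk s ak → 0 < β → 0 < μ → β*μ = √s.im → 2*π*α = √s.im*μ → (m:ℝ) = α - a → 0 ≤ a → a ≤ 1 →
    0 < ε → ε ≤ 1/2 → n + ε ≤ x0 → x0 ≤ n + 1 - ε → |μ*(x0-β)| ≤ 1/2 →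
    Integrable (mainI a β μ ak N (μ*(x0-β))) ∧
    IntegrableOn (fun v : ℝ => (-1+I)/μ * gfun s m (x0 + (-1+I)*v/μ)) (Set.Iic (√s.im/2)) ∧
    ‖∫ v : ℝ, mainI a β μ ak N (μ*(x0-β)) v‖ ≤ C/(μ*ε) ∧
    ‖(∫ v in Set.Iic (√s.im/2), (-1+I)/μ * gfun s m (x0 + (-1+I)*v/μ)) - ((β:ℂ)^(s-1) * cexp (-(I*s.im))) * ∫ v : ℝ, mainI a β μ ak N (μ*(x0-β)) v‖
      ≤ β^(s.re-1) * (C/(μ*ε)/τ^N) := by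
  obtain ⟨C1, hC1, hFT⟩ := FT_bound M N
  obtain ⟨C2, hC2, hpe⟩ := poly_exp M N
  set J := ∫ v : ℝ, rexp (-(|v|/2)) with hJ
  have hJ0 : 0 ≤ J := integral_nonneg fun v => (Real.exp_pos _).le
  by_cases hM0 : 0 ≤ M
  swap
  · refine ⟨0, le_rfl, ?_⟩
    intro s τ ak α β μ a ε x0 m n _ _ _ _ hM
    exact absurd ((abs_nonneg _).trans hM) hM0
  refine ⟨4*C1*J + 4*(N*(M+2)^N*2^N*C2)*J, by positivity, ?_⟩
  intro s τ ak α β μ a ε x0 m n hτ ht hs h2p hM hak hβ hμ hβμ hα hm ha0 ha1 hε hε2 h1 h2 hw0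
  set w0 := μ*(x0-β) with hw0d
  set R := √s.im with hR
  have hp : 0 < τ := by linarith
  have hRp : 0 < R := by rw [hs]; positivity
  have hμc : (μ:ℂ) ≠ 0 := by exact_mod_cast hμ.ne'
  have hR25 : 2.5 ≤ R := Real.le_sqrt_of_sq_le (by norm_num; linarith [Real.pi_gt_d2])
  have hx : ∀ v : ℝ, (x0:ℂ) + (-1+I)*v/μ = β + wl w0 v/μ := by
    intro v; unfold wl; rw [hw0d]; push_cast; field_simp; ring
  have hK : ∀ v : ℝ, ‖Kf a (β + wl w0 v/μ)‖ ≤ 2/ε := by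
    intro v
    apply K_bound ha0 ha1 hε hε2 h1 h2
    rw [← hx]
    have e : (x0:ℂ) + (-1+I)*v/μ = ((x0 - v/μ : ℝ):ℂ) + ((v/μ:ℝ):ℂ)*I := by push_cast; ring
    rw [e]
    simp only [Complex.add_re, Complex.add_im, Complex.re_ofReal_mul, Complex.im_ofReal_mul, Complex.I_re, Complex.I_im, Complex.ofReal_re, Complex.ofReal_im]
    ring
  have hdir := norm_dir hμ
  set F : ℝ → ℂ := fun v => (-1+I)/μ * ((if v ≤ R/2 then wfun s (wl w0 v) else 0) * cexp (-(I * (wl w0 v)^2/2)) * Kf a (β + wl w0 v/μ)) with hF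
  have hKm : Measurable fun v : ℝ => Kf a (β + wl w0 v/μ) := (Kf_meas a).comp (by have := (wl_cont w0).measurable; fun_prop)
  have hgm : Measurable fun v : ℝ => cexp (-(I * (wl w0 v)^2/2)) := by have := wl_cont w0; fun_prop
  have hFm : Measurable F := by
    have hi : Measurable fun v : ℝ => if v ≤ R/2 then wfun s (wl w0 v) else 0 :=
      Measurable.ite measurableSet_Iic ((wfun_meas s).comp (wl_cont w0).measurable) measurable_const
    exact ((hi.mul hgm).mul hKm).const_mul _
  have hTm : Measurable (mainI a β μ ak N w0) := by
    unfold mainI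
    have hT : Measurable fun v : ℝ => Tpoly ak N (wl w0 v) := ((Tpoly_cont ak N).comp (wl_cont w0)).measurable
    exact ((hT.mul hgm).mul hKm).const_mul _
  have hTb : ∀ v, ‖mainI a β μ ak N w0 v‖ ≤ 4*(N*(M+2)^N*2^N*C2)/(μ*ε) * rexp (-(|v|/2)) := by
    intro v
    unfold mainI
    rw [norm_mul, norm_mul, norm_mul]
    have hwn := wl_norm w0 v hw0
    have b1 : ‖Tpoly ak N (wl w0 v)‖ * ‖cexp (-(I * (wl w0 v)^2/2))‖ ≤ N*(M+2)^N*2^N*C2 * rexp (-(|v|/2)) := by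
      set u := 2*(1+|v|) with hu
      have hu1 : 1 ≤ u := by rw [hu]; linarith [abs_nonneg v]
      have huM : 1 ≤ u^(M+1) := Real.one_le_rpow hu1 (by linarith)
      calc _ ≤ (N * (M+2)^N * (1+‖wl w0 v‖)^N) * rexp (6-|v|) :=
            mul_le_mul (T_bound hτ hs hM hak N _) (gauss_bound w0 v hw0) (norm_nonneg _) (by positivity)
        _ ≤ (N * (M+2)^N * (2*u)^N) * rexp (6-|v|) := by gcongr; linarith
        _ = N*(M+2)^N*2^N * (1 * u^N * rexp (6-|v|)) := by rw [mul_pow]; ring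
        _ ≤ N*(M+2)^N*2^N * (u^(M+1) * u^N * rexp (6-|v|)) := by gcongr
        _ ≤ N*(M+2)^N*2^N * (C2 * rexp (-(|v|/2))) := mul_le_mul_of_nonneg_left (hpe v) (by positivity)
        _ = _ := by ring
    calc _ ≤ 2/μ * ((N*(M+2)^N*2^N*C2 * rexp (-(|v|/2))) * (2/ε)) := by
          refine mul_le_mul hdir (mul_le_mul b1 (hK v) (norm_nonneg _) (by positivity)) (by positivity) (by positivity)
      _ = _ := by field_simp; ring
  have hTi : Integrable (mainI a β μ ak N w0) :=
    (edec_int.const_mul _).mono' hTm.aestronglyMeasurable (Filter.Eventually.of_forall hTb)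
  have hDb : ∀ v, ‖F v - mainI a β μ ak N w0 v‖ ≤ 4*C1/(μ*ε)/τ^N * rexp (-(|v|/2)) := by
    intro v
    have e : F v - mainI a β μ ak N w0 v = (-1+I)/μ * (((if v ≤ R/2 then wfun s (wl w0 v) else 0) - Tpoly ak N (wl w0 v)) * cexp (-(I * (wl w0 v)^2/2)) * Kf a (β + wl w0 v/μ)) := by
      simp only [hF, mainI]; ring
    rw [e, norm_mul, norm_mul _ (Kf a _)]
    calc _ ≤ 2/μ * ((C1/τ^N * rexp (-(|v|/2))) * (2/ε)) := by
          refine mul_le_mul hdir (mul_le_mul (hFT s τ ak w0 v hτ ht hs h2p hM hak hw0) (hK v) (norm_nonneg _) (by positivity)) (by positivity) (by positivity)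
      _ = _ := by field_simp; ring
  have hDi : Integrable (fun v => F v - mainI a β μ ak N w0 v) :=
    (edec_int.const_mul _).mono' (hFm.sub hTm).aestronglyMeasurable (Filter.Eventually.of_forall hDb)
  have hFi : Integrable F := by
    have := hDi.add hTi
    refine this.congr (Filter.Eventually.of_forall fun v => ?_)
    simp
  set c := (β:ℂ)^(s-1) * cexp (-(I*s.im)) with hc
  have hcn : ‖c‖ = β^(s.re-1) := by
    rw [hc, norm_mul, Complex.norm_cpow_eq_rpow_re_of_pos hβ, Complex.norm_exp]
    simp
  have hgF : ∀ v : ℝ, (Set.Iic (R/2)).indicator (fun v : ℝ => (-1+I)/μ * gfun s m (x0 + (-1+I)*v/μ)) v = c * F v := by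
    intro v
    by_cases hv : v ≤ R/2
    · rw [Set.indicator_of_mem (by exact hv), hx, g_factor hβ hμ hR hRp hβμ hα hm]
      · simp only [hF, if_pos hv]; ring
      · intro h0
        have : (1 + wl w0 v/(R:ℂ)).re = 1 + (w0 - v)/R := by
          rw [Complex.add_re, Complex.div_ofReal_re, wl_re, Complex.one_re]
        rw [h0] at this
        simp at this
        have h5 : -1/2 ≤ w0 := by have := (abs_le.1 hw0).1; linarith
        have h6 : -1 < (w0 - v)/R := by rw [lt_div_iff₀ hRp]; linarith
        linarith
    · rw [Set.indicator_of_notMem (by exact hv)]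
      simp [hF, hv]
  have hgi : IntegrableOn (fun v : ℝ => (-1+I)/μ * gfun s m (x0 + (-1+I)*v/μ)) (Set.Iic (R/2)) := by
    rw [← integrable_indicator_iff measurableSet_Iic]
    refine (hFi.const_mul c).congr (Filter.Eventually.of_forall fun v => (hgF v).symm)
  refine ⟨hTi, hgi, ?_, ?_⟩
  · calc _ ≤ ∫ v, 4*(N*(M+2)^N*2^N*C2)/(μ*ε) * rexp (-(|v|/2)) :=
          norm_integral_le_of_norm_le (edec_int.const_mul _) (Filter.Eventually.of_forall hTb)
      _ = 4*(N*(M+2)^N*2^N*C2)*J/(μ*ε) := by rw [integral_const_mul]; ring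
      _ ≤ _ := by gcongr; have : 0 ≤ 4*C1*J := by positivity
                  linarith
  · rw [← integral_indicator measurableSet_Iic, integral_congr_ae (Filter.Eventually.of_forall hgF), integral_const_mul, ← mul_sub, ← integral_sub hFi hTi, norm_mul, hcn]
    gcongr
    calc _ ≤ ∫ v, 4*C1/(μ*ε)/τ^N * rexp (-(|v|/2)) :=
          norm_integral_le_of_norm_le (edec_int.const_mul _) (Filter.Eventually.of_forall hDb)
      _ = 4*C1*J/(μ*ε)/τ^N := by rw [integral_const_mul]; ring
      _ ≤ _ := by gcongr; have : 0 ≤ 4*(N*(M+2)^N*2^N*C2)*J := by positivity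
                  linarith

section
open Filter Topology

theorem exp_absorb (P : ℝ) : ∃ C : ℝ, 0 ≤ C ∧ ∀ t : ℝ, 1 ≤ t → t^P * rexp (-(t/32)) ≤ C := by
  set k := ⌈P⌉₊ with hk
  refine ⟨k.factorial * 32^k, by positivity, fun t ht => ?_⟩
  have h1 : t^P ≤ t^k := by
    rw [← Real.rpow_natCast]
    exact Real.rpow_le_rpow_of_exponent_le ht (Nat.le_ceil _)
  have h2 := Real.pow_div_factorial_le_exp (t/32) (by linarith) k
  rw [div_le_iff₀ (by positivity), div_pow, div_le_iff₀ (by positivity)] at h2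
  rw [Real.exp_neg, ← div_eq_mul_inv, div_le_iff₀ (Real.exp_pos _)]
  linarith

theorem x_mem_gap {x0 μ : ℝ} {n : ℕ} (hμ : 0 < μ) (h1 : (n:ℝ) < x0) (h2 : x0 < n+1) (v : ℝ) : (x0:ℂ) + (-1+I)*v/μ ∈ gapS n := by
  have e : (x0:ℂ) + (-1+I)*v/μ = ((x0 - v/μ : ℝ):ℂ) + ((v/μ:ℝ):ℂ)*I := by push_cast; ring
  rw [e]
  unfold gapS
  simp only [Set.mem_ofPred_eq, Complex.add_re, Complex.add_im, Complex.re_ofReal_mul, Complex.im_ofReal_mul, Complex.I_re, Complex.I_im, Complex.ofReal_re, Complex.ofReal_im]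
  by_cases hv : v = 0
  · right; subst hv; simp; exact ⟨h1, h2⟩
  · left; simp; exact ⟨hv, hμ.ne'⟩

theorem contour_line (s : ℂ) (hs : 0 < s.im) (m n : ℕ) {x0 μ V : ℝ} (hμ : 0 < μ) (h1 : (n:ℝ) < x0) (h2 : x0 < n+1) {Q : ℂ → ℂ}
    (hQ : ∀ x ∈ gapS n, HasDerivAt Q (gfun s m x) x)
    (hi : IntegrableOn (fun v : ℝ => (-1+I)/μ * gfun s m (x0 + (-1+I)*v/μ)) (Set.Iic V)) :
    riemannZeta s - ∑ k ∈ Finset.Icc 1 m, (k:ℂ)^(-s) = Efac s / Complex.Gamma s * (hLoop2 m s/((cexp (2*π*I*s) - 1) * Efac s) + ∑ k ∈ Finset.Icc 1 n, (k:ℂ)^(s-1)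
      - (∫ v in Set.Iic V, (-1+I)/μ * gfun s m (x0 + (-1+I)*v/μ)) + (Q (x0 + (-1+I)*V/μ) - Q (I/(2*π)))) := by
  have hn0 : (0:ℝ) ≤ n := Nat.cast_nonneg n
  have hx := contour s hs m n (x0 := x0) (by linarith) hQ
  have hμc : (μ:ℂ) ≠ 0 := by exact_mod_cast hμ.ne'
  -- reparametrize
  have hd : dirE = (-1+I) * ((√2/2:ℝ):ℂ) := by rw [dirE_eq]; push_cast; ring
  have hlim : Tendsto (fun A : ℝ => Q (x0 + (-1+I)*((-A:ℝ):ℂ)/μ)) atTop (𝓝 (Q (I/(2*π)) + (Complex.Gamma s*(riemannZeta s - ∑ k ∈ Finset.Icc 1 m, (k:ℂ)^(-s)) - hLoop2 m s/(cexp (2*π*I*s) - 1))/Efac s - ∑ k ∈ Finset.Icc 1 n, (k:ℂ)^(s-1))) := by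
    have hr : Tendsto (fun A : ℝ => A * (√2/μ)) atTop atTop := tendsto_id.atTop_mul_const (by positivity)
    refine (hx.comp hr).congr fun A => ?_
    simp only [Function.comp]
    congr 2
    rw [hd]
    have h2 : (√2:ℂ)*√2 = 2 := by
      rw [← Complex.ofReal_mul, Real.mul_self_sqrt (by norm_num)]; norm_num
    push_cast
    field_simp
    linear_combination (1 - I) * A * h2
  have hint : Tendsto (fun A : ℝ => ∫ v in (-A)..V, (-1+I)/μ * gfun s m (x0 + (-1+I)*v/μ)) atTop (𝓝 (∫ v in Set.Iic V, (-1+I)/μ * gfun s m (x0 + (-1+I)*v/μ))) :=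
    intervalIntegral_tendsto_integral_Iic V hi tendsto_neg_atTop_atBot
  have heq : ∀ A : ℝ, ∫ v in (-A)..V, (-1+I)/μ * gfun s m (x0 + (-1+I)*v/μ) = Q (x0 + (-1+I)*V/μ) - Q (x0 + (-1+I)*((-A:ℝ):ℂ)/μ) := by
    intro A
    exact path_int (γ := fun v : ℝ => (x0:ℂ) + (-1+I)*v/μ) (γ' := fun _ => (-1+I)/(μ:ℂ)) hQ (gfun_cont s m n)
      (fun v => by
        have := (((Complex.ofRealCLM.hasDerivAt (x := v)).const_mul (-1+I)).div_const (μ:ℂ)).const_add (x0:ℂ)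
        simpa using this) (by fun_prop) (fun v _ => x_mem_gap hμ h1 h2 v)
  have hu := tendsto_nhds_unique (hint.congr heq) (tendsto_const_nhds.sub hlim)
  have hE := Efac_ne s
  have hG : Complex.Gamma s ≠ 0 := by
    apply Complex.Gamma_ne_zero
    intro k h; rw [h] at hs; simp at hs
  have he := exp2pi_ne hs
  rw [hu]
  field_simp
  ring

set_option maxHeartbeats 800000 in
theorem seg_bound {s : ℂ} {M : ℝ} (hM : |s.re| ≤ M) (ht : 2*π ≤ s.im) {m n : ℕ} {x0 α β : ℝ} (hβ : 1 ≤ β) (hα : 1 ≤ α) (hab : s.im = 2*π*α*β)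
    (hm : (m:ℝ) ≤ α) (hx0 : |x0-β| ≤ β/5) {Q : ℂ → ℂ} (hQ : ∀ x ∈ gapS n, HasDerivAt Q (gfun s m x) x) :
    ‖Q ((x0 - β/2 : ℝ) + (β/2:ℝ)*I) - Q (I/(2*π))‖ ≤ 4 * β * (7*β)^(M+1) * rexp (-(s.im/16)) := by
  have hpi := Real.pi_gt_three
  have hpi4 := Real.pi_lt_d2
  have hd := abs_le.1 hx0
  set A : ℂ := I/(2*π) with hA
  set B : ℂ := (x0 - β/2 : ℝ) + (β/2:ℝ)*I with hB
  have hAre : A.re = 0 := by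
    have : A = ((1/(2*π):ℝ):ℂ) * I := by rw [hA]; push_cast; ring
    rw [this]; simp
  have hAim : A.im = 1/(2*π) := by
    have : A = ((1/(2*π):ℝ):ℂ) * I := by rw [hA]; push_cast; ring
    rw [this, Complex.im_ofReal_mul]; simp
  have hBre : B.re = x0 - β/2 := by rw [hB]; simp [-Complex.ofReal_sub, -Complex.ofReal_div]
  have hBim : B.im = β/2 := by rw [hB]; simp [-Complex.ofReal_sub, -Complex.ofReal_div]
  set S : Set ℂ := segment ℝ A B with hS
  have hA2 : 1/(2*π) ≤ 1/6 := by apply div_le_div_of_nonneg_left <;> linarith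
  have hA7 : 1/7 ≤ 1/(2*π) := by apply div_le_div_of_nonneg_left <;> linarith
  have hpt : ∀ x ∈ S, ∃ θ : ℝ, 0 ≤ θ ∧ θ ≤ 1 ∧ x.re = θ*(x0-β/2) ∧ x.im = θ*(β/2) + (1-θ)*(1/(2*π)) := by
    rintro x ⟨p, q, hp, hq, hpq, rfl⟩
    refine ⟨q, hq, by linarith, ?_, ?_⟩
    · simp [hAre, hBre]
    · simp only [Complex.add_im, Complex.real_smul, Complex.im_ofReal_mul, hAim, hBim]
      rw [show p = 1 - q by linarith]; ring
  have hbd : ∀ x ∈ S, ‖gfun s m x‖ ≤ 2 * (7*β)^(M+1) * rexp (-(s.im/16)) := by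
    intro x hx
    obtain ⟨θ, h0, h1, hre, him⟩ := hpt x hx
    have hi1 : 1/(2*π) ≤ x.im := by rw [him]; linarith [mul_nonneg h0 (by linarith : 0 ≤ β/2 - 1/(2*π))]
    have hi2 : x.im ≤ β/2 := by rw [him]; linarith [mul_nonneg (by linarith : 0 ≤ 1 - θ) (by linarith : 0 ≤ β/2 - 1/(2*π))]
    have hi0 : 0 < x.im := by linarith
    have hx0' : x ≠ 0 := by intro h; rw [h] at hi0; simp at hi0
    have hn : ‖x‖^2 = x.re^2 + x.im^2 := by rw [Complex.sq_norm, Complex.normSq_apply]; ring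
    have hr0 : 0 ≤ x.re := by rw [hre]; apply mul_nonneg h0; linarith
    have hr1 : x.re ≤ 7/10*β := by rw [hre]; linarith [mul_le_mul_of_nonneg_right h1 (by linarith : 0 ≤ x0 - β/2)]
    have hr2 : x.re ≤ 7/5*x.im := by
      rw [hre, him]
      have : 0 ≤ (1-θ)*(1/(2*π)) := mul_nonneg (by linarith) (by positivity)
      linarith [mul_nonneg h0 (by linarith : 0 ≤ 7/10*β - (x0-β/2))]
    have hnβ : ‖x‖ ≤ 7/8*β := by
      apply le_of_sq_le_sq _ (by linarith)
      rw [hn]; linarith [pow_le_pow_left₀ hr0 hr1 2, pow_le_pow_left₀ hi0.le hi2 2, sq_nonneg β]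
    have hn2 : ‖x‖ ≤ 2*x.im := by
      apply le_of_sq_le_sq _ (by linarith)
      rw [hn]; linarith [pow_le_pow_left₀ hr0 hr2 2, sq_nonneg x.im]
    have hnp : 0 < ‖x‖ := norm_pos_iff.2 hx0'
    have hnl : x.im ≤ ‖x‖ := Complex.im_le_norm x
    have harg := arg_ge_sin hi0.le
    have hkey : 1/16 ≤ x.arg - x.im/β := by
      have h3 : 1/2 ≤ x.im/‖x‖ := by rw [div_le_div_iff₀ (by norm_num) hnp]; linarith
      have h4 : x.im/β ≤ 7/8*(x.im/‖x‖) := by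
        rw [div_le_iff₀ (by linarith)]
        calc x.im = (x.im/‖x‖)*‖x‖ := by field_simp
          _ ≤ (x.im/‖x‖)*(7/8*β) := by gcongr
          _ = _ := by ring
      linarith
    rw [gfun_norm s m hx0']
    have hden : 1/2 ≤ ‖cexp (2*π*I*x) - 1‖ := by
      have hE : ‖cexp (2*π*I*x)‖ = rexp (-(2*π*x.im)) := by
        rw [Complex.norm_exp]; congr 1
        have : 2*π*I*x = ((2*π:ℝ):ℂ) * (I*x) := by push_cast; ring
        rw [this, Complex.re_ofReal_mul, Complex.I_mul_re]; ring
      have h5 := norm_sub_norm_le 1 (cexp (2*π*I*x))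
      rw [norm_one, hE, norm_sub_rev] at h5
      have h6 : 1 ≤ 2*π*x.im := by rw [div_le_iff₀ (by positivity)] at hi1; linarith
      have h7 : rexp (-(2*π*x.im)) ≤ 1/2 := by
        calc _ ≤ rexp (-1) := Real.exp_le_exp.2 (by linarith)
          _ ≤ 1/2 := by
            rw [Real.exp_neg, inv_le_comm₀ (Real.exp_pos _) (by norm_num)]
            linarith [Real.exp_one_gt_d9]
      linarith
    have hpow : ‖x‖^(s.re-1) ≤ (7*β)^(M+1) := by
      apply rpow_two_sided (by linarith)
      · refine le_trans ?_ (hi1.trans hnl)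
        refine le_trans ?_ hA7
        apply div_le_div_of_nonneg_left <;> linarith
      · linarith
      · have := abs_sub s.re 1
        rw [abs_one] at this; linarith
    have hexp : rexp (-(s.im*x.arg)) * rexp (2*π*m*x.im) ≤ rexp (-(s.im/16)) := by
      rw [← Real.exp_add]
      apply Real.exp_le_exp.2
      have h8 : 2*π*m*x.im ≤ s.im*(x.im/β) := by
        rw [hab]
        calc 2*π*m*x.im ≤ 2*π*α*x.im := by gcongr
          _ = _ := by field_simp
      linarith [mul_le_mul_of_nonneg_left hkey (by linarith : 0 ≤ s.im)]
    rw [div_le_iff₀ (by linarith), mul_assoc (‖x‖^(s.re-1))]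
    calc _ ≤ (7*β)^(M+1) * rexp (-(s.im/16)) := mul_le_mul hpow hexp (by positivity) (by positivity)
      _ = 2 * (7*β)^(M+1) * rexp (-(s.im/16)) * (1/2) := by ring
      _ ≤ _ := by gcongr
  have hder : ∀ x ∈ S, HasDerivWithinAt Q (gfun s m x) S x := by
    intro x hx
    obtain ⟨θ, h0, h1, hre, him⟩ := hpt x hx
    refine (hQ x (Or.inl ?_)).hasDerivWithinAt
    have : 0 < 1/(2*π) := by positivity
    have : 1/(2*π) ≤ x.im := by rw [him]; linarith [mul_nonneg h0 (by linarith : 0 ≤ β/2 - 1/(2*π))]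
    linarith
  have hmv := (convex_segment A B).norm_image_sub_le_of_norm_hasDerivWithin_le hder hbd (left_mem_segment ℝ A B) (right_mem_segment ℝ A B)
  refine hmv.trans ?_
  have hAB : ‖B - A‖ ≤ 2*β := by
    refine (Complex.norm_le_abs_re_add_abs_im _).trans ?_
    rw [Complex.sub_re, Complex.sub_im, hAre, hAim, hBre, hBim, sub_zero, abs_of_nonneg (by linarith), abs_of_nonneg (by linarith)]
    linarith
  calc _ ≤ 2 * (7*β)^(M+1) * rexp (-(s.im/16)) * (2*β) := by gcongr
    _ = _ := by ring
end

section
open Filter Topology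

theorem hLoop2_bound : ∃ C : ℝ, 0 ≤ C ∧ ∀ (m : ℕ) (s : ℂ), 0 < s.im → ‖hLoop2 m s‖ ≤ C * rexp (m - π*s.im) := by
  obtain ⟨C0, hC0⟩ := (isCompact_Icc (a := π) (b := 3*π)).exists_bound_of_continuousOn (hLoop_integrand_cont 0).continuousOn
  have hC0' : 0 ≤ C0 := (norm_nonneg _).trans (hC0 π ⟨le_rfl, by linarith [Real.pi_pos]⟩)
  refine ⟨C0 * (2*π), by positivity, fun m s hs => ?_⟩
  have hpi := Real.pi_pos
  have hb : ∀ θ ∈ Set.uIoc π (3*π), ‖I*cexp (I*s*θ)*hz m (cexp (I*θ))‖ ≤ C0 * rexp (m - π*s.im) := by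
    intro θ hθ
    rw [Set.uIoc_of_le (by linarith)] at hθ
    have h1 := hC0 θ ⟨hθ.1.le, hθ.2⟩
    have e : hz m (cexp (I*θ)) = cexp (-(m:ℂ)*cexp (I*θ)) * hz 0 (cexp (I*θ)) := by
      unfold hz; simp; ring
    rw [e, norm_mul, norm_mul, norm_mul, Complex.norm_I, one_mul, Complex.norm_exp, Complex.norm_exp]
    have e1 : (I*s*θ).re = -(s.im*θ) := by simp
    have e2 : (-(m:ℂ)*cexp (I*θ)).re ≤ m := by
      refine (Complex.re_le_norm _).trans ?_
      rw [norm_mul, norm_neg, Complex.norm_natCast, mul_comm I, Complex.norm_exp_ofReal_mul_I, mul_one]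
    rw [e1]
    have h2 : π*s.im ≤ s.im*θ := by nlinarith [hθ.1]
    calc _ ≤ rexp (-(π*s.im)) * (rexp m * C0) := by gcongr
      _ = C0 * (rexp (-(π*s.im)) * rexp m) := by ring
      _ = _ := by rw [← Real.exp_add]; congr 2; ring
  have := intervalIntegral.norm_integral_le_of_norm_le_const hb
  unfold hLoop2
  refine this.trans (le_of_eq ?_)
  rw [abs_of_pos (by linarith)]; ring

theorem exp2pis_norm (s : ℂ) : ‖cexp (2*π*I*s)‖ = rexp (-(2*π*s.im)) := by
  rw [Complex.norm_exp]; congr 1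
  have : 2*π*I*s = ((2*π:ℝ):ℂ) * (I*s) := by push_cast; ring
  rw [this, Complex.re_ofReal_mul, Complex.I_mul_re]; ring

theorem exppis_norm (s : ℂ) : ‖cexp (π*I*s)‖ = rexp (-(π*s.im)) := by
  rw [Complex.norm_exp]; congr 1
  have : π*I*s = ((π:ℝ):ℂ) * (I*s) := by ring
  rw [this, Complex.re_ofReal_mul, Complex.I_mul_re]; ring

theorem exp_neg_half {y : ℝ} (h : 1 ≤ y) : rexp (-y) ≤ 1/2 := by
  calc _ ≤ rexp (-1) := Real.exp_le_exp.2 (by linarith)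
    _ ≤ 1/2 := by
      rw [Real.exp_neg, inv_le_comm₀ (Real.exp_pos _) (by norm_num)]
      linarith [Real.exp_one_gt_d9]

theorem exp2pis_low {s : ℂ} (ht : 1 ≤ s.im) : 1/2 ≤ ‖cexp (2*π*I*s) - 1‖ := by
  have h5 := norm_sub_norm_le 1 (cexp (2*π*I*s))
  rw [norm_one, exp2pis_norm, norm_sub_rev] at h5
  have := exp_neg_half (y := 2*π*s.im) (by nlinarith [Real.pi_gt_three])
  linarith

theorem exppis_low {s : ℂ} (ht : 1 ≤ s.im) : 1/2 ≤ ‖1 + cexp (π*I*s)‖ := by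
  have h5 := norm_sub_norm_le 1 (-cexp (π*I*s))
  rw [norm_one, norm_neg, exppis_norm, sub_neg_eq_add] at h5
  have := exp_neg_half (y := π*s.im) (by nlinarith [Real.pi_gt_three])
  linarith

theorem E1_bound (M : ℝ) : ∃ C : ℝ, 0 ≤ C ∧ ∀ (m : ℕ) (s : ℂ), |s.re| ≤ M → 1 ≤ s.im → (m:ℝ) ≤ s.im/6 →
    ‖hLoop2 m s/((cexp (2*π*I*s) - 1) * Efac s)‖ ≤ C * rexp (-s.im) := by
  obtain ⟨C0, hC0, hb⟩ := hLoop2_bound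
  refine ⟨C0 * 2 * (2*π)^M, by positivity, fun m s hM ht hm => ?_⟩
  have hpi := Real.pi_gt_three
  rw [norm_div, norm_mul, Efac_norm]
  have h1 := hb m s (by linarith)
  have h2 := exp2pis_low ht
  have h3 : (2*π)^(-M) ≤ (2*π)^s.re := Real.rpow_le_rpow_of_exponent_le (by linarith) (by linarith [(abs_le.1 hM).1])
  rw [Real.rpow_neg (by positivity)] at h3
  calc _ ≤ C0 * rexp (m - π*s.im) / (1/2 * (((2*π)^M)⁻¹ * rexp (-(π*s.im/2)))) := by gcongr
    _ = C0 * 2 * (2*π)^M * (rexp (m - π*s.im) * rexp (π*s.im/2)) := by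
      rw [Real.exp_neg (π*s.im/2)]; field_simp
    _ ≤ _ := by
      gcongr
      rw [← Real.exp_add]
      apply Real.exp_le_exp.2
      nlinarith

theorem chi_eq {s : ℂ} (ht : 0 < s.im) : chi s = Efac s / Complex.Gamma s / (1 + cexp (π*I*s)) := by
  have hpi : (π:ℂ) ≠ 0 := by exact_mod_cast Real.pi_ne_zero
  have im_ne : ∀ z : ℂ, z.im ≠ 0 → ∀ k : ℕ, z ≠ -k := by
    intro z hz k h; rw [h] at hz; simp at hz
  have g1 : Complex.Gamma s ≠ 0 := Complex.Gamma_ne_zero (im_ne s ht.ne')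
  have g2 : Complex.Gamma (s/2) ≠ 0 := Complex.Gamma_ne_zero (im_ne _ (by simp; exact ht.ne'))
  have g3 : Complex.Gamma (1 - s/2) ≠ 0 := Complex.Gamma_ne_zero (im_ne _ (by simp; exact ht.ne'))
  have r1 := Complex.Gamma_mul_Gamma_one_sub (s/2)
  have r2 := Complex.Gamma_mul_Gamma_one_sub s
  have r3 := Complex.Gamma_mul_Gamma_add_half ((1-s)/2)
  rw [show (1-s)/2 + 1/2 = 1 - s/2 by ring, show 2*((1-s)/2) = 1 - s by ring, show 1 - (1-s) = s by ring] at r3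
  have sne : ∀ z : ℂ, z.im ≠ 0 → Complex.sin (π*z) ≠ 0 := by
    intro z hz h
    rw [Complex.sin_eq_zero_iff] at h
    obtain ⟨k, hk⟩ := h
    have : z = k := by
      have : (π:ℂ)*(z - k) = 0 := by rw [mul_sub, hk]; ring
      rcases mul_eq_zero.1 this with h | h
      · exact absurd h hpi
      · linear_combination h
    rw [this] at hz; simp at hz
  have s1 := sne s ht.ne'
  have s2 := sne (s/2) (by simp; exact ht.ne')
  have hdbl : Complex.sin (π*s) = 2 * Complex.sin (π*(s/2)) * Complex.cos (π*(s/2)) := by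
    rw [← Complex.sin_two_mul]; congr 1; ring
  have hc : Complex.cos (π*(s/2)) ≠ 0 := by
    intro h; rw [h, mul_zero] at hdbl; exact s1 hdbl
  have hcos : 2 * Complex.cos (π*(s/2)) * cexp (π*I*s/2) = 1 + cexp (π*I*s) := by
    rw [Complex.cos]
    have e1 : cexp (π*I*s) = cexp (π*I*s/2) * cexp (π*I*s/2) := by rw [← Complex.exp_add]; ring_nf
    have e2 : cexp (-(π*(s/2))*I) = (cexp (π*I*s/2))⁻¹ := by rw [← Complex.exp_neg]; ring_nf
    have e3 : cexp (π*(s/2)*I) = cexp (π*I*s/2) := by ring_nf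
    rw [e1, e2, e3]; field_simp; ring
  have hpow : ((2*π:ℝ):ℂ)^s = 2^s * (π:ℂ)^s := by
    rw [Complex.ofReal_mul, Complex.mul_cpow_ofReal_nonneg (by norm_num) Real.pi_pos.le]; norm_num
  have hpi2 : (π:ℂ)^(s-1/2) * (√π:ℂ) = (π:ℂ)^s := by
    rw [Real.sqrt_eq_rpow, Complex.ofReal_cpow Real.pi_pos.le, ← Complex.cpow_add _ _ hpi]; congr 1; push_cast; ring
  rw [eq_div_iff s2] at r1
  rw [eq_div_iff s1] at r2
  unfold chi Efac
  rw [← hcos, hpow, ← hpi2]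
  have hE := Complex.exp_ne_zero (π*I*s/2)
  have hG : Complex.Gamma ((1-s)/2) * (2 * Complex.cos (π*(s/2)) * Complex.Gamma s) = 2^s * (√π:ℂ) * Complex.Gamma (s/2) := by
    have : Complex.Gamma ((1-s)/2) * (2 * Complex.cos (π*(s/2)) * Complex.Gamma s) * (Complex.Gamma (1-s/2) * Complex.sin (π*(s/2)) ) =  2^s * (√π:ℂ) * Complex.Gamma (s/2) * (Complex.Gamma (1-s/2) * Complex.sin (π*(s/2)) ) := by
      rw [hdbl] at r2
      linear_combination (2*Complex.cos (π*(s/2)) * Complex.Gamma s * Complex.sin (π*(s/2))) * r3 + 2^s*(√π:ℂ)*(r2 - r1)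
    exact mul_right_cancel₀ (mul_ne_zero g3 s2) this
  rw [div_div, div_eq_div_iff g2 (mul_ne_zero g1 (mul_ne_zero (mul_ne_zero two_ne_zero hc) hE))]
  linear_combination (π:ℂ)^(s-1/2) * cexp (π*I*s/2) * hG
end

section
open Filter Topology

theorem gb (k : ℕ) (W Y : ℝ) (hW : 0 ≤ W) (hY : 0 ≤ Y) : ∃ C : ℝ, 0 ≤ C ∧ ∀ (w0 v : ℝ) (y : ℂ), |w0| ≤ W → ‖y‖ ≤ Y →
    ‖(wl w0 v)^k * (cexp (y * wl w0 v) * cexp (-(I * (wl w0 v)^2/2)))‖ ≤ C * rexp (-(|v|/2)) := by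
  set L := 2*(1+Y) + W + 1/2 with hL
  refine ⟨k.factorial * rexp ((1+Y)*W + L^2/4), by positivity, fun w0 v y hw hy => ?_⟩
  have hn : ‖wl w0 v‖ ≤ W + 2*|v| := by
    refine (Complex.norm_le_abs_re_add_abs_im _).trans ?_
    rw [wl_re, wl_im]
    have := abs_sub w0 v
    linarith
  have h1 : ‖wl w0 v‖^k ≤ k.factorial * rexp ‖wl w0 v‖ := by
    have := Real.pow_div_factorial_le_exp _ (norm_nonneg (wl w0 v)) k
    rw [div_le_iff₀ (by positivity)] at this
    linarith
  have h2 : ‖cexp (y * wl w0 v)‖ ≤ rexp (Y * ‖wl w0 v‖) := by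
    rw [Complex.norm_exp]
    apply Real.exp_le_exp.2
    refine (Complex.re_le_norm _).trans ?_
    rw [norm_mul]; gcongr
  have h3 : w0*v ≤ W*|v| := by
    calc w0*v ≤ |w0*v| := le_abs_self _
      _ = |w0| * |v| := abs_mul _ _
      _ ≤ _ := by gcongr
  rw [norm_mul, norm_mul, norm_pow, gauss_norm]
  calc _ ≤ (k.factorial * rexp ‖wl w0 v‖) * (rexp (Y * ‖wl w0 v‖) * rexp (w0*v - v^2)) := by gcongr
    _ = k.factorial * rexp ((1+Y)*‖wl w0 v‖ + (w0*v - v^2)) := by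
      rw [mul_assoc, ← Real.exp_add, ← Real.exp_add]; ring_nf
    _ ≤ k.factorial * rexp ((1+Y)*W + L^2/4 + -(|v|/2)) := by
      refine mul_le_mul_of_nonneg_left (Real.exp_le_exp.2 ?_) (by positivity)
      have : (1+Y)*‖wl w0 v‖ ≤ (1+Y)*(W+2*|v|) := by gcongr
      have e1 : L*|v| = (2*(1+Y) + W + 1/2)*|v| := by rw [hL]
      nlinarith [sq_nonneg (|v| - L/2), sq_abs v]
    _ = _ := by rw [Real.exp_add]; ring

def Fk (a β μ : ℝ) (w0 : ℝ) (k : ℕ) (y : ℂ) (v : ℝ) : ℂ :=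
  (-1+I)/μ * ((wl w0 v)^k * (cexp (y * wl w0 v) * cexp (-(I * (wl w0 v)^2/2))) * Kf a (β + wl w0 v/μ))

theorem Fk_meas (a β μ w0 : ℝ) (k : ℕ) (y : ℂ) : AEStronglyMeasurable (Fk a β μ w0 k y) := by
  unfold Fk
  have h1 := (wl_cont w0)
  have h2 := (Kf_meas a).comp (show Measurable (fun v => (β:ℂ) + wl w0 v/μ) from by
    have := h1.measurable; fun_prop)
  refine AEStronglyMeasurable.const_mul (AEStronglyMeasurable.mul ?_ h2.aestronglyMeasurable) _
  exact (by fun_prop : Continuous _).aestronglyMeasurable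

theorem Fk_bound {a β μ w0 Kb : ℝ} (hK : ∀ v, ‖Kf a (β + wl w0 v/μ)‖ ≤ Kb) (k : ℕ) (Y : ℝ) (hY : 0 ≤ Y) :
    ∃ C, 0 ≤ C ∧ ∀ y v, ‖y‖ ≤ Y → ‖Fk a β μ w0 k y v‖ ≤ C * rexp (-(|v|/2)) := by
  obtain ⟨C, hC, h⟩ := gb k |w0| Y (abs_nonneg _) hY
  have hKb : 0 ≤ Kb := (norm_nonneg _).trans (hK 0)
  refine ⟨‖(-1+I)/(μ:ℂ)‖ * (C * Kb), by positivity, fun y v hy => ?_⟩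
  unfold Fk
  rw [norm_mul, norm_mul]
  calc _ ≤ ‖(-1+I)/(μ:ℂ)‖ * ((C*rexp (-(|v|/2))) * Kb) := by
        gcongr
        · exact h w0 v y le_rfl hy
        · exact hK v
    _ = _ := by ring

theorem Fk_int {a β μ w0 Kb : ℝ} (hK : ∀ v, ‖Kf a (β + wl w0 v/μ)‖ ≤ Kb) (k : ℕ) (y : ℂ) : Integrable (Fk a β μ w0 k y) := by
  obtain ⟨C, hC, h⟩ := Fk_bound hK k ‖y‖ (norm_nonneg _)
  exact (edec_int.const_mul C).mono' (Fk_meas ..) (ae_of_all _ fun v => h y v le_rfl)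

def Jk (a β μ : ℝ) (w0 : ℝ) (k : ℕ) (y : ℂ) : ℂ := ∫ v, Fk a β μ w0 k y v

theorem Jk_deriv {a β μ w0 Kb : ℝ} (hK : ∀ v, ‖Kf a (β + wl w0 v/μ)‖ ≤ Kb) (k : ℕ) (y : ℂ) :
    HasDerivAt (Jk a β μ w0 k) (Jk a β μ w0 (k+1) y) y := by
  obtain ⟨C, hC, h⟩ := Fk_bound hK (k+1) (‖y‖+1) (by positivity)
  refine (hasDerivAt_integral_of_dominated_loc_of_deriv_le (F := Fk a β μ w0 k) (F' := Fk a β μ w0 (k+1)) (bound := fun v => C * rexp (-(|v|/2)))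
    (Metric.ball_mem_nhds y one_pos) (Eventually.of_forall fun y => Fk_meas ..) (Fk_int hK k y) (Fk_meas ..) ?_ (edec_int.const_mul C) ?_).2
  · refine ae_of_all _ fun v z hz => h z v ?_
    rw [Metric.mem_ball, dist_eq_norm] at hz
    have := norm_add_le (z - y) y
    simp only [sub_add_cancel] at this
    linarith
  · refine ae_of_all _ fun v z hz => ?_
    unfold Fk
    have : HasDerivAt (fun y => cexp (y * wl w0 v)) (cexp (z * wl w0 v) * wl w0 v) z := by
      have := ((hasDerivAt_id z).mul_const (wl w0 v)).cexp
      simpa using this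
    have := (((this.mul_const (cexp (-(I * (wl w0 v)^2/2)))).const_mul ((wl w0 v)^k)).mul_const (Kf a (β + wl w0 v/μ))).const_mul ((-1+I)/(μ:ℂ))
    refine HasDerivAt.congr_deriv this ?_
    rw [pow_succ]; ring

theorem Jk_iter {a β μ w0 Kb : ℝ} (hK : ∀ v, ‖Kf a (β + wl w0 v/μ)‖ ≤ Kb) (k : ℕ) :
    iteratedDeriv k (Jk a β μ w0 0) = Jk a β μ w0 k := by
  induction k with
  | zero => simp
  | succ k ih => rw [iteratedDeriv_succ, ih]; funext y; exact (Jk_deriv hK k y).deriv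

theorem mainI_sum {a β μ w0 Kb : ℝ} (hK : ∀ v, ‖Kf a (β + wl w0 v/μ)‖ ≤ Kb) (ak : ℕ → ℂ) (N : ℕ) :
    ∫ v, mainI a β μ ak N w0 v = ∑ k ∈ Finset.range N, ak k * iteratedDeriv k (Jk a β μ w0 0) 0 := by
  have : ∀ v, mainI a β μ ak N w0 v = ∑ k ∈ Finset.range N, ak k * Fk a β μ w0 k 0 v := by
    intro v
    unfold mainI Tpoly Fk
    rw [Finset.sum_mul, Finset.sum_mul, Finset.mul_sum]
    refine Finset.sum_congr rfl fun k _ => ?_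
    simp; ring
  simp_rw [this]
  rw [integral_finsetSum _ (fun k _ => (Fk_int hK k 0).const_mul _)]
  refine Finset.sum_congr rfl fun k _ => ?_
  rw [integral_const_mul, Jk_iter hK]; rfl
end

section
open Filter Topology

theorem K_line {a ε β μ w0 : ℝ} {n : ℕ} (ha0 : 0 ≤ a) (ha1 : a ≤ 1) (hε : 0 < ε) (hε2 : ε ≤ 1/2) (hμ : 0 < μ)
    (h1 : n + ε ≤ β + w0/μ) (h2 : β + w0/μ ≤ n + 1 - ε) (v : ℝ) : ‖Kf a (β + wl w0 v/μ)‖ ≤ 2/ε := by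
  have e1 : ((β:ℂ) + wl w0 v/μ).re = β + (w0 - v)/μ := by
    rw [Complex.add_re, Complex.div_ofReal_re, wl_re, Complex.ofReal_re]
  have e2 : ((β:ℂ) + wl w0 v/μ).im = v/μ := by
    rw [Complex.add_im, Complex.div_ofReal_im, wl_im, Complex.ofReal_im, zero_add]
  refine K_bound (n := n) (x0 := β + w0/μ) ha0 ha1 hε hε2 (by exact_mod_cast h1) (by exact_mod_cast h2) ?_
  rw [e1, e2]; ring

def Phi (a β μ : ℝ) (y x : ℂ) : ℂ := cexp (y * (μ*(x-β))) * cexp (-(I * (μ*(x-β))^2/2)) * Kf a x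

theorem Phi_diff (a β μ : ℝ) (y : ℂ) (n : ℕ) : DifferentiableOn ℂ (Phi a β μ y) (gapS n) := by
  intro x hx
  apply DifferentiableAt.differentiableWithinAt
  have h2 : cexp (2*π*I*x) - 1 ≠ 0 := exp_two_pi_ne_one (gapS_ne_int hx)
  unfold Phi Kf
  refine DifferentiableAt.mul (by fun_prop) (DifferentiableAt.div (by fun_prop) (by fun_prop) h2)

theorem Phi_wl (a β μ : ℝ) (hμ : 0 < μ) (y : ℂ) (w : ℂ) : Phi a β μ y (β + w/μ) = cexp (y*w) * cexp (-(I*w^2/2)) * Kf a (β + w/μ) := by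
  have : (μ:ℂ) ≠ 0 := by exact_mod_cast hμ.ne'
  unfold Phi
  rw [show (μ:ℂ)*((β:ℂ) + w/μ - β) = w by field_simp; ring]

theorem line_shift {a ε β μ w0 w1 : ℝ} {n : ℕ} (ha0 : 0 ≤ a) (ha1 : a ≤ 1) (hε : 0 < ε) (hε2 : ε ≤ 1/2) (hμ : 0 < μ)
    (h1 : n + ε ≤ β + w0/μ) (h2 : β + w0/μ ≤ n + 1 - ε) (h3 : n + ε ≤ β + w1/μ) (h4 : β + w1/μ ≤ n + 1 - ε) (y : ℂ) :
    Jk a β μ w0 0 y = Jk a β μ w1 0 y := by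
  obtain ⟨P, hP⟩ := star_prim (gapS_open n) (gapS_star n) (Phi_diff a β μ y n)
  have hc := (Phi_diff a β μ y n).continuousOn
  have hmem : ∀ ω v : ℝ, n + ε ≤ β + ω/μ → β + ω/μ ≤ n+1-ε → (β:ℂ) + wl ω v/μ ∈ gapS n := by
    intro ω v h h'
    have := x_mem_gap (x0 := β + ω/μ) (n := n) hμ (by linarith) (by linarith) v
    convert this using 1
    unfold wl; push_cast; ring
  have hv : ∀ ω : ℝ, n + ε ≤ β + ω/μ → β + ω/μ ≤ n+1-ε → ∀ V : ℝ, ∫ v in (-V)..V, Fk a β μ ω 0 y v = P (β + wl ω V/μ) - P (β + wl ω (-V)/μ) := by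
    intro ω h h' V
    rw [← path_int hP hc (γ := fun v => (β:ℂ) + wl ω v/μ) (γ' := fun _ => (-1+I)/(μ:ℂ)) (a := -V) (b := V) ?_ continuous_const (fun v _ => hmem ω v h h')]
    · refine intervalIntegral.integral_congr fun v _ => ?_
      simp only [Phi_wl a β μ hμ, Fk]; simp
    · intro v
      unfold wl
      have : HasDerivAt (fun v : ℝ => (v:ℂ)) 1 v := Complex.ofRealCLM.hasDerivAt
      have := (((this.const_mul (-1+I)).const_add (ω:ℂ)).div_const (μ:ℂ)).const_add (β:ℂ)
      simpa using this
  obtain ⟨C, hC, hb⟩ := gb 0 (|w0|+|w1|) ‖y‖ (by positivity) (norm_nonneg _)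
  have hbet : ∀ ω ∈ Set.uIcc w1 w0, n + ε ≤ β + ω/μ ∧ β + ω/μ ≤ n+1-ε ∧ |ω| ≤ |w0| + |w1| := by
    intro ω hω
    rw [Set.mem_uIcc] at hω
    have m1 : ∀ p q : ℝ, p ≤ q → p/μ ≤ q/μ := fun p q h => by gcongr
    rcases hω with ⟨p, q⟩ | ⟨p, q⟩
    · refine ⟨by linarith [m1 _ _ p], by linarith [m1 _ _ q], abs_le.2 ⟨?_, ?_⟩⟩
      · linarith [neg_abs_le w1, abs_nonneg w0]
      · linarith [le_abs_self w0, abs_nonneg w1]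
    · refine ⟨by linarith [m1 _ _ p], by linarith [m1 _ _ q], abs_le.2 ⟨?_, ?_⟩⟩
      · linarith [neg_abs_le w0, abs_nonneg w1]
      · linarith [le_abs_self w1, abs_nonneg w0]
  have hh : ∀ V : ℝ, ‖P (β + wl w0 V/μ) - P (β + wl w1 V/μ)‖ ≤ (1/μ * (C * rexp (-(|V|/2)) * (2/ε))) * |w0 - w1| := by
    intro V
    rw [← path_int hP hc (γ := fun ω => (β:ℂ) + wl ω V/μ) (γ' := fun _ => 1/(μ:ℂ)) (a := w1) (b := w0) ?_ continuous_const (fun ω h => hmem ω V (hbet ω h).1 (hbet ω h).2.1)]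
    · refine intervalIntegral.norm_integral_le_of_norm_le_const fun ω hω => ?_
      obtain ⟨q1, q2, q3⟩ := hbet ω (Set.uIoc_subset_uIcc hω)
      rw [Phi_wl a β μ hμ, norm_mul, norm_mul (_ * _), norm_div, norm_one, Complex.norm_real, Real.norm_of_nonneg hμ.le]
      gcongr
      · simpa using hb ω V y q3 le_rfl
      · exact K_line ha0 ha1 hε hε2 hμ q1 q2 V
    · intro ω
      unfold wl
      have : HasDerivAt (fun v : ℝ => (v:ℂ)) 1 ω := Complex.ofRealCLM.hasDerivAt
      have := ((this.add_const ((-1+I)*V)).div_const (μ:ℂ)).const_add (β:ℂ)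
      simpa using this
  have t0 := intervalIntegral_tendsto_integral (Fk_int (K_line ha0 ha1 hε hε2 hμ h1 h2) 0 y) tendsto_neg_atTop_atBot tendsto_id
  have t1 := intervalIntegral_tendsto_integral (Fk_int (K_line ha0 ha1 hε hε2 hμ h3 h4) 0 y) tendsto_neg_atTop_atBot tendsto_id
  have t2 := t0.sub t1
  have t3 : Tendsto (fun V : ℝ => (∫ v in (-V)..(id V), Fk a β μ w0 0 y v) - ∫ v in (-V)..(id V), Fk a β μ w1 0 y v) atTop (𝓝 0) := by
    refine squeeze_zero_norm' (a := fun V : ℝ => 2*((1/μ * (C * rexp (-(V/2)) * (2/ε))) * |w0 - w1|)) ?_ ?_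
    · filter_upwards [eventually_ge_atTop 0] with V hV
      simp only [id]
      rw [hv w0 h1 h2, hv w1 h3 h4]
      have b1 := hh V
      have b2 := hh (-V)
      rw [abs_neg] at b2
      rw [abs_of_nonneg hV] at b1 b2
      rw [show ∀ p q r s : ℂ, p - q - (r - s) = (p - r) - (q - s) from fun p q r s => by ring]
      refine (norm_sub_le _ _).trans ?_
      linarith
    · have : Tendsto (fun V : ℝ => rexp (-(V/2))) atTop (𝓝 0) := by
        refine Real.tendsto_exp_neg_atTop_nhds_zero.comp (tendsto_id.atTop_div_const (by norm_num))
      have := ((((this.const_mul C).mul_const (2/ε)).const_mul (1/μ)).mul_const |w0-w1|).const_mul 2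
      simpa using this
  have := tendsto_nhds_unique t2 t3
  unfold Jk
  exact sub_eq_zero.1 this
end

section
open Filter Topology

theorem J_Ups {a b β μ lam : ℝ} {n : ℕ} (hl : 0 < lam) (hμ : μ = √(2*π)*lam) (hb : b = β - n) (y : ℂ) :
    Jk a β μ (μ*(n+1/2-β)) 0 y = cexp (2*π*I*a*n - I*π*lam^2*b^2 - y*μ*b) * Upsilon (lam^2*b + a - I*y*μ/(2*π)) ((lam^2:ℝ):ℂ) := by
  have hμ0 : 0 < μ := by rw [hμ]; positivity
  have hμc : (μ:ℂ) ≠ 0 := by exact_mod_cast hμ0.ne'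
  have hpi : (π:ℂ) ≠ 0 := by exact_mod_cast Real.pi_ne_zero
  have hμ2 : (μ:ℂ)^2 = 2*π*lam^2 := by
    have : μ^2 = 2*π*lam^2 := by rw [hμ, mul_pow, Real.sq_sqrt (by positivity)]
    exact_mod_cast this
  have hs2 : ((√2:ℝ):ℂ)^2 = 2 := by
    have : (√2:ℝ)^2 = 2 := Real.sq_sqrt (by norm_num)
    exact_mod_cast this
  have hd : (-1+I:ℂ) = (√2:ℝ) * dirE := by
    rw [dirE_eq]; push_cast; linear_combination (-(-1+I)/2)*hs2
  set c : ℝ := √2/μ with hc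
  have hc0 : 0 < c := by positivity
  set E := cexp (2*π*I*a*n - I*π*lam^2*b^2 - y*μ*b) with hE
  set g : ℝ → ℂ := fun v => Complex.exp (3 * (π:ℂ) * I / 4) *
    (Complex.exp (-(π:ℂ) * I * ((lam^2:ℝ):ℂ) * (1/2 + Complex.exp (3 * (π:ℂ) * I / 4) * v) ^ 2
        + 2 * (π:ℂ) * I * (lam^2*b + a - I*y*μ/(2*π)) * (1/2 + Complex.exp (3 * (π:ℂ) * I / 4) * v)) /
      (Complex.exp (2 * (π:ℂ) * I * (1/2 + Complex.exp (3 * (π:ℂ) * I / 4) * v)) - 1)) with hg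
  have key : ∀ v, Fk a β μ (μ*(n+1/2-β)) 0 y v = (c:ℂ) * (E * g (c*v)) := by
    intro v
    simp only [hg]
    rw [show cexp (3*(π:ℂ)*I/4) = dirE from rfl]
    set z : ℂ := 1/2 + dirE * ((c*v:ℝ):ℂ) with hz
    have hw : wl (μ*(n+1/2-β)) v = μ*(z - b) := by
      unfold wl
      rw [hd, hz, hb, hc]; push_cast; field_simp; ring
    have hx : (β:ℂ) + wl (μ*(n+1/2-β)) v/μ = n + z := by
      rw [hw, hb]; push_cast; field_simp; ring
    unfold Fk Kf
    rw [hx, hw]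
    have hper : cexp (2*π*I*(n+z)) = cexp (2*π*I*z) := by
      rw [mul_add, Complex.exp_add, show 2*π*I*(n:ℂ) = n*(2*π*I) by ring, Complex.exp_nat_mul_two_pi_mul_I, one_mul]
    rw [hper, pow_zero, one_mul, ← Complex.exp_add, hE]
    have e1 : cexp (y * (μ*(z-b)) + -(I*(μ*(z-b))^2/2)) * cexp (2*π*I*a*(n+z)) = cexp (2*π*I*a*n - I*π*lam^2*b^2 - y*μ*b) *
       cexp (-(π:ℂ) * I * ((lam^2:ℝ):ℂ) * z ^ 2 + 2 * (π:ℂ) * I * (lam^2*b + a - I*y*μ/(2*π)) * z) := by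
      rw [← Complex.exp_add, ← Complex.exp_add]; congr 1
      have : 2*(π:ℂ)*I*(I*y*μ/(2*π)) = -(y*μ) := by
        field_simp; rw [Complex.I_sq]; ring
      push_cast
      linear_combination (-(I*(z-b)^2/2))*hμ2 + z * this
    rw [show (-1+I:ℂ)/μ = c * dirE by rw [hd, hc]; push_cast; ring]
    rw [mul_div_assoc', e1]; ring
  unfold Jk
  simp_rw [key]
  rw [integral_const_mul, integral_const_mul, Measure.integral_comp_mul_left g c, abs_of_pos (by positivity)]
  have hcc : (c:ℂ) ≠ 0 := by exact_mod_cast hc0.ne'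
  have hU : ∫ v, g v = Upsilon (lam^2*b + a - I*y*μ/(2*π)) ((lam^2:ℝ):ℂ) := rfl
  rw [Complex.real_smul, hU]
  push_cast
  field_simp

theorem J_eval {a b β μ lam : ℝ} {n : ℕ} (hl : 0 < lam) (hμ : μ = √(2*π)*lam) (hb : b = β - n) (y : ℂ) :
    Jk a β μ (μ*(n+1/2-β)) 0 y = (((lam^((1:ℝ)/2))⁻¹:ℝ):ℂ) * cexp (2*π*I*a*n - I*π*lam^2*b^2 + π*I*(a/lam+b*lam)^2/2 - π*I/8) *
      (cexp ((√(π/2):ℝ)*(a/lam-b*lam)*y - I*y^2/4) * G ((a/lam+b*lam:ℝ) + (-I/(√(2*π):ℝ))*y) ((lam^2:ℝ):ℂ)) := by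
  have hlc : (lam:ℂ) ≠ 0 := by exact_mod_cast hl.ne'
  have hpi : (π:ℂ) ≠ 0 := by exact_mod_cast Real.pi_ne_zero
  have hr2 : ((√(2*π):ℝ):ℂ)^2 = 2*π := by
    have : (√(2*π))^2 = 2*π := Real.sq_sqrt (by positivity)
    exact_mod_cast this
  have hr0 : ((√(2*π):ℝ):ℂ) ≠ 0 := by
    have : √(2*π) ≠ 0 := by positivity
    exact_mod_cast this
  have hrr : (√(π/2):ℝ) = √(2*π)/2 := by
    rw [Real.sqrt_eq_iff_mul_self_eq (by positivity) (by positivity)]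
    have := Real.mul_self_sqrt (show 0 ≤ 2*π by positivity)
    nlinarith
  rw [J_Ups hl hμ hb]
  unfold G
  have p4 : (((lam^2:ℝ):ℂ))^((1:ℂ)/4) = ((lam^((1:ℝ)/2):ℝ):ℂ) := by
    rw [show ((1:ℂ)/4) = ((1/4:ℝ):ℂ) by push_cast; ring, ← Complex.ofReal_cpow (by positivity), ← Real.rpow_natCast, ← Real.rpow_mul hl.le]
    norm_num
  have p2 : (((lam^2:ℝ):ℂ))^((1:ℂ)/2) = (lam:ℂ) := by
    rw [show ((1:ℂ)/2) = ((1/2:ℝ):ℂ) by push_cast; ring, ← Complex.ofReal_cpow (by positivity), ← Real.rpow_natCast, ← Real.rpow_mul hl.le]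
    norm_num
  have hlp : ((lam^((1:ℝ)/2):ℝ):ℂ) ≠ 0 := by
    have : lam^((1:ℝ)/2) ≠ 0 := by positivity
    exact_mod_cast this
  rw [p4, p2, hrr]
  set R := ((√(2*π):ℝ):ℂ) with hR
  have hu : (lam:ℂ)^2*b + a - I*y*μ/(2*π) = lam * ((a/lam+b*lam:ℝ) + (-I/R)*y) := by
    rw [hμ]; push_cast; rw [← hR, ← hr2]; field_simp; ring
  rw [hu]
  set Y := Upsilon (lam * ((a/lam+b*lam:ℝ) + (-I/R)*y)) ((lam^2:ℝ):ℂ)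
  rw [Complex.ofReal_inv]
  set q := ((lam^((1:ℝ)/2):ℝ):ℂ)
  rw [show ∀ A B D : ℂ, q⁻¹ * A * (B * (q * D * Y)) = A*B*D*Y from fun A B D => by field_simp]
  congr 1
  rw [← Complex.exp_add, ← Complex.exp_add]
  congr 1
  rw [hμ]
  push_cast
  rw [← hR]
  have hp : (π:ℂ) = R^2/2 := by rw [hr2]; ring
  rw [hp]
  field_simp
  ring_nf
  have i3 : Complex.I^3 = -Complex.I := by rw [pow_succ, Complex.I_sq]; ring
  rw [i3, Complex.I_sq]; ring
end

section
open Filter Topology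

theorem gs_rec (n : ℕ) (t : ℂ) : iteratedDeriv (n+2) (fun t : ℂ => cexp (-t^2)) t = -2*t*iteratedDeriv (n+1) (fun t : ℂ => cexp (-t^2)) t - 2*(n+1)*iteratedDeriv n (fun t : ℂ => cexp (-t^2)) t := by
  have hcd : ContDiff ℂ ⊤ (fun t : ℂ => cexp (-t^2)) := by fun_prop
  have hd : ∀ m, Differentiable ℂ (iteratedDeriv m (fun t : ℂ => cexp (-t^2))) := fun m => hcd.differentiable_iteratedDeriv m (by exact_mod_cast WithTop.coe_lt_top _)
  have h1 : iteratedDeriv 1 (fun t : ℂ => cexp (-t^2)) = fun t => -2*t*cexp (-t^2) := by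
    rw [iteratedDeriv_one]; funext t
    have := ((hasDerivAt_pow 2 t).neg).cexp
    refine this.deriv.trans ?_; simp; ring
  induction n generalizing t with
  | zero =>
    rw [iteratedDeriv_succ, zero_add, h1]
    have := (((hasDerivAt_id t).const_mul (-2)).mul ((hasDerivAt_pow 2 t).neg).cexp)
    have := this.deriv
    simp only [id] at this
    rw [show (fun t : ℂ => -2*t*cexp (-t^2)) = ((fun y : ℂ => -2*y) * fun x : ℂ => cexp ((-fun x : ℂ => x^2) x)) from rfl, this]
    simp; ring
  | succ n ih =>
    rw [iteratedDeriv_succ]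
    have : iteratedDeriv (n+2) (fun t : ℂ => cexp (-t^2)) = fun t => -2*t*iteratedDeriv (n+1) (fun t : ℂ => cexp (-t^2)) t - 2*(n+1)*iteratedDeriv n (fun t : ℂ => cexp (-t^2)) t := funext ih
    rw [show n+1+1 = n+2 from rfl, this]
    have a1 := (hd (n+1) t).hasDerivAt
    have a0 := (hd n t).hasDerivAt
    rw [← iteratedDeriv_succ] at a1 a0
    have := ((((hasDerivAt_id t).const_mul (-2)).mul a1).sub (a0.const_mul (2*((n:ℂ)+1))))
    have := this.deriv
    simp only [id] at this
    refine Eq.trans this ?_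
    push_cast
    rw [show n+1+1 = n+2 from rfl]
    linear_combination (-2*t)*ih t

theorem gs_vals (j : ℕ) : iteratedDeriv (2*j) (fun t : ℂ => cexp (-t^2)) 0 = (-1)^j*(2*j).factorial/j.factorial ∧ iteratedDeriv (2*j+1) (fun t : ℂ => cexp (-t^2)) 0 = 0 := by
  induction j with
  | zero =>
    refine ⟨by simp, ?_⟩
    rw [mul_zero, zero_add, iteratedDeriv_one]
    have := ((hasDerivAt_pow 2 (0:ℂ)).neg).cexp
    refine this.deriv.trans ?_; simp
  | succ j ih =>
    rw [show 2*(j+1) = 2*j+2 by ring, show 2*j+2+1 = (2*j+1)+2 by ring, gs_rec, gs_rec, ih.1, ih.2]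
    refine ⟨?_, by simp⟩
    rw [Nat.factorial_succ (2*j+1), Nat.factorial_succ (2*j), Nat.factorial_succ j]
    have : (j.factorial:ℂ) ≠ 0 := by exact_mod_cast j.factorial_ne_zero
    have : (j:ℂ)+1 ≠ 0 := by exact_mod_cast j.succ_ne_zero
    push_cast
    field_simp; ring

theorem herm_iter (n : ℕ) (x : ℂ) : iteratedDeriv n (fun t => cexp (2*x*t - t^2)) 0 = hermiteH n x := by
  have : (fun t => cexp (2*x*t - t^2)) = fun t => cexp (-t^2) * cexp (2*x*t) := by
    funext t; rw [← Complex.exp_add]; ring_nf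
  rw [this, iteratedDeriv_fun_mul (by fun_prop) (by fun_prop)]
  unfold hermiteH
  rw [Finset.mul_sum]
  symm
  refine Finset.sum_of_injOn (fun j => 2*j) (fun i _ j _ h => by simpa using h) ?_ ?_ ?_
  · intro j hj
    simp only [Finset.coe_range, Set.mem_Iio] at hj ⊢
    omega
  · intro i hi hni
    obtain ⟨j, hj | hj⟩ := Nat.even_or_odd' i
    · exfalso; apply hni
      refine ⟨j, ?_, hj.symm⟩
      simp only [Finset.coe_range, Set.mem_Iio, Finset.mem_range] at hi ⊢
      omega
    · rw [hj, (gs_vals j).2]; simp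
  · intro j hj
    rw [Finset.mem_range] at hj
    have hjn : 2*j ≤ n := by omega
    rw [(gs_vals j).1, iteratedDeriv_cexp_const_mul]
    have h1 := Nat.choose_mul_factorial_mul_factorial hjn
    have h1' : (n.choose (2*j):ℂ) * (2*j).factorial * (n-2*j).factorial = n.factorial := by exact_mod_cast h1
    have z1 : (j.factorial:ℂ) ≠ 0 := by exact_mod_cast j.factorial_ne_zero
    have z2 : ((n-2*j).factorial:ℂ) ≠ 0 := by exact_mod_cast (n-2*j).factorial_ne_zero
    rw [← h1']
    simp only [mul_zero, Complex.exp_zero]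
    field_simp

theorem herm_scaled (n : ℕ) (κ c ω : ℂ) (hc : c^2 = I/4) (hω : 2*ω*c = κ) :
    iteratedDeriv n (fun y => cexp (κ*y - I*y^2/4)) 0 = c^n * hermiteH n ω := by
  have := iteratedDeriv_comp_const_mul (n := n) (f := fun t => cexp (2*ω*t - t^2)) (by fun_prop) c
  have h2 : (fun y => cexp (κ*y - I*y^2/4)) = fun y => cexp (2*ω*(c*y) - (c*y)^2) := by
    funext y; rw [← hω]; congr 1; linear_combination y^2*hc
  rw [h2, this]
  simp only [mul_zero]
  rw [herm_iter]

theorem G_iter (n : ℕ) (τ U d : ℂ) (hG : Differentiable ℂ (fun w => G w τ)) :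
    iteratedDeriv n (fun y => G (U + d*y) τ) 0 = d^n * Gderiv n U τ := by
  have hcd : ContDiff ℂ n (fun w => G w τ) := hG.contDiff
  have := iteratedDeriv_comp_const_mul (n := n) (f := fun z => G (U + z) τ) (hcd.comp (by fun_prop)) d
  rw [this]
  have h2 := iteratedDeriv_comp_const_add n (fun w => G w τ) U
  rw [h2]
  simp [Gderiv]
end

section
open Filter Topology

def Sk (a b lam : ℝ) (k : ℕ) : ℂ := ∑ r ∈ Finset.range (k + 1),
                  (Nat.choose k r : ℂ) *
                    Gderiv r ((a/lam + b*lam : ℝ) : ℂ) ((lam^2 : ℝ) : ℂ) *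
                    (Complex.exp ((π:ℂ)*I*((k:ℂ) - 3*(r:ℂ))/4) /
                      ((2:ℂ)^(k-r) * ((((2*π) ^ ((r:ℝ)/2) : ℝ)) : ℂ))) *
                    hermiteH (k - r)
                      (Complex.exp (-(π:ℂ)*I/4) * (Real.sqrt (π/2) : ℂ) *
                        ((a/lam - b*lam : ℝ) : ℂ))

def K0 (a b lam : ℝ) (n : ℕ) : ℂ := (((lam^((1:ℝ)/2))⁻¹:ℝ):ℂ) * cexp (2*π*I*a*n - I*π*lam^2*b^2 + π*I*(a/lam+b*lam)^2/2 - π*I/8)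

theorem K0_ne {a b lam : ℝ} {n : ℕ} (hl : 0 < lam) : K0 a b lam n ≠ 0 := by
  unfold K0
  refine mul_ne_zero ?_ (Complex.exp_ne_zero _)
  have : (lam^((1:ℝ)/2))⁻¹ ≠ 0 := by positivity
  exact_mod_cast this

theorem G_diff {a b β μ lam Kb : ℝ} {n : ℕ} (hl : 0 < lam) (hμ : μ = √(2*π)*lam) (hb : b = β - n)
    (hK : ∀ v, ‖Kf a (β + wl (μ*(n+1/2-β)) v/μ)‖ ≤ Kb) : Differentiable ℂ (fun w => G w ((lam^2:ℝ):ℂ)) := by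
  have hr0 : ((√(2*π):ℝ):ℂ) ≠ 0 := by
    have : √(2*π) ≠ 0 := by positivity
    exact_mod_cast this
  have hJ : Differentiable ℂ (Jk a β μ (μ*(n+1/2-β)) 0) := fun y => (Jk_deriv hK 0 y).differentiableAt
  have hk := K0_ne (a := a) (b := b) (n := n) hl
  have : (fun w => G w ((lam^2:ℝ):ℂ)) = fun w => (K0 a b lam n)⁻¹ * (cexp (-((√(π/2):ℝ)*(a/lam-b*lam)*(I*(√(2*π):ℝ)*(w-(a/lam+b*lam:ℝ))) - I*(I*(√(2*π):ℝ)*(w-(a/lam+b*lam:ℝ)))^2/4)) * Jk a β μ (μ*(n+1/2-β)) 0 (I*(√(2*π):ℝ)*(w-(a/lam+b*lam:ℝ)))) := by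
    funext w
    set y := I*(√(2*π):ℝ)*(w-(a/lam+b*lam:ℝ)) with hy
    rw [J_eval hl hμ hb]
    have hw : ((a/lam+b*lam:ℝ):ℂ) + (-I/(√(2*π):ℝ))*y = w := by
      rw [hy]; field_simp; rw [Complex.I_sq]; ring
    rw [hw, Complex.exp_neg]
    have h3 := Complex.exp_ne_zero ((√(π/2):ℝ)*(a/lam-b*lam)*y - I*y^2/4)
    change _ = _ * (_ * (K0 a b lam n * _))
    set e := cexp ((√(π/2):ℝ)*(a/lam-b*lam)*y - I*y^2/4)
    field_simp
  rw [this]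
  fun_prop

theorem J_iter_eval {a b β μ lam Kb : ℝ} {n : ℕ} (hl : 0 < lam) (hμ : μ = √(2*π)*lam) (hb : b = β - n)
    (hK : ∀ v, ‖Kf a (β + wl (μ*(n+1/2-β)) v/μ)‖ ≤ Kb) (k : ℕ) :
    iteratedDeriv k (Jk a β μ (μ*(n+1/2-β)) 0) 0 = K0 a b lam n * Sk a b lam k := by
  have hG := G_diff hl hμ hb hK
  have hGc : ContDiff ℂ k (fun y => G ((a/lam+b*lam:ℝ) + (-I/(√(2*π):ℝ))*y) ((lam^2:ℝ):ℂ)) := by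
    have : ContDiff ℂ k (fun w => G w ((lam^2:ℝ):ℂ)) := hG.contDiff
    exact this.comp (by fun_prop)
  have e0 : Jk a β μ (μ*(n+1/2-β)) 0 = fun y => K0 a b lam n * (G ((a/lam+b*lam:ℝ) + (-I/(√(2*π):ℝ))*y) ((lam^2:ℝ):ℂ) * cexp ((√(π/2):ℝ)*(a/lam-b*lam)*y - I*y^2/4)) := by
    funext y; rw [J_eval hl hμ hb]; unfold K0; ring
  rw [e0, iteratedDeriv_const_mul_field, iteratedDeriv_fun_mul hGc.contDiffAt (by fun_prop)]
  congr 1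
  unfold Sk
  refine Finset.sum_congr rfl fun r hr => ?_
  have hrk : r ≤ k := by rw [Finset.mem_range] at hr; omega
  rw [G_iter _ _ _ _ hG, herm_scaled (k-r) _ (cexp (π*I/4)/2) (cexp (-(π:ℂ)*I/4) * (√(π/2):ℝ) * (a/lam-b*lam:ℝ))]
  · have hd : (-I:ℂ) = cexp (-(π*I/2)) := by
      rw [show -((π:ℂ)*I/2) = -(π/2*I) by ring, Complex.exp_neg, Complex.exp_pi_div_two_mul_I]; simp
    have h2 : (((2*π)^((r:ℝ)/2):ℝ):ℂ) = ((√(2*π):ℝ):ℂ)^r := by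
      rw [Real.sqrt_eq_rpow, ← Complex.ofReal_pow, ← Real.rpow_natCast, ← Real.rpow_mul (by positivity)]
      congr 2; ring
    have h3 : cexp ((π:ℂ)*I*((k:ℂ)-3*(r:ℂ))/4) = cexp (-(π*I/2))^r * cexp (π*I/4)^(k-r) := by
      rw [← Complex.exp_nat_mul, ← Complex.exp_nat_mul, ← Complex.exp_add, Nat.cast_sub hrk]
      congr 1; ring
    rw [h2, h3, hd, div_pow, div_pow]
    field_simp
  · rw [div_pow, ← Complex.exp_nat_mul, show ((2:ℕ):ℂ)*(π*I/4) = π/2*I by push_cast; ring, Complex.exp_pi_div_two_mul_I]; norm_num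
  · have : cexp (-(π:ℂ)*I/4) * cexp (π*I/4) = 1 := by
      rw [← Complex.exp_add, ← Complex.exp_zero]; congr 1; ring
    push_cast
    linear_combination ((√(π/2):ℝ):ℂ) * (a/lam-b*lam) * this

theorem mainI_eval {a b β μ lam ε w0 : ℝ} {n : ℕ} (hl : 0 < lam) (hμ : μ = √(2*π)*lam) (hb : b = β - n)
    (ha0 : 0 ≤ a) (ha1 : a ≤ 1) (hε : 0 < ε) (hε2 : ε ≤ 1/2) 
    (h1 : n + ε ≤ β + w0/μ) (h2 : β + w0/μ ≤ n + 1 - ε) (ak : ℕ → ℂ) (N : ℕ) :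
    ∫ v, mainI a β μ ak N w0 v = K0 a b lam n * ∑ k ∈ Finset.range N, ak k * Sk a b lam k := by
  have hμ0 : 0 < μ := by rw [hμ]; positivity
  have hx : β + (μ*(n+1/2-β))/μ = n+1/2 := by field_simp; ring
  have h3 : n + ε ≤ β + (μ*(n+1/2-β))/μ := by rw [hx]; linarith
  have h4 : β + (μ*(n+1/2-β))/μ ≤ n+1-ε := by rw [hx]; linarith
  rw [mainI_sum (K_line ha0 ha1 hε hε2 hμ0 h1 h2), Finset.mul_sum]
  refine Finset.sum_congr rfl fun k _ => ?_
  have : Jk a β μ w0 0 = Jk a β μ (μ*(n+1/2-β)) 0 := funext fun y => line_shift ha0 ha1 hε hε2 hμ0 h1 h2 h3 h4 y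
  rw [this, J_iter_eval hl hμ hb (K_line ha0 ha1 hε hε2 hμ0 h3 h4)]
  ring

theorem const_eq {s : ℂ} {α β lam a b : ℝ} {m n : ℕ} (hα : 1 ≤ α) (hβ : 1 ≤ β) (ht : s.im = 2*π*α*β) (hlam : lam = √(α/β))
    (ha : α = m + a) (hb : β = n + b) :
    (-1:ℂ)^(m*n) * (((2*π/s.im) ^ ((1:ℝ)/4) : ℝ) : ℂ) * (lam : ℂ) ^ ((1:ℂ)/2 - s) *
              Complex.exp ((π:ℂ) * I / 2 *
                ((2*a*β - 2*b*α + a^2/lam^2 - b^2*lam^2 : ℝ) : ℂ)) *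
              Complex.exp ((s/2 - 1/4) * (Real.log (s.im/(2*π)) : ℂ)
                - I*(s.im:ℂ)/2 - I*(π:ℂ)/8) = (β:ℂ)^(s-1) * cexp (-(I*s.im)) * K0 a b lam n := by
  have hα0 : 0 < α := by linarith
  have hβ0 : 0 < β := by linarith
  have hl : 0 < lam := by rw [hlam]; positivity
  have hlc : (lam:ℂ) ≠ 0 := by exact_mod_cast hl.ne'
  have hβc : (β:ℂ) ≠ 0 := by exact_mod_cast hβ0.ne'
  have hll : Real.log lam = (Real.log α - Real.log β)/2 := by
    rw [hlam, Real.log_sqrt (by positivity), Real.log_div hα0.ne' hβ0.ne']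
  have e1 : Real.log (s.im/(2*π)) = Real.log α + Real.log β := by
    rw [ht, show 2*π*α*β/(2*π) = α*β by field_simp, Real.log_mul hα0.ne' hβ0.ne']
  have e2 : (((2*π/s.im) ^ ((1:ℝ)/4) : ℝ) : ℂ) = cexp (-(Real.log α + Real.log β)/4) := by
    rw [ht, show 2*π/(2*π*α*β) = (α*β)⁻¹ by field_simp, Real.rpow_def_of_pos (by positivity), Real.log_inv, Real.log_mul hα0.ne' hβ0.ne']
    push_cast; congr 1; ring
  have e3 : (lam : ℂ) ^ ((1:ℂ)/2 - s) = cexp ((Real.log α - Real.log β)/2 * (1/2 - s)) := by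
    rw [Complex.cpow_def_of_ne_zero hlc, ← Complex.ofReal_log hl.le, hll]; push_cast; rfl
  have e4 : (β:ℂ)^(s-1) = cexp (Real.log β * (s-1)) := by
    rw [Complex.cpow_def_of_ne_zero hβc, ← Complex.ofReal_log hβ0.le]
  have e5 : (((lam^((1:ℝ)/2))⁻¹:ℝ):ℂ) = cexp (-(Real.log α - Real.log β)/4) := by
    rw [← Real.rpow_neg hl.le, Real.rpow_def_of_pos hl, hll]
    push_cast; congr 1; ring
  have e6 : (-1:ℂ)^(m*n) = cexp (-(π*I*m*n)) := by
    rw [← Complex.exp_pi_mul_I, ← Complex.exp_nat_mul, Complex.exp_eq_exp_iff_exists_int]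
    refine ⟨m*n, ?_⟩
    push_cast; ring
  unfold K0
  rw [e1, e2, e3, e4, e5, e6, ht, ha, hb]
  simp only [← Complex.exp_add]
  congr 1
  push_cast
  field_simp
  ring
end

section
open Filter Topology

theorem absorb2 (M : ℝ) (N : ℕ) : ∃ C : ℝ, 0 ≤ C ∧ ∀ (σ β t τ : ℝ), |σ| ≤ M → 1 ≤ β → β ≤ t → 1 ≤ τ → t = τ^6 →
    t^(M+2) * rexp (-(t/16)) ≤ C * (β^(σ-1)/τ^N) := by
  obtain ⟨C, hC, h⟩ := exp_absorb (M+2 + (M+1) + N)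
  refine ⟨C, hC, fun σ β t τ hσ hβ hβt hτ ht => ?_⟩
  have ht1 : 1 ≤ t := hβ.trans hβt
  have ht0 : 0 < t := by linarith
  have hβ0 : 0 < β := by linarith
  have h1 : β^(1-σ) ≤ t^(M+1) := rpow_two_sided ht1 (le_trans (by rw [div_le_one ht0]; exact ht1) hβ) hβt (by
    have := abs_sub 1 σ; rw [abs_one] at this; linarith)
  have h2 : τ^N ≤ t^(N:ℝ) := by
    rw [Real.rpow_natCast]
    gcongr
    rw [ht]; exact le_self_pow₀ hτ (by norm_num)
  have h3 := h t ht1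
  rw [Real.rpow_add ht0, Real.rpow_add ht0] at h3
  have h4 : rexp (-(t/16)) ≤ rexp (-(t/32)) := Real.exp_le_exp.2 (by linarith)
  have h5 : β^(σ-1) = (β^(1-σ))⁻¹ := by rw [← Real.rpow_neg hβ0.le]; ring_nf
  rw [h5, inv_eq_one_div, div_div, mul_one_div, le_div_iff₀ (by positivity)]
  calc _ ≤ t^(M+2)*rexp (-(t/32)) * (t^(M+1) * t^(N:ℝ)) := by gcongr
    _ = t^(M+2)*t^(M+1)*t^(N:ℝ) * rexp (-(t/32)) := by ring
    _ ≤ C := h3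

theorem S_bound {s : ℂ} {M β t : ℝ} {n : ℕ} (hM : |s.re| ≤ M) (hβ : 1 ≤ β) (hn : (n:ℝ) ≤ β) (hβt : β ≤ t) :
    ‖∑ k ∈ Finset.Icc 1 n, (k:ℂ)^(s-1)‖ ≤ t^(M+2) := by
  have ht1 : 1 ≤ t := hβ.trans hβt
  calc _ ≤ ∑ k ∈ Finset.Icc 1 n, t^(M+1) := by
        refine norm_sum_le_of_le _ fun k hk => ?_
        rw [Finset.mem_Icc] at hk
        have hk1 : (1:ℝ) ≤ k := by exact_mod_cast hk.1
        have hk2 : (k:ℝ) ≤ n := by exact_mod_cast hk.2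
        have : ((k:ℕ):ℂ) = ((k:ℝ):ℂ) := by simp
        rw [this, Complex.norm_cpow_eq_rpow_re_of_pos (by linarith)]
        refine rpow_two_sided ht1 (le_trans (by rw [div_le_one (by linarith)]; exact ht1) hk1) (by linarith) ?_
        have := abs_sub s.re 1; rw [abs_one] at this; simp only [Complex.sub_re, Complex.one_re]; linarith
    _ = n * t^(M+1) := by simp
    _ ≤ t * t^(M+1) := by gcongr; linarith
    _ = t^(M+2) := by
      rw [show M+2 = 1 + (M+1) by ring, Real.rpow_add (by linarith) 1 (M+1), Real.rpow_one]

set_option maxHeartbeats 1000000 in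
theorem bracket (M : ℝ) (N : ℕ) (lam₀ : ℝ) (hl0 : 0 < lam₀) : ∃ C : ℝ, 0 ≤ C ∧ ∀ (s : ℂ) (τ : ℝ) (ak : ℕ → ℂ) (α β lam a b : ℝ) (m n : ℕ),
    |s.re| ≤ M → 2*π ≤ s.im → 1 ≤ α → 1 ≤ β → s.im = 2*π*α*β → lam = √(α/β) → α = m + a → β = n + b → 0 ≤ a → a ≤ 1 → 0 ≤ b → b ≤ 1 →
    lam₀ ≤ lam → IsAk s ak → 1 ≤ τ → s.im = τ^6 →
    ∃ X : ℂ, riemannZeta s - ∑ k ∈ Finset.Icc 1 m, (k:ℂ)^(-s) - chi s * ∑ k ∈ Finset.Icc 1 n, (k:ℂ)^(s-1)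
      - Efac s/Complex.Gamma s/(cexp (2*π*I*s) - 1) * ((β:ℂ)^(s-1) * cexp (-(I*s.im)) * (K0 a b lam n * ∑ k ∈ Finset.range N, ak k * Sk a b lam k))
      = Efac s/Complex.Gamma s * X ∧ ‖X‖ ≤ C * (β^(s.re-1)/τ^N) := by
  obtain ⟨C1, hC1, hE1⟩ := E1_bound M
  obtain ⟨C2, hC2, hL⟩ := line_est M N
  obtain ⟨C3, hC3, hA⟩ := absorb2 M N
  set ε0 := min (lam₀/2) 0.19 with hε0
  have hε00 : 0 < ε0 := by rw [hε0]; apply lt_min <;> [linarith; norm_num]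
  have hε01 : ε0 ≤ lam₀/2 := min_le_left _ _
  have hε02 : ε0 ≤ 0.19 := min_le_right _ _
  refine ⟨(C1 + 2 + 4*7^(M+1) + 2*(C2/ε0)) * C3 + C2/ε0, by positivity, ?_⟩
  intro s τ ak α β lam a b m n hM ht hα hβ hab hlam ham hbn ha0 ha1 hb0 hb1 hll hak hτ htτ
  have hpi := Real.pi_gt_three
  have hpi4 := Real.pi_lt_d2
  have ht1 : 1 ≤ s.im := by linarith
  have ht0 : 0 < s.im := by linarith
  have hα0 : 0 < α := by linarith
  have hβ0 : 0 < β := by linarith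
  have hl : 0 < lam := by linarith
  set μ := √(2*π)*lam with hμ
  have hμ0 : 0 < μ := by positivity
  have hsq : √s.im^2 = s.im := Real.sq_sqrt ht0.le
  have hlam2 : lam^2 = α/β := by rw [hlam, Real.sq_sqrt (by positivity)]
  have hr2 : √(2*π)^2 = 2*π := Real.sq_sqrt (by positivity)
  have hμ2 : μ^2 = 2*π*(α/β) := by rw [hμ, mul_pow, hr2, hlam2]
  have hβμ : β*μ = √s.im := by
    symm
    rw [Real.sqrt_eq_iff_mul_self_eq ht0.le (by positivity)]
    rw [show β*μ*(β*μ) = β^2*μ^2 by ring, hμ2, hab]; field_simp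
  have h2α : 2*π*α = √s.im*μ := by
    rw [← hβμ, show β*μ*μ = β*μ^2 by ring, hμ2]; field_simp
  have hτ3 : √s.im = τ^3 := by
    rw [Real.sqrt_eq_iff_mul_self_eq ht0.le (by positivity), htτ]; ring
  have hr25 : 2.5 ≤ √(2*π) := by
    apply Real.le_sqrt_of_sq_le; linarith [Real.pi_gt_d2]
  have hr26 : √(2*π) ≤ 2.6 := by
    rw [Real.sqrt_le_left (by norm_num)]; linarith
  have hst : 2.5 ≤ √s.im := hr25.trans (Real.sqrt_le_sqrt ht)
  set ε := ε0/lam with hε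
  have hε' : 0 < ε := by positivity
  have hε2 : ε ≤ 1/2 := by rw [hε, div_le_iff₀ hl]; linarith
  have hεl : ε*lam = ε0 := by rw [hε]; field_simp
  obtain ⟨x0, hx1, hx2, hx3⟩ : ∃ x0 : ℝ, n + ε ≤ x0 ∧ x0 ≤ n + 1 - ε ∧ |x0 - β| ≤ ε := by
    by_cases c1 : b ≤ ε
    · refine ⟨n+ε, le_rfl, by linarith, ?_⟩
      rw [abs_le]; constructor <;> linarith
    · by_cases c2 : b ≤ 1 - ε
      · refine ⟨β, by linarith, by linarith, ?_⟩
        simp [hε'.le]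
      · refine ⟨n+1-ε, by linarith, le_rfl, ?_⟩
        rw [abs_le]; constructor <;> linarith
  have hw0 : |μ*(x0-β)| ≤ 1/2 := by
    rw [abs_mul, abs_of_pos hμ0]
    calc _ ≤ μ*ε := by gcongr
      _ = √(2*π)*ε0 := by rw [hμ, ← hεl]; ring
      _ ≤ 2.6*0.19 := by gcongr
      _ ≤ _ := by norm_num
  have hx5 : |x0-β| ≤ β/5 := by
    rw [abs_mul, abs_of_pos hμ0] at hw0
    have h6 : 2.5*(μ*|x0-β|) ≤ β*μ/2 := by rw [hβμ]; linarith
    have : μ*|x0-β| ≤ μ*(β/5) := by linarith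
    exact le_of_mul_le_mul_left this hμ0
  have hw : β + (μ*(x0-β))/μ = x0 := by field_simp; ring
  obtain ⟨_, hi, hmn, hdf⟩ := hL s τ ak α β μ a ε x0 m n hτ htτ hτ3 ht hM hak hβ0 hμ0 hβμ h2α (by linarith) ha0 ha1 hε' hε2 (by exact_mod_cast hx1) (by exact_mod_cast hx2) hw0
  have hme : C2/(μ*ε) ≤ C2/ε0 := by
    have : μ*ε = √(2*π)*ε0 := by rw [hμ, ← hεl]; ring
    rw [this]
    gcongr
    exact le_mul_of_one_le_left hε00.le (by linarith)
  obtain ⟨Q, hQ⟩ := gfun_prim s m n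
  have hcl := contour_line s ht0 m n hμ0 (by linarith) (by linarith) hQ hi
  have hsegp : (x0:ℂ) + (-1+I)*((√s.im/2:ℝ):ℂ)/μ = (x0 - β/2 : ℝ) + (β/2:ℝ)*I := by
    have hμc : (μ:ℂ) ≠ 0 := by exact_mod_cast hμ0.ne'
    rw [← hβμ]; push_cast; field_simp; ring
  have hma : (m:ℝ) ≤ α := by linarith
  have hβt : β ≤ s.im := by
    have q1 : 1 ≤ 2*π*α := by
      have := one_le_mul_of_one_le_of_one_le (by linarith : 1 ≤ 2*π) hα
      linarith
    rw [hab]; exact le_mul_of_one_le_left hβ0.le q1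
  have hseg := seg_bound hM ht hβ hα hab hma hx5 hQ
  rw [hsegp] at hcl
  have hev := mainI_eval (μ := μ) (w0 := μ*(x0-β)) (β := β) (n := n) hl hμ (show b = β - n by linarith) ha0 ha1 hε' hε2 (by rw [hw]; exact hx1) (by rw [hw]; exact hx2) ak N
  rw [← hev, hcl, chi_eq ht0]
  have hab6 : (m:ℝ) ≤ s.im/6 := by
    have q1 : α*1 ≤ α*β := mul_le_mul_of_nonneg_left hβ hα0.le
    have q2 : 3*(α*β) ≤ π*(α*β) := mul_le_mul_of_nonneg_right hpi.le (by positivity)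
    rw [hab]; linarith
  have b1 := hE1 m s hM ht1 hab6
  have b2 := S_bound hM hβ (by linarith : (n:ℝ) ≤ β) hβt
  have l1 := exp2pis_low ht1
  have l2 := exppis_low ht1
  have n1 := exp2pis_norm s
  have n2 := exppis_norm s
  set E1 := hLoop2 m s/((cexp (2*π*I*s) - 1) * Efac s)
  set S := ∑ k ∈ Finset.Icc 1 n, (k:ℂ)^(s-1)
  set II := ∫ v in Set.Iic (√s.im/2), (-1+I)/μ * gfun s m (x0 + (-1+I)*v/μ)
  set MI := ∫ v : ℝ, mainI a β μ ak N (μ*(x0-β)) v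
  set Sg := Q ((x0 - β/2 : ℝ) + (β/2:ℝ)*I) - Q (I/(2*π))
  set D := Efac s/Complex.Gamma s
  set e := cexp (2*π*I*s)
  set e1 := cexp (π*I*s)
  set Mn := (β:ℂ)^(s-1) * cexp (-(I*s.im)) * MI with hMn
  have ne1 : e - 1 ≠ 0 := by rw [← norm_pos_iff]; linarith
  have ne2 : 1 + e1 ≠ 0 := by rw [← norm_pos_iff]; linarith
  refine ⟨E1 + S*(e1/(1+e1)) + Sg - (II - Mn) - Mn*(e/(e-1)), by field_simp; ring, ?_⟩
  have hexp : rexp (-(s.im/16)) ≤ 1 := Real.exp_le_one_iff.2 (by linarith)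
  have hT1 : 1 ≤ s.im^(M+2) := Real.one_le_rpow ht1 (by linarith [abs_nonneg s.re])
  set T := s.im^(M+2) * rexp (-(s.im/16)) with hT
  have x1 : ‖E1‖ ≤ C1 * T := by
    refine b1.trans ?_
    gcongr
    calc rexp (-s.im) ≤ 1 * rexp (-(s.im/16)) := by rw [one_mul]; exact Real.exp_le_exp.2 (by linarith)
      _ ≤ T := by rw [hT]; gcongr
  have x2 : ‖S*(e1/(1+e1))‖ ≤ 2 * T := by
    rw [norm_mul, norm_div, n2]
    calc _ ≤ s.im^(M+2) * (rexp (-(s.im/16))/(1/2)) := by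
          gcongr
          linarith [mul_le_mul_of_nonneg_right hpi.le ht0.le]
      _ = _ := by rw [hT]; ring
  have hMnn : 0 ≤ M := (abs_nonneg _).trans hM
  have hβM : β * β^(M+1) ≤ s.im^(M+2) := by
    calc _ = β^(M+2) := by rw [show M+2 = 1+(M+1) by ring, Real.rpow_add hβ0 1 (M+1), Real.rpow_one]
      _ ≤ _ := by gcongr
  have x3 : ‖Sg‖ ≤ 4*7^(M+1) * T := by
    refine hseg.trans ?_
    rw [Real.mul_rpow (by norm_num) hβ0.le]
    calc _ = 4*7^(M+1) * ((β*β^(M+1)) * rexp (-(s.im/16))) := by ring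
      _ ≤ _ := by rw [hT]; gcongr
  have hMnb : ‖Mn‖ ≤ s.im^(M+2) * (C2/ε0) := by
    rw [hMn, norm_mul, norm_mul]
    have : ‖cexp (-(I*s.im))‖ = 1 := by
      rw [show -(I*(s.im:ℂ)) = ((-s.im:ℝ):ℂ)*I by push_cast; ring, Complex.norm_exp_ofReal_mul_I]
    rw [this, mul_one, Complex.norm_cpow_eq_rpow_re_of_pos hβ0]
    gcongr
    · refine rpow_two_sided ht1 (le_trans (by rw [div_le_one (by linarith)]; exact ht1) hβ) hβt ?_
      have := abs_sub s.re 1; rw [abs_one] at this; simp only [Complex.sub_re, Complex.one_re]; linarith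
    · exact hmn.trans hme
  have x4 : ‖Mn*(e/(e-1))‖ ≤ 2*(C2/ε0) * T := by
    rw [norm_mul, norm_div, n1]
    calc _ ≤ (s.im^(M+2) * (C2/ε0)) * (rexp (-(s.im/16))/(1/2)) := by
          gcongr
          linarith [mul_le_mul_of_nonneg_right hpi.le ht0.le]
      _ = _ := by rw [hT]; ring
  have x5 : ‖II - Mn‖ ≤ C2/ε0 * (β^(s.re-1)/τ^N) := by
    refine hdf.trans ?_
    calc _ ≤ β^(s.re-1) * (C2/ε0/τ^N) := by gcongr
      _ = _ := by ring
  have hTb := hA s.re β s.im τ hM hβ hβt hτ htτ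
  rw [← hT] at hTb
  calc _ ≤ ‖E1‖ + ‖S*(e1/(1+e1))‖ + ‖Sg‖ + ‖II - Mn‖ + ‖Mn*(e/(e-1))‖ :=
        (norm_sub_le _ _).trans (add_le_add_left ((norm_sub_le _ _).trans (add_le_add_left (norm_add₃_le) _)) _)
    _ ≤ (C1 + 2 + 4*7^(M+1) + 2*(C2/ε0)) * T + C2/ε0 * (β^(s.re-1)/τ^N) := by linarith
    _ ≤ (C1 + 2 + 4*7^(M+1) + 2*(C2/ε0)) * (C3 * (β^(s.re-1)/τ^N)) + C2/ε0 * (β^(s.re-1)/τ^N) := by gcongr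
    _ = _ := by ring
end

section
open Filter Topology

theorem fin_real {σ M α β lam t τ : ℝ} {N : ℕ} (hM : |σ| ≤ M) (hα : 1 ≤ α) (hβ : 1 ≤ β) (ht : t = 2*π*α*β)
    (hlam : lam = √(α/β)) (hτ : τ = t^((1:ℝ)/6)) :
    t^(1/2-σ) * (β^(σ-1)/τ^N) ≤ (2*π)^((M+1)/2) * (lam^(1-σ) * t^(-σ/2-(N:ℝ)/6)) := by
  have hα0 : 0 < α := by linarith
  have hβ0 : 0 < β := by linarith
  have hp : 0 < 2*π := by positivity
  have ht0 : 0 < t := by rw [ht]; positivity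
  have hl : 0 < lam := by rw [hlam]; positivity
  have hlog : Real.log lam = (Real.log α - Real.log β)/2 := by
    rw [hlam, Real.log_sqrt (by positivity), Real.log_div hα0.ne' hβ0.ne']
  have hlt : Real.log t = Real.log (2*π) + Real.log α + Real.log β := by
    rw [ht, Real.log_mul (by positivity) hβ0.ne', Real.log_mul hp.ne' hα0.ne']
  have hτN : τ^N = t^((N:ℝ)/6) := by
    rw [hτ, ← Real.rpow_natCast, ← Real.rpow_mul ht0.le]; ring_nf
  rw [hτN, Real.rpow_def_of_pos ht0, Real.rpow_def_of_pos ht0, Real.rpow_def_of_pos ht0, Real.rpow_def_of_pos hβ0,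
    Real.rpow_def_of_pos hl, Real.rpow_def_of_pos hp, ← Real.exp_sub, ← Real.exp_add, ← Real.exp_add, ← Real.exp_add, hlog]
  apply Real.exp_le_exp.2
  have h1 : 0 ≤ Real.log (2*π) := Real.log_nonneg (by linarith [Real.pi_gt_three])
  have h2 : 0 ≤ Real.log (2*π) * ((M + σ)/2) := mul_nonneg h1 (by linarith [neg_le_of_abs_le hM])
  rw [hlt]
  linarith
end

theorem statement5 (A B : ℝ) (N : ℕ) (lam₀ : ℝ) (hlam₀ : 0 < lam₀) :
    ∃ C : ℝ, ∀ s : ℂ, s.re ∈ Set.Icc A B → 2 * π ≤ s.im →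
      ∀ α β : ℝ, 1 ≤ α → 1 ≤ β → s.im = 2 * π * α * β →
      ∀ lam a b : ℝ, lam = Real.sqrt (α/β) → a = Int.fract α → b = Int.fract β →
      lam₀ ≤ lam →
      ∀ ak : ℕ → ℂ, IsAk s ak →
        ‖riemannZeta s - zetaSum α s - chi s * zetaSum β (1 - s)
            - (-1:ℂ)^(⌊α⌋₊ * ⌊β⌋₊) *
              (((2*π : ℝ):ℂ)^s * Complex.exp ((π:ℂ)*I*s/2) /
                (Complex.Gamma s * (Complex.exp (2*(π:ℂ)*I*s) - 1))) *
              (((2*π/s.im) ^ ((1:ℝ)/4) : ℝ) : ℂ) * (lam : ℂ) ^ ((1:ℂ)/2 - s) *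
              Complex.exp ((π:ℂ) * I / 2 *
                ((2*a*β - 2*b*α + a^2/lam^2 - b^2*lam^2 : ℝ) : ℂ)) *
              Complex.exp ((s/2 - 1/4) * (Real.log (s.im/(2*π)) : ℂ)
                - I*(s.im:ℂ)/2 - I*(π:ℂ)/8) *
              ∑ k ∈ Finset.range N, ak k *
                ∑ r ∈ Finset.range (k + 1),
                  (Nat.choose k r : ℂ) *
                    Gderiv r ((a/lam + b*lam : ℝ) : ℂ) ((lam^2 : ℝ) : ℂ) *
                    (Complex.exp ((π:ℂ)*I*((k:ℂ) - 3*(r:ℂ))/4) /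
                      ((2:ℂ)^(k-r) * ((((2*π) ^ ((r:ℝ)/2) : ℝ)) : ℂ))) *
                    hermiteH (k - r)
                      (Complex.exp (-(π:ℂ)*I/4) * (Real.sqrt (π/2) : ℂ) *
                        ((a/lam - b*lam : ℝ) : ℂ))‖
          ≤ C * lam ^ (1 - s.re) * s.im ^ (-s.re/2 - (N:ℝ)/6) := by
  obtain ⟨C, hC, hB⟩ := bracket (max |A| |B|) N lam₀ hlam₀
  obtain ⟨C', hC', hD⟩ := D_bound A B
  refine ⟨C' * C * (2*π)^((max |A| |B| + 1)/2), ?_⟩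
  intro s hs ht α β hα hβ hab lam a b hlam ha hb hll ak hak
  have hpi := Real.pi_gt_three
  have ht1 : 1 ≤ s.im := by linarith
  have hM : |s.re| ≤ max |A| |B| := by
    rw [abs_le]
    constructor
    · have := neg_abs_le A; have := le_max_left |A| |B|; linarith [hs.1]
    · have := le_abs_self B; have := le_max_right |A| |B|; linarith [hs.2]
  have ham : α = (⌊α⌋₊:ℝ) + a := by
    rw [ha, natCast_floor_eq_intCast_floor (by linarith)]; exact (Int.floor_add_fract α).symm
  have hbn : β = (⌊β⌋₊:ℝ) + b := by
    rw [hb, natCast_floor_eq_intCast_floor (by linarith)]; exact (Int.floor_add_fract β).symm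
  have hτ6 : s.im = (s.im^((1:ℝ)/6))^6 := by
    rw [← Real.rpow_natCast, ← Real.rpow_mul (by linarith)]; norm_num
  obtain ⟨X, hX, hXb⟩ := hB s (s.im^((1:ℝ)/6)) ak α β lam a b ⌊α⌋₊ ⌊β⌋₊ hM ht hα hβ hab hlam ham hbn
    (by rw [ha]; exact Int.fract_nonneg α) (by rw [ha]; exact (Int.fract_lt_one α).le)
    (by rw [hb]; exact Int.fract_nonneg β) (by rw [hb]; exact (Int.fract_lt_one β).le)
    hll hak (Real.one_le_rpow ht1 (by norm_num)) hτ6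
  have hce := const_eq hα hβ hab hlam ham hbn
  have key := norm_mul_le (Efac s/Complex.Gamma s) X
  rw [← hX] at key
  have hle : ‖Efac s/Complex.Gamma s‖ * ‖X‖ ≤ C' * C * (2*π)^((max |A| |B| + 1)/2) * lam ^ (1 - s.re) * s.im ^ (-s.re/2 - (N:ℝ)/6) := by
    have h1 := hD s hs.1 hs.2 ht1
    have h2 := fin_real (N := N) hM hα hβ hab hlam rfl
    calc _ ≤ (C' * s.im^(1/2 - s.re)) * (C * (β^(s.re-1)/(s.im^((1:ℝ)/6))^N)) := by gcongr
      _ = C' * C * (s.im^(1/2 - s.re) * (β^(s.re-1)/(s.im^((1:ℝ)/6))^N)) := by ring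
      _ ≤ C' * C * ((2*π)^((max |A| |B| + 1)/2) * (lam ^ (1 - s.re) * s.im ^ (-s.re/2 - (N:ℝ)/6))) := by gcongr
      _ = _ := by ring
  refine le_trans (le_of_eq ?_) (key.trans hle)
  congr 1
  unfold zetaSum
  rw [neg_sub]
  congr 1
  rw [show ∀ x y : ℂ, (β:ℂ)^(s-1) * cexp (-(I*s.im)) * (x * y) = ((β:ℂ)^(s-1) * cexp (-(I*s.im)) * x) * y from fun x y => by ring, ← hce]
  have assoc : ∀ p q c l e1 e2 G d S : ℂ, p * (q/(G*d)) * c * l * e1 * e2 * S = q/G/d*((p*c*l*e1*e2)*S) := by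
    intro p q c l e1 e2 G d S
    rw [← div_div]; ring
  exact assoc _ _ _ _ _ _ _ _ _


end
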